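/- Assume additionally, for a constant M ≥ 1: each a_{ij} is twice continuously differentiable on B₁ × ℝ with |∇_x a_{ij}| + |∂_z a_{ij}| ≤ Λ₁ and |∇²_x a_{ij}| + |∇_x ∂_z a_{ij}| + |∂²_z a_{ij}| ≤ Λ₂ for constants Λ₁, Λ₂ > 0; ρ is C¹ on B₁ × ℝ with C¹-norm at most M; f ∈ C^{1/3}(B₁) with Hölder-1/3 seminorm at most M; F(x,z,p) = Σ_{i,j} c_{ij}(x,z) pᵢpⱼ + Σ_i c_i(x,z) pᵢ + c₀(x,z), where c_{ij}, c_i, c₀ are C¹ on B₁ × ℝ with C¹-norms at most M and |F(x,z,p)| ≤ |p|² + 1; and the solution φ is twice continuously differentiable on B₁. Then there exists a constant C > 0, depending only on n, Λ, Λ₁, Λ₂ and M, such that sup_{B_{1/2}} (|φ| + |∇φ| + |∇²φ|) ≤ (C e^{κ})^{C e^{4Λκ}} and |∇²φ(x) − ∇²φ(y)| ≤ (C e^{κ})^{C e^{4Λκ}} |x − y|^{1/3} for all x, y ∈ B_{1/2}. -/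

import Mathlib

open MeasureTheory Metric Real Set

/-- A (weak) solution of the quasilinear elliptic equation
`-∂ⱼ(aᵢⱼ(x,φ)∂ᵢφ) = ρ(x,φ)[1 - (1/2) f e^φ + F(x,φ,∇φ)]` on the unit ball `B₁ ⊆ ℝⁿ`,
which is continuously differentiable and satisfies `0 ≤ φ ≤ κ`. -/
def IsSolution (n : ℕ) (κ : ℝ)
    (a : Fin n → Fin n → EuclideanSpace ℝ (Fin n) → ℝ → ℝ)
    (ρ : EuclideanSpace ℝ (Fin n) → ℝ → ℝ)
    (f : EuclideanSpace ℝ (Fin n) → ℝ)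
    (F : EuclideanSpace ℝ (Fin n) → ℝ → EuclideanSpace ℝ (Fin n) → ℝ)
    (φ : EuclideanSpace ℝ (Fin n) → ℝ) : Prop :=
  ContDiffOn ℝ 1 φ (ball (0 : EuclideanSpace ℝ (Fin n)) 1) ∧
  (∀ x ∈ ball (0 : EuclideanSpace ℝ (Fin n)) 1, 0 ≤ φ x ∧ φ x ≤ κ) ∧
  ∀ ψ : EuclideanSpace ℝ (Fin n) → ℝ,
    ContDiff ℝ (⊤ : ℕ∞) ψ → HasCompactSupport ψ →
    tsupport ψ ⊆ ball (0 : EuclideanSpace ℝ (Fin n)) 1 →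
    (∫ x in ball (0 : EuclideanSpace ℝ (Fin n)) 1,
        ∑ i : Fin n, ∑ j : Fin n,
          a i j x (φ x) * fderiv ℝ φ x (EuclideanSpace.single i 1) *
            fderiv ℝ ψ x (EuclideanSpace.single j 1))
      = ∫ x in ball (0 : EuclideanSpace ℝ (Fin n)) 1,
          ρ x (φ x) * (1 - (1/2) * f x * Real.exp (φ x) + F x (φ x) (gradient φ x)) * ψ x

/-- Structural assumptions on the coefficients: symmetry and `Λ`-ellipticity of `aᵢⱼ`,
`1/2 ≤ ρ ≤ 2`, `0 ≤ f ≤ 1`, the natural growth bound `|F(x,z,p)| ≤ |p|² + 1`,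
and continuity of all coefficients. -/
def GoodCoeffs (n : ℕ) (Λ : ℝ)
    (a : Fin n → Fin n → EuclideanSpace ℝ (Fin n) → ℝ → ℝ)
    (ρ : EuclideanSpace ℝ (Fin n) → ℝ → ℝ)
    (f : EuclideanSpace ℝ (Fin n) → ℝ)
    (F : EuclideanSpace ℝ (Fin n) → ℝ → EuclideanSpace ℝ (Fin n) → ℝ) : Prop :=
  (∀ i j, ContinuousOn (fun p : EuclideanSpace ℝ (Fin n) × ℝ => a i j p.1 p.2)
      ((ball (0 : EuclideanSpace ℝ (Fin n)) 1) ×ˢ (Set.univ : Set ℝ))) ∧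
  (∀ i j x z, a i j x z = a j i x z) ∧
  (∀ x ∈ ball (0 : EuclideanSpace ℝ (Fin n)) 1, ∀ z : ℝ, ∀ ξ : EuclideanSpace ℝ (Fin n),
      Λ⁻¹ * ‖ξ‖ ^ 2 ≤ ∑ i : Fin n, ∑ j : Fin n, a i j x z * ξ i * ξ j ∧
      ∑ i : Fin n, ∑ j : Fin n, a i j x z * ξ i * ξ j ≤ Λ * ‖ξ‖ ^ 2) ∧
  ContinuousOn (fun p : EuclideanSpace ℝ (Fin n) × ℝ => ρ p.1 p.2)
      ((ball (0 : EuclideanSpace ℝ (Fin n)) 1) ×ˢ (Set.univ : Set ℝ)) ∧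
  (∀ x ∈ ball (0 : EuclideanSpace ℝ (Fin n)) 1, ∀ z : ℝ, 1/2 ≤ ρ x z ∧ ρ x z ≤ 2) ∧
  ContinuousOn f (ball (0 : EuclideanSpace ℝ (Fin n)) 1) ∧
  (∀ x ∈ ball (0 : EuclideanSpace ℝ (Fin n)) 1, 0 ≤ f x ∧ f x ≤ 1) ∧
  ContinuousOn (fun p : EuclideanSpace ℝ (Fin n) × ℝ × EuclideanSpace ℝ (Fin n) =>
      F p.1 p.2.1 p.2.2)
      ((ball (0 : EuclideanSpace ℝ (Fin n)) 1) ×ˢ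
        (Set.univ : Set (ℝ × EuclideanSpace ℝ (Fin n)))) ∧
  (∀ x ∈ ball (0 : EuclideanSpace ℝ (Fin n)) 1, ∀ (z : ℝ) (p : EuclideanSpace ℝ (Fin n)),
      |F x z p| ≤ ‖p‖ ^ 2 + 1)

/-- The coefficients `aᵢⱼ` are continuously differentiable on `B₁ × ℝ` with
`|∇ₓ aᵢⱼ| + |∂_z aᵢⱼ| ≤ Λ₁`. -/
def C1Bound (n : ℕ) (Λ₁ : ℝ)
    (a : Fin n → Fin n → EuclideanSpace ℝ (Fin n) → ℝ → ℝ) : Prop :=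
  (∀ i j, ContDiffOn ℝ 1 (fun p : EuclideanSpace ℝ (Fin n) × ℝ => a i j p.1 p.2)
      ((ball (0 : EuclideanSpace ℝ (Fin n)) 1) ×ˢ (Set.univ : Set ℝ))) ∧
  (∀ i j, ∀ x ∈ ball (0 : EuclideanSpace ℝ (Fin n)) 1, ∀ z : ℝ,
      ‖fderiv ℝ (fun y => a i j y z) x‖ + |deriv (fun w => a i j x w) z| ≤ Λ₁)

/-- The coefficients `aᵢⱼ` are twice continuously differentiable on `B₁ × ℝ` with
`|∇²ₓ aᵢⱼ| + |∇ₓ ∂_z aᵢⱼ| + |∂²_z aᵢⱼ| ≤ Λ₂`. -/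
def C2Bound (n : ℕ) (Λ₂ : ℝ)
    (a : Fin n → Fin n → EuclideanSpace ℝ (Fin n) → ℝ → ℝ) : Prop :=
  (∀ i j, ContDiffOn ℝ 2 (fun p : EuclideanSpace ℝ (Fin n) × ℝ => a i j p.1 p.2)
      ((ball (0 : EuclideanSpace ℝ (Fin n)) 1) ×ˢ (Set.univ : Set ℝ))) ∧
  (∀ i j, ∀ x ∈ ball (0 : EuclideanSpace ℝ (Fin n)) 1, ∀ z : ℝ,
      ‖fderiv ℝ (fun y => fderiv ℝ (fun y' => a i j y' z) y) x‖ +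
        ‖fderiv ℝ (fun y => deriv (fun w => a i j y w) z) x‖ +
        |deriv (fun w => deriv (fun w' => a i j x w') w) z| ≤ Λ₂)

/-- A function `g : B₁ × ℝ → ℝ` is `C¹` with `C¹`-norm at most `M`. -/
def C1NormLE (n : ℕ) (M : ℝ) (g : EuclideanSpace ℝ (Fin n) → ℝ → ℝ) : Prop :=
  ContDiffOn ℝ 1 (fun p : EuclideanSpace ℝ (Fin n) × ℝ => g p.1 p.2)
      ((ball (0 : EuclideanSpace ℝ (Fin n)) 1) ×ˢ (Set.univ : Set ℝ)) ∧
  (∀ x ∈ ball (0 : EuclideanSpace ℝ (Fin n)) 1, ∀ z : ℝ,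
      |g x z| + ‖fderiv ℝ (fun p : EuclideanSpace ℝ (Fin n) × ℝ => g p.1 p.2) (x, z)‖ ≤ M)

/-- Euclidean space abbreviation. -/
abbrev EuS (n : ℕ) := EuclideanSpace ℝ (Fin n)

/-- standard basis vector -/
noncomputable def ee {n : ℕ} (i : Fin n) : EuS n := EuclideanSpace.single i (1:ℝ)

/-- Hessian as a bilinear form. -/
noncomputable def hess {n : ℕ} (φ : EuS n → ℝ) (x : EuS n) : EuS n →L[ℝ] EuS n →L[ℝ] ℝ :=
  fderiv ℝ (fderiv ℝ φ) x

/-- `tr (A H)`. -/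
noncomputable def trA {n : ℕ} (A : Fin n → Fin n → ℝ) (H : EuS n →L[ℝ] EuS n →L[ℝ] ℝ) : ℝ :=
  ∑ i, ∑ j, A i j * H (ee i) (ee j)

/-- uniform ellipticity of a symmetric matrix -/
def Ell {n : ℕ} (Λ : ℝ) (A : Fin n → Fin n → ℝ) : Prop :=
  (∀ i j, A i j = A j i) ∧ ∀ ξ : EuS n,
    Λ⁻¹ * ‖ξ‖ ^ 2 ≤ ∑ i, ∑ j, A i j * ξ i * ξ j ∧ ∑ i, ∑ j, A i j * ξ i * ξ j ≤ Λ * ‖ξ‖ ^ 2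

lemma sum_ee {n : ℕ} (ξ : EuS n) : ξ = ∑ i, ξ i • ee i := by
  have := (EuclideanSpace.basisFun (Fin n) ℝ).sum_repr ξ
  simpa [ee] using this.symm

lemma norm_ee {n : ℕ} (i : Fin n) : ‖(ee i : EuS n)‖ = 1 := by simp [ee]

lemma lin_expand {n : ℕ} (p : EuS n →L[ℝ] ℝ) (ξ : EuS n) : p ξ = ∑ i, ξ i * p (ee i) := by
  conv_lhs => rw [sum_ee ξ]
  simp [map_sum]

lemma bil_expand {n : ℕ} (H : EuS n →L[ℝ] EuS n →L[ℝ] ℝ) (ξ ζ : EuS n) :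
    H ξ ζ = ∑ i, ∑ j, ξ i * ζ j * H (ee i) (ee j) := by
  conv_lhs => rw [sum_ee ξ]
  simp only [map_sum, map_smul, _root_.sum_apply, _root_.smul_apply,
    smul_eq_mul]
  refine Finset.sum_congr rfl fun i _ => ?_
  rw [lin_expand, Finset.mul_sum]
  refine Finset.sum_congr rfl fun j _ => by ring

lemma psd_decomp {n : ℕ} (H : EuS n →L[ℝ] EuS n →L[ℝ] ℝ) (hs : ∀ ξ ζ, H ξ ζ = H ζ ξ)
    (hp : ∀ ξ, 0 ≤ H ξ ξ) : ∃ (m : ℕ) (b : Fin m → EuS n),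
      ∀ i j, H (ee i) (ee j) = ∑ k, b k i * b k j := by
  have hP : (Matrix.of fun i j : Fin n => H (ee i) (ee j)).PosSemidef := by
    apply Matrix.PosSemidef.of_dotProduct_mulVec_nonneg
    · ext i j; simp [hs (ee i)]
    · intro x
      have := hp (WithLp.toLp 2 x)
      rw [bil_expand] at this
      simp only [dotProduct, Matrix.mulVec, Finset.mul_sum]
      refine this.trans (le_of_eq ?_)
      refine Finset.sum_congr rfl fun i _ => Finset.sum_congr rfl fun j _ => ?_
      simp; ring
  obtain ⟨m, v, hv⟩ := Matrix.posSemidef_iff_eq_sum_vecMulVec.mp hP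
  refine ⟨m, fun k => WithLp.toLp 2 (v k), fun i j => ?_⟩
  have := congrFun (congrFun hv i) j
  simpa [Matrix.sum_apply, Matrix.vecMulVec_apply] using this

lemma psd_trA {n : ℕ} {Λ : ℝ} (hΛ : 1 ≤ Λ) {A : Fin n → Fin n → ℝ} (hA : Ell Λ A)
    (H : EuS n →L[ℝ] EuS n →L[ℝ] ℝ) (hs : ∀ ξ ζ, H ξ ζ = H ζ ξ) (hp : ∀ ξ, 0 ≤ H ξ ξ) :
    0 ≤ trA A H ∧ ∀ ξ, H ξ ξ ≤ Λ * trA A H * ‖ξ‖ ^ 2 := by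
  obtain ⟨m, b, hb⟩ := psd_decomp H hs hp
  have h1 : trA A H = ∑ k, ∑ i, ∑ j, A i j * b k i * b k j := by
    unfold trA
    simp_rw [hb, Finset.mul_sum]
    rw [Finset.sum_comm' (t' := Finset.univ) (s' := fun _ => Finset.univ) (by simp)]
    rw [Finset.sum_comm]
    rw [Finset.sum_comm' (t' := Finset.univ) (s' := fun _ => Finset.univ) (by simp)]
    conv_rhs => rw [Finset.sum_comm]
    refine Finset.sum_congr rfl fun i _ => ?_
    rw [Finset.sum_comm]
    refine Finset.sum_congr rfl fun k _ => ?_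
    refine Finset.sum_congr rfl fun j _ => ?_
    rw [hA.1 i j]; ring
  have h2 : Λ⁻¹ * ∑ k, ‖b k‖ ^ 2 ≤ trA A H := by
    rw [h1, Finset.mul_sum]
    exact Finset.sum_le_sum fun k _ => (hA.2 (b k)).1
  have h3 : ∑ k, ‖b k‖ ^ 2 ≤ Λ * trA A H := by
    have : Λ * (Λ⁻¹ * ∑ k, ‖b k‖ ^ 2) ≤ Λ * trA A H := by gcongr
    rwa [← mul_assoc, mul_inv_cancel₀ (by positivity), one_mul] at this
  have h4 : 0 ≤ ∑ k, ‖b k‖ ^ 2 := by positivity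
  refine ⟨le_trans (by positivity) h2, fun ξ => ?_⟩
  have h5 : H ξ ξ = ∑ k, (inner ℝ (b k) ξ) ^ 2 := by
    rw [bil_expand]
    simp_rw [hb, Finset.mul_sum, PiLp.inner_apply, sq, Finset.sum_mul_sum]
    conv_rhs => rw [Finset.sum_comm]
    refine Finset.sum_congr rfl fun i _ => ?_
    rw [Finset.sum_comm]
    refine Finset.sum_congr rfl fun k _ => ?_
    refine Finset.sum_congr rfl fun j _ => ?_
    simp; ring
  calc H ξ ξ = ∑ k, (inner ℝ (b k) ξ) ^ 2 := h5
    _ ≤ ∑ k, ‖b k‖ ^ 2 * ‖ξ‖ ^ 2 := by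
        refine Finset.sum_le_sum fun k _ => ?_
        have := abs_real_inner_le_norm (b k) ξ
        rw [← mul_pow, ← sq_abs]
        gcongr
    _ = (∑ k, ‖b k‖ ^ 2) * ‖ξ‖ ^ 2 := by rw [Finset.sum_mul]
    _ ≤ _ := by gcongr

lemma trA_add {n : ℕ} (A : Fin n → Fin n → ℝ) (H G : EuS n →L[ℝ] EuS n →L[ℝ] ℝ) :
    trA A (H + G) = trA A H + trA A G := by
  simp [trA, mul_add, Finset.sum_add_distrib]

lemma trA_smul {n : ℕ} (A : Fin n → Fin n → ℝ) (c : ℝ) (H : EuS n →L[ℝ] EuS n →L[ℝ] ℝ) :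
    trA A (c • H) = c * trA A H := by
  simp only [trA, _root_.smul_apply, smul_eq_mul, Finset.mul_sum]
  refine Finset.sum_congr rfl fun i _ => Finset.sum_congr rfl fun j _ => by ring

lemma trA_sub {n : ℕ} (A : Fin n → Fin n → ℝ) (H G : EuS n →L[ℝ] EuS n →L[ℝ] ℝ) :
    trA A (H - G) = trA A H - trA A G := by
  simp [trA, mul_sub, Finset.sum_sub_distrib]

lemma trA_neg {n : ℕ} (A : Fin n → Fin n → ℝ) (H : EuS n →L[ℝ] EuS n →L[ℝ] ℝ) :
    trA A (-H) = - trA A H := by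
  simp [trA, Finset.sum_neg_distrib]

/-- rank one form -/
noncomputable def rk1 {n : ℕ} (p : EuS n →L[ℝ] ℝ) : EuS n →L[ℝ] EuS n →L[ℝ] ℝ :=
  p.smulRight p

lemma rk1_apply {n : ℕ} (p : EuS n →L[ℝ] ℝ) (ξ ζ : EuS n) : rk1 p ξ ζ = p ξ * p ζ := by
  simp [rk1]

lemma trA_rk1 {n : ℕ} {Λ : ℝ} {A : Fin n → Fin n → ℝ} (hA : Ell Λ A)
    (p : EuS n →L[ℝ] ℝ) : Λ⁻¹ * ‖p‖ ^ 2 ≤ trA A (rk1 p) ∧ trA A (rk1 p) ≤ Λ * ‖p‖ ^ 2 := by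
  set g := (InnerProductSpace.toDual ℝ (EuS n)).symm p with hg
  have h1 : ‖g‖ = ‖p‖ := by simp [hg]
  have h2 : ∀ i, p (ee i) = g i := by
    intro i
    have : inner ℝ g (ee i) = p (ee i) := by simp [hg]
    rw [← this]
    simp [ee, EuclideanSpace.inner_single_right]
  have h3 : trA A (rk1 p) = ∑ i, ∑ j, A i j * g i * g j := by
    unfold trA
    refine Finset.sum_congr rfl fun i _ => Finset.sum_congr rfl fun j _ => ?_
    rw [rk1_apply, h2, h2]; ring
  rw [h3, ← h1]
  exact hA.2 g

lemma Ell.entry_le {n : ℕ} {Λ : ℝ} {A : Fin n → Fin n → ℝ} (hA : Ell Λ A) (i : Fin n) :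
    A i i ≤ Λ := by
  have := (hA.2 (ee i)).2
  simpa [ee, Finset.sum_ite_eq, PiLp.single_apply] using this

/-- the identity bilinear form -/
noncomputable def idf (n : ℕ) : EuS n →L[ℝ] EuS n →L[ℝ] ℝ := innerSL ℝ

lemma idf_apply {n : ℕ} (ξ ζ : EuS n) : idf n ξ ζ = inner ℝ ξ ζ := rfl

lemma trA_inner {n : ℕ} {Λ : ℝ} {A : Fin n → Fin n → ℝ} (hA : Ell Λ A) :
    trA A (idf n) ≤ n * Λ := by
  have : trA A (idf n) = ∑ i, A i i := by
    unfold trA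
    refine Finset.sum_congr rfl fun i _ => ?_
    simp only [idf_apply, ee, EuclideanSpace.inner_single_right]
    simp [PiLp.single_apply]
  rw [this]
  calc ∑ i, A i i ≤ ∑ i : Fin n, Λ := Finset.sum_le_sum fun i _ => hA.entry_le i
    _ = n * Λ := by simp

lemma taylor2_1d (m m1 m2 : ℝ → ℝ) (h1 : ∀ t, HasDerivAt m (m1 t) t)
    (h2 : ∀ t, HasDerivAt m1 (m2 t) t) :
    ∃ s ∈ Ioo (0:ℝ) 1, m 1 = m 0 + m1 0 + m2 s / 2 := by
  set c := m 1 - m 0 - m1 0 with hc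
  have hk : ∀ t, HasDerivAt (fun t => m 1 - m t - m1 t * (1 - t) - c * (1 - t) ^ 2)
      (-(m1 t) - (m2 t * (1 - t) + m1 t * (-1)) - c * (2 * (1 - t) ^ 1 * (-1))) t := by
    intro t
    have e : HasDerivAt (fun t : ℝ => 1 - t) (-1) t := by
      simpa using (hasDerivAt_id t).const_sub 1
    have := (((h1 t).const_sub (m 1)).sub ((h2 t).mul e)).sub ((e.pow 2).const_mul c)
    refine this.congr_deriv ?_
    push_cast; ring
  obtain ⟨s, hs, hs'⟩ := exists_hasDerivAt_eq_zero (a := (0:ℝ)) (b := 1) one_pos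
    (fun t _ => (hk t).continuousAt.continuousWithinAt) (by simp [hc]) (fun t _ => hk t)
  refine ⟨s, hs, ?_⟩
  have h0 : (1 - s) * (2 * c - m2 s) = 0 := by linear_combination hs'
  have : 2 * c - m2 s = 0 := by
    rcases mul_eq_zero.mp h0 with h | h
    · exact absurd hs.2 (by linarith)
    · exact h
  linarith

lemma taylor3_1d (m m1 m2 m3 : ℝ → ℝ) (h1 : ∀ t, HasDerivAt m (m1 t) t)
    (h2 : ∀ t, HasDerivAt m1 (m2 t) t) (h3 : ∀ t, HasDerivAt m2 (m3 t) t) :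
    ∃ s ∈ Ioo (0:ℝ) 1, m 1 = m 0 + m1 0 + m2 0 / 2 + m3 s / 6 := by
  set c := m 1 - m 0 - m1 0 - m2 0 / 2 with hc
  have hk : ∀ t, HasDerivAt (fun t => m 1 - m t - m1 t * (1 - t) - m2 t * ((1 - t) ^ 2 / 2)
      - c * (1 - t) ^ 3)
      (-(m1 t) - (m2 t * (1 - t) + m1 t * (-1)) -
        (m3 t * ((1 - t) ^ 2 / 2) + m2 t * (2 * (1 - t) * (-1) / 2)) -
        c * (3 * (1 - t) ^ 2 * (-1))) t := by
    intro t
    have e : HasDerivAt (fun t : ℝ => 1 - t) (-1) t := by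
      simpa using (hasDerivAt_id t).const_sub 1
    have := ((((h1 t).const_sub (m 1)).sub ((h2 t).mul e)).sub
      ((h3 t).mul ((e.pow 2).div_const 2))).sub ((e.pow 3).const_mul c)
    refine this.congr_deriv ?_
    push_cast; simp
  obtain ⟨s, hs, hs'⟩ := exists_hasDerivAt_eq_zero (a := (0:ℝ)) (b := 1) one_pos
    (fun t _ => (hk t).continuousAt.continuousWithinAt) (by simp [hc]; ring) (fun t _ => hk t)
  refine ⟨s, hs, ?_⟩
  have h0 : (1 - s) ^ 2 * (6 * c - m3 s) = 0 := by linear_combination 2 * hs'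
  have : 6 * c - m3 s = 0 := by
    rcases mul_eq_zero.mp h0 with h | h
    · exact absurd hs.2 (by have := pow_eq_zero_iff (two_ne_zero) |>.mp h; linarith)
    · exact h
  linarith

lemma hasDerivAt_line {n : ℕ} {φ : EuS n → ℝ} (hφ : ContDiff ℝ 1 φ) (x ξ : EuS n) (t : ℝ) :
    HasDerivAt (fun t : ℝ => φ (x + t • ξ)) (fderiv ℝ φ (x + t • ξ) ξ) t := by
  have h := ((hφ.differentiable (by norm_num)) (x + t • ξ)).hasFDerivAt
  have e : HasDerivAt (fun t : ℝ => x + t • ξ) ξ t := by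
    simpa using ((hasDerivAt_id t).smul_const ξ).const_add x
  exact h.comp_hasDerivAt t e

lemma contDiff_fderiv {n : ℕ} {φ : EuS n → ℝ} (hφ : ContDiff ℝ 2 φ) :
    ContDiff ℝ 1 (fderiv ℝ φ) := hφ.fderiv_right (by norm_num)

lemma continuous_hess {n : ℕ} {φ : EuS n → ℝ} (hφ : ContDiff ℝ 2 φ) :
    Continuous (hess φ) := (contDiff_fderiv hφ).continuous_fderiv (by norm_num)

lemma hasFDerivAt_fderiv {n : ℕ} {φ : EuS n → ℝ} (hφ : ContDiff ℝ 2 φ) (x : EuS n) :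
    HasFDerivAt (fderiv ℝ φ) (hess φ x) x :=
  ((contDiff_fderiv hφ).differentiable (by norm_num) x).hasFDerivAt

lemma hasDerivAt_line2 {n : ℕ} {φ : EuS n → ℝ} (hφ : ContDiff ℝ 2 φ) (x ξ ζ : EuS n) (t : ℝ) :
    HasDerivAt (fun t : ℝ => fderiv ℝ φ (x + t • ξ) ζ) (hess φ (x + t • ξ) ξ ζ) t := by
  have h := hasFDerivAt_fderiv hφ (x + t • ξ)
  have e : HasDerivAt (fun t : ℝ => x + t • ξ) ξ t := by
    simpa using ((hasDerivAt_id t).smul_const ξ).const_add x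
  exact (ContinuousLinearMap.apply ℝ ℝ ζ).hasFDerivAt.comp_hasDerivAt t (h.comp_hasDerivAt t e)

lemma taylor2 {n : ℕ} {φ : EuS n → ℝ} (hφ : ContDiff ℝ 2 φ) (x ξ : EuS n) :
    ∃ s ∈ Ioo (0:ℝ) 1, φ (x + ξ) = φ x + fderiv ℝ φ x ξ + hess φ (x + s • ξ) ξ ξ / 2 := by
  obtain ⟨s, hs, h⟩ := taylor2_1d _ _ _ (hasDerivAt_line (hφ.of_le (by norm_num)) x ξ)
    (hasDerivAt_line2 hφ x ξ ξ)
  exact ⟨s, hs, by simpa using h⟩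

lemma hess_symm {n : ℕ} {φ : EuS n → ℝ} (hφ : ContDiff ℝ 2 φ) (x ξ ζ : EuS n) :
    hess φ x ξ ζ = hess φ x ζ ξ :=
  (hφ.contDiffAt.isSymmSndFDerivAt (by simp)) ξ ζ

lemma hess_nonneg_of_isLocalMin {n : ℕ} {φ : EuS n → ℝ} (hφ : ContDiff ℝ 2 φ) {x : EuS n}
    (h : IsLocalMin φ x) (ξ : EuS n) : 0 ≤ hess φ x ξ ξ := by
  by_contra! hneg
  have hc : Continuous fun y => hess φ y ξ ξ :=
    ((continuous_hess hφ).clm_apply continuous_const).clm_apply continuous_const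
  have h1 : ∀ᶠ y in nhds x, hess φ y ξ ξ < 0 := hc.continuousAt.eventually_lt_const hneg
  obtain ⟨ε, hε, h2⟩ := Metric.eventually_nhds_iff.mp (h1.and h)
  obtain ⟨t, ht, htε⟩ : ∃ t : ℝ, 0 < t ∧ t * ‖ξ‖ < ε := by
    refine ⟨ε / (‖ξ‖ + 1), by positivity, ?_⟩
    rw [div_mul_eq_mul_div, div_lt_iff₀ (by positivity)]
    nlinarith [norm_nonneg ξ]
  obtain ⟨s, hs, hT⟩ := taylor2 hφ x (t • ξ)
  have d1 : dist (x + t • ξ) x < ε := by simpa [norm_smul, abs_of_pos ht] using htε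
  have d2 : dist (x + s • t • ξ) x < ε := by
    rw [dist_eq_norm, add_sub_cancel_left, norm_smul, norm_smul, Real.norm_eq_abs,
      Real.norm_eq_abs, abs_of_pos ht, abs_of_pos hs.1]
    nlinarith [norm_nonneg ξ, hs.1, hs.2, mul_nonneg ht.le (norm_nonneg ξ)]
  have e1 := (h2 d1).2
  have e2 := (h2 d2).1
  rw [h.fderiv_eq_zero] at hT
  simp only [map_smul, _root_.smul_apply, smul_eq_mul,
    _root_.zero_apply] at hT
  nlinarith [mul_pos ht ht]

/-- determinant bound for a bounded linear map of `EuS n` -/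
lemma det_le_of_bound {n : ℕ} (hn : 0 < n) (L : EuS n →L[ℝ] EuS n) {D : ℝ} (hD : 0 ≤ D)
    (h : ∀ ξ, ‖L ξ‖ ≤ D * ‖ξ‖) : |L.det| ≤ D ^ n := by
  haveI : Nonempty (Fin n) := ⟨⟨0, hn⟩⟩
  haveI : Nontrivial (EuS n) := inferInstance
  have h1 : L '' ball 0 1 ⊆ closedBall 0 D := by
    rintro _ ⟨ξ, hξ, rfl⟩
    rw [mem_closedBall_zero_iff]
    rw [mem_ball_zero_iff] at hξ
    exact (h ξ).trans (mul_le_of_le_one_right hD hξ.le)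
  have h2 := measure_mono (μ := (volume : Measure (EuS n))) h1
  rw [Measure.addHaar_image_continuousLinearMap, Measure.addHaar_closedBall _ _ hD] at h2
  have h3 := (ENNReal.mul_le_mul_iff_left (measure_ball_pos volume (0 : EuS n) one_pos).ne'
    measure_ball_lt_top.ne).mp h2
  rw [ENNReal.ofReal_le_ofReal_iff (by positivity)] at h3
  simpa using h3

lemma psd_norm {n : ℕ} (H : EuS n →L[ℝ] EuS n →L[ℝ] ℝ) (hs : ∀ ξ ζ, H ξ ζ = H ζ ξ) {D : ℝ}
    (hp : ∀ ξ, 0 ≤ H ξ ξ) (hD : ∀ ξ, H ξ ξ ≤ D * ‖ξ‖ ^ 2) (ξ ζ : EuS n)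
     : |H ξ ζ| ≤ D * (‖ξ‖ ^ 2 + ‖ζ‖ ^ 2) / 2 := by
  have h1 := hp (ξ + ζ)
  have h2 := hp (ξ - ζ)
  simp only [map_add, map_sub, _root_.add_apply, _root_.sub_apply] at h1 h2
  rw [hs ζ ξ] at h1 h2
  have := hD ξ
  have := hD ζ
  rw [abs_le]; constructor <;> linarith

/-- gradient as a vector -/
noncomputable def grv {n : ℕ} (v : EuS n → ℝ) (x : EuS n) : EuS n := ∑ i, fderiv ℝ v x (ee i) • ee i

/-- Hessian as an endomorphism -/
noncomputable def hessL {n : ℕ} (v : EuS n → ℝ) (x : EuS n) : EuS n →L[ℝ] EuS n :=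
  ∑ i, ((hess v x).flip (ee i)).smulRight (ee i)

lemma hasFDerivAt_grv {n : ℕ} {v : EuS n → ℝ} (hv : ContDiff ℝ 2 v) (x : EuS n) :
    HasFDerivAt (grv v) (hessL v x) x := by
  unfold grv hessL
  apply HasFDerivAt.fun_sum
  intro i _
  apply HasFDerivAt.smul_const
  have := (ContinuousLinearMap.apply ℝ ℝ (ee i)).hasFDerivAt.comp x (hasFDerivAt_fderiv hv x)
  exact this

lemma hessL_bound {n : ℕ} {v : EuS n → ℝ} (hv : ContDiff ℝ 2 v) (x : EuS n) {D : ℝ}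
    (hp : ∀ ξ, 0 ≤ hess v x ξ ξ) (hD : ∀ ξ, hess v x ξ ξ ≤ D * ‖ξ‖ ^ 2) (hD0 : 0 ≤ D) (ξ : EuS n) :
    ‖hessL v x ξ‖ ≤ (n * D) * ‖ξ‖ := by
  have key : ∀ i, |hess v x ξ (ee i)| ≤ D * ‖ξ‖ := by
    intro i
    rcases eq_or_ne ξ 0 with rfl | h0
    · simp
    have hpos : 0 < ‖ξ‖ := norm_pos_iff.mpr h0
    have := psd_norm _ (hess_symm hv x) hp hD (‖ξ‖⁻¹ • ξ) (ee i)
    rw [norm_smul, norm_ee, norm_inv, norm_norm, inv_mul_cancel₀ hpos.ne'] at this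
    simp only [map_smul, _root_.smul_apply, smul_eq_mul, abs_mul, abs_inv, abs_norm] at this
    rw [inv_mul_le_iff₀ hpos] at this
    linarith
  have : hessL v x ξ = ∑ i, (hess v x ξ (ee i)) • ee i := by
    simp [hessL]
  rw [this]
  refine (norm_sum_le _ _).trans ?_
  have : ∀ i ∈ (Finset.univ : Finset (Fin n)), ‖(hess v x ξ (ee i)) • (ee i : EuS n)‖ ≤ D * ‖ξ‖ := by
    intro i _
    rw [norm_smul, norm_ee, mul_one]; exact key i
  refine (Finset.sum_le_sum this).trans ?_
  simp; linarith

/-- area estimate: every `p` in a ball is attained as gradient on a set -/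
lemma area_est {n : ℕ} (hn : 0 < n) {v : EuS n → ℝ} (hv : ContDiff ℝ 2 v) {D η : ℝ} (hD0 : 0 ≤ D)
    (T : Set (EuS n)) (hT : MeasurableSet T) (hη : 0 ≤ η)
    (hp : ∀ x ∈ T, ∀ ξ, 0 ≤ hess v x ξ ξ) (hD : ∀ x ∈ T, ∀ ξ, hess v x ξ ξ ≤ D * ‖ξ‖ ^ 2)
    (hs : ball 0 η ⊆ grv v '' T) :
    ENNReal.ofReal (η ^ n) * volume (ball (0 : EuS n) 1) ≤ ENNReal.ofReal ((n * D) ^ n) * volume T := by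
  haveI : Nonempty (Fin n) := ⟨⟨0, hn⟩⟩
  haveI : Nontrivial (EuS n) := inferInstance
  have h1 := addHaar_image_le_lintegral_abs_det_fderiv (volume : Measure (EuS n)) hT
    (fun x _ => (hasFDerivAt_grv hv x).hasFDerivWithinAt)
  have h2 : ∫⁻ x in T, ENNReal.ofReal |(hessL v x).det| ≤ ∫⁻ x in T, ENNReal.ofReal ((n * D) ^ n) := by
    apply setLIntegral_mono' hT
    intro x hx
    apply ENNReal.ofReal_le_ofReal
    exact det_le_of_bound hn _ (by positivity) (hessL_bound hv x (hp x hx) (hD x hx) hD0)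
  have h3 := (measure_mono hs).trans (h1.trans h2)
  rw [setLIntegral_const, Measure.addHaar_ball _ _ hη] at h3
  simpa using h3

/-- Gaussian -/
noncomputable def gau {n : ℕ} (β : ℝ) (x : EuS n) : ℝ := rexp (-β * ‖x‖ ^ 2)

lemma gau_contDiff {n : ℕ} (β : ℝ) {k : WithTop ℕ∞} : ContDiff ℝ k (gau (n := n) β) := by
  unfold gau
  exact Real.contDiff_exp.comp (contDiff_const.mul (contDiff_norm_sq ℝ))

lemma gau_fderiv {n : ℕ} (β : ℝ) (x : EuS n) :
    HasFDerivAt (gau β) ((-2 * β * gau β x) • idf n x) x := by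
  have h : HasFDerivAt (fun x : EuS n => -β * ‖x‖ ^ 2) (-β • (2 • idf n x)) x :=
    ((hasStrictFDerivAt_norm_sq x).hasFDerivAt).const_mul (-β)
  have := h.exp
  have e : (-2 * β * gau β x) • idf n x = rexp (-β * ‖x‖ ^ 2) • -β • 2 • (idf n) x := by
    ext y
    simp [gau]
    ring
  rw [e]
  exact this

lemma gau_hess {n : ℕ} (β : ℝ) (x : EuS n) :
    hess (gau β) x = gau β x • ((4 * β ^ 2) • rk1 (idf n x) - (2 * β) • idf n) := by
  unfold hess
  have : fderiv ℝ (gau (n := n) β) = fun x => (-2 * β * gau β x) • idf n x := by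
    ext1 x; exact (gau_fderiv β x).fderiv
  rw [this]
  have h1 := (((gau_fderiv β x).const_mul (-2*β)).smul (idf n).hasFDerivAt)
  have h2 : HasFDerivAt (fun x : EuS n => (-2 * β * gau β x) • idf n x) _ x := h1
  rw [h2.fderiv]
  ext ξ ζ
  simp [rk1_apply, idf_apply]
  ring

lemma fderiv_sub_smul {n : ℕ} {w g : EuS n → ℝ} (hw : ContDiff ℝ 2 w) (hg : ContDiff ℝ 2 g) (K : ℝ) :
    fderiv ℝ (fun x => w x - K * g x) = fun x => fderiv ℝ w x - K • fderiv ℝ g x := by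
  ext1 x
  have h1 := (hw.differentiable (by norm_num) x).hasFDerivAt
  have h2 := (hg.differentiable (by norm_num) x).hasFDerivAt
  exact (h1.sub (h2.const_mul K)).fderiv

lemma hess_sub_smul {n : ℕ} {w g : EuS n → ℝ} (hw : ContDiff ℝ 2 w) (hg : ContDiff ℝ 2 g) (K : ℝ)
    (x : EuS n) : hess (fun x => w x - K * g x) x = hess w x - K • hess g x := by
  unfold hess
  rw [fderiv_sub_smul hw hg]
  have h1 := hasFDerivAt_fderiv hw x
  have h2 := hasFDerivAt_fderiv hg x
  exact (h1.sub (h2.const_smul K)).fderiv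

lemma grv_eq {n : ℕ} {v : EuS n → ℝ} {x p : EuS n} (h : fderiv ℝ v x = idf n p) : grv v x = p := by
  unfold grv
  rw [h]
  conv_rhs => rw [sum_ee p]
  refine Finset.sum_congr rfl fun i _ => ?_
  simp [idf_apply, ee, EuclideanSpace.inner_single_right]

lemma min_point {n : ℕ} {v : EuS n → ℝ} (hv : ContDiff ℝ 2 v) (p : EuS n) {R : ℝ} (x1 : EuS n)
    (hx1 : x1 ∈ ball (0 : EuS n) R)
    (hb : ∀ x, ‖x‖ = R → v x1 - inner ℝ p x1 < v x - inner ℝ p x) :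
    ∃ x ∈ ball (0 : EuS n) R, v x - inner ℝ p x ≤ v x1 - inner ℝ p x1 ∧ fderiv ℝ v x = idf n p ∧
      ∀ ξ, 0 ≤ hess v x ξ ξ := by
  have hc2 : ContDiff ℝ 2 (fun x => inner ℝ p x) := contDiff_const.inner ℝ contDiff_id
  have hcd : ContDiff ℝ 2 (fun x => v x - 1 * inner ℝ p x) := hv.sub (contDiff_const.mul hc2)
  obtain ⟨x, hx, hmin⟩ := (isCompact_closedBall (0 : EuS n) R).exists_isMinOn
    ⟨x1, ball_subset_closedBall hx1⟩ hcd.continuous.continuousOn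
  have h1 := hmin (ball_subset_closedBall hx1)
  simp only [mem_ofPred_eq, one_mul] at h1
  have hxb : x ∈ ball (0 : EuS n) R := by
    rw [mem_closedBall_zero_iff] at hx
    rw [mem_ball_zero_iff]
    refine lt_of_le_of_ne hx fun h => ?_
    have := hb x h
    linarith
  have hloc : IsLocalMin (fun x => v x - 1 * inner ℝ p x) x := by
    filter_upwards [isOpen_ball.mem_nhds hxb] with y hy
    exact hmin (ball_subset_closedBall hy)
  have hD : fderiv ℝ (fun x => inner ℝ p x) = fun _ : EuS n => idf n p := by
    ext1 x
    exact (idf n p).hasFDerivAt.fderiv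
  have hH : hess (fun x => inner ℝ p x) x = 0 := by
    unfold hess; rw [hD]; simp
  refine ⟨x, hxb, h1, ?_, ?_⟩
  · have := hloc.fderiv_eq_zero
    rw [fderiv_sub_smul hv hc2 1, hD] at this
    simpa [sub_eq_zero] using this
  · intro ξ
    have := hess_nonneg_of_isLocalMin hcd hloc ξ
    rw [hess_sub_smul hv hc2, hH] at this
    simpa using this

set_option maxHeartbeats 1000000 in
lemma lemmaP_unit (n : ℕ) (hn : 0 < n) (Λ : ℝ) (hΛ : 1 ≤ Λ) : ∃ M μ : ℝ, 1 < M ∧ 0 < μ ∧ μ < 1 ∧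
    ∀ w : EuS n → ℝ, ContDiff ℝ 2 w → (∀ x ∈ closedBall (0 : EuS n) 2, 0 ≤ w x) →
    (∀ x ∈ ball (0 : EuS n) 2, ∃ A, Ell Λ A ∧ trA A (hess w x) ≤ 1) →
    (∃ x ∈ ball (0 : EuS n) 1, w x ≤ 1) →
    ENNReal.ofReal μ * volume (ball (0 : EuS n) 1) ≤ volume (ball (0 : EuS n) 1 ∩ {x | w x ≤ M}) := by
  set β : ℝ := 8 * Λ * (n * Λ + 1) with hβ
  have hn1 : (1:ℝ) ≤ n := by exact_mod_cast hn
  have hβ8 : 8 ≤ β := by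
    have : 0 ≤ (n:ℝ) * Λ := by positivity
    rw [hβ]; nlinarith
  obtain ⟨K, hK1, hK2, hK3⟩ : ∃ K : ℝ, 1 ≤ K ∧ 1 ≤ K * rexp (-4*β) ∧
      3 ≤ K * (rexp (-β) - rexp (-4*β)) := by
    have h0 : 0 < rexp (-β) - rexp (-4*β) := by
      rw [sub_pos]; apply Real.exp_lt_exp.mpr; linarith
    have h1 := Real.exp_pos (-4*β)
    refine ⟨max 1 (max (rexp (-4*β))⁻¹ (3 / (rexp (-β) - rexp (-4*β)))), le_max_left _ _, ?_, ?_⟩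
    · rw [← div_le_iff₀ h1, one_div]
      exact (le_max_left _ _).trans (le_max_right _ _)
    · rw [← div_le_iff₀ h0]
      exact (le_max_right _ _).trans (le_max_right _ _)
  set D : ℝ := Λ * (1 + K * (2 * β * (n * Λ))) with hD
  have hD1 : 1 ≤ D := by
    have : 0 ≤ K * (2 * β * (n * Λ)) := by positivity
    rw [hD]; nlinarith
  have hnD : 1 ≤ n * D := by nlinarith
  refine ⟨K + 1, (1/2) ^ n / (n * D) ^ n, by linarith, by positivity, ?_, ?_⟩
  · rw [div_lt_one (by positivity)]
    exact pow_lt_pow_left₀ (by linarith) (by norm_num) (by omega)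
  intro w hw hw0 htr ⟨x1, hx1, hwx1⟩
  set v : EuS n → ℝ := fun x => w x - K * gau β x with hvdef
  have hgc : ContDiff ℝ 2 (gau (n := n) β) := gau_contDiff β
  have hv : ContDiff ℝ 2 v := hw.sub (contDiff_const.mul hgc)
  have hhv : ∀ x, hess v x = hess w x - K • hess (gau β) x := fun x => hess_sub_smul hw hgc K x
  set T : Set (EuS n) := {x | x ∈ ball (0 : EuS n) 1 ∧ w x ≤ K + 1 ∧ ∀ ξ, 0 ≤ hess v x ξ ξ} with hT
  have hTm : MeasurableSet T := by
    apply MeasurableSet.inter isOpen_ball.measurableSet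
    apply MeasurableSet.inter
    · exact (isClosed_le hw.continuous continuous_const).measurableSet
    · have : IsClosed {x | ∀ ξ, 0 ≤ hess v x ξ ξ} := by
        simp only [ofPred_forall]
        apply isClosed_iInter
        intro ξ
        exact isClosed_le continuous_const
          (((continuous_hess hv).clm_apply continuous_const).clm_apply continuous_const)
      exact this.measurableSet
  have gle : ∀ x : EuS n, gau β x ≤ 1 := by
    intro x; unfold gau; rw [Real.exp_le_one_iff]
    have : 0 ≤ β * ‖x‖ ^ 2 := by positivity
    linarith
  have gpos : ∀ x : EuS n, 0 < gau β x := fun x => Real.exp_pos _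
  have trg : ∀ A, Ell Λ A → ∀ x : EuS n, gau β x * (4 * β ^ 2 * (Λ⁻¹ * ‖x‖ ^ 2) - 2 * β * (n * Λ))
      ≤ trA A (hess (gau β) x) := by
    intro A hA x
    rw [gau_hess, trA_smul, trA_sub, trA_smul, trA_smul]
    apply mul_le_mul_of_nonneg_left _ (gpos x).le
    have h1 := (trA_rk1 hA (idf n x)).1
    have h2 := trA_inner hA
    have h3 : ‖idf n x‖ = ‖x‖ := innerSL_apply_norm _ _
    rw [h3] at h1
    have h4 : 2 * β * trA A (idf n) ≤ 2 * β * (n * Λ) := mul_le_mul_of_nonneg_left h2 (by positivity)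
    have h5 := mul_le_mul_of_nonneg_left h1 (by positivity : 0 ≤ 4 * β ^ 2)
    linarith
  have hTD : ∀ x ∈ T, ∀ ξ, hess v x ξ ξ ≤ D * ‖ξ‖ ^ 2 := by
    intro x hx ξ
    obtain ⟨A, hA, hA1⟩ := htr x (ball_subset_ball (by norm_num) hx.1)
    have h1 := (psd_trA hΛ hA (hess v x) (hess_symm hv x) hx.2.2).2 ξ
    refine h1.trans ?_
    apply mul_le_mul_of_nonneg_right _ (sq_nonneg _)
    apply mul_le_mul_of_nonneg_left _ (by linarith)
    rw [hhv, trA_sub, trA_smul]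
    have h2 := trg A hA x
    have h3 : -(2 * β * (n * Λ)) ≤ trA A (hess (gau β) x) := by
      refine le_trans ?_ h2
      have a1 : 0 ≤ 4 * β ^ 2 * (Λ⁻¹ * ‖x‖ ^ 2) := by positivity
      have a2 : 0 ≤ 2 * β * (n * Λ) := by positivity
      have := gle x
      have := gpos x
      nlinarith
    have := mul_le_mul_of_nonneg_left h3 (by linarith : 0 ≤ K)
    linarith
  have hsub : ball 0 (1/2) ⊆ grv v '' T := by
    intro p hp
    rw [mem_ball_zero_iff] at hp
    have ip : ∀ x : EuS n, |inner ℝ p x| ≤ 1/2 * ‖x‖ := fun x =>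
      (abs_real_inner_le_norm p x).trans (mul_le_mul_of_nonneg_right hp.le (norm_nonneg _))
    have hx1n : ‖x1‖ < 1 := mem_ball_zero_iff.mp hx1
    have g1 : rexp (-β) ≤ gau β x1 := by
      unfold gau; apply Real.exp_le_exp.mpr
      have : ‖x1‖ ^ 2 ≤ 1 := pow_le_one₀ (norm_nonneg _) hx1n.le
      nlinarith
    have v1 : v x1 - inner ℝ p x1 ≤ -3/2 - K * rexp (-4*β) := by
      have := (abs_le.mp (ip x1)).1
      have := mul_le_mul_of_nonneg_left g1 (by linarith : 0 ≤ K)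
      simp only [hvdef]
      linarith
    obtain ⟨x, hxb, hxv, hxD, hxp⟩ := min_point hv p (R := 2) x1 (ball_subset_ball (by norm_num) hx1) (by
      intro x hx
      have h1 := hw0 x (by rw [mem_closedBall_zero_iff, hx])
      have h2 := (abs_le.mp (ip x)).2
      have h3 : gau β x = rexp (-4*β) := by
        unfold gau; rw [hx]; ring_nf
      rw [hx] at h2
      have : v x = w x - K * rexp (-4*β) := by simp only [hvdef, h3]
      linarith)
    have hxn : ‖x‖ < 2 := mem_ball_zero_iff.mp hxb
    have hx2 := (abs_le.mp (ip x)).2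
    refine ⟨x, ⟨?_, ?_, hxp⟩, grv_eq hxD⟩
    · rw [mem_ball_zero_iff]
      by_contra! hcon
      obtain ⟨A, hA, hA1⟩ := htr x hxb
      have h1 := (psd_trA hΛ hA (hess v x) (hess_symm hv x) hxp).1
      rw [hhv, trA_sub, trA_smul] at h1
      have h2 := trg A hA x
      have h3 : 4 * β ^ 2 * (Λ⁻¹ * ‖x‖ ^ 2) - 2 * β * (n * Λ) ≥ 2 * β := by
        have e1 : β * Λ⁻¹ = 8 * (n * Λ + 1) := by rw [hβ]; field_simp
        have e2 : 1 ≤ ‖x‖ ^ 2 := one_le_pow₀ hcon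
        have e3 : 4 * β ^ 2 * (Λ⁻¹ * ‖x‖ ^ 2) = 4 * β * (β * Λ⁻¹) * ‖x‖ ^ 2 := by ring
        rw [e3, e1]
        have e4 : 4 * β * (8 * (n * Λ + 1)) ≤ 4 * β * (8 * (n * Λ + 1)) * ‖x‖ ^ 2 :=
          le_mul_of_one_le_right (by positivity) e2
        have : 0 ≤ β * (n * Λ) := by positivity
        nlinarith
      have g2 : rexp (-4*β) ≤ gau β x := by
        unfold gau; apply Real.exp_le_exp.mpr
        have : ‖x‖ ^ 2 ≤ 4 := by nlinarith [norm_nonneg x]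
        nlinarith
      have h4 : gau β x * (2 * β) ≤ trA A (hess (gau β) x) :=
        (mul_le_mul_of_nonneg_left h3 (gpos x).le).trans h2
      have h5 : 1 ≤ K * gau β x := hK2.trans (mul_le_mul_of_nonneg_left g2 (by linarith))
      have h6 := mul_le_mul_of_nonneg_left h4 (by linarith : 0 ≤ K)
      have h7 : 2 * β * 1 ≤ 2 * β * (K * gau β x) := mul_le_mul_of_nonneg_left h5 (by linarith)
      linarith
    · have : K * gau β x ≤ K := mul_le_of_le_one_right (by linarith) (gle x)
      have e : v x = w x - K * gau β x := rfl
      linarith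
  have hA := area_est hn hv (by linarith : 0 ≤ D) T hTm (by norm_num) (fun x hx => hx.2.2) hTD hsub
  have hTs : T ⊆ ball (0 : EuS n) 1 ∩ {x | w x ≤ K + 1} := fun x hx => ⟨hx.1, hx.2.1⟩
  refine le_trans ?_ (measure_mono hTs)
  rw [ENNReal.ofReal_div_of_pos (by positivity), mul_comm, ← mul_div_assoc, mul_comm]
  apply ENNReal.div_le_of_le_mul
  rw [mul_comm (volume T)]
  exact hA

section B2

open scoped Pointwise

lemma fderiv_affine {n : ℕ} {φ : EuS n → ℝ} (hφ : ContDiff ℝ 2 φ) (k t : ℝ) (c y : EuS n) :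
    fderiv ℝ (fun y => k * φ (c + t • y)) y = (k * t) • fderiv ℝ φ (c + t • y) := by
  have h := ((hφ.differentiable (by norm_num)) (c + t • y)).hasFDerivAt
  have e : HasFDerivAt (fun y : EuS n => c + t • y) (t • ContinuousLinearMap.id ℝ (EuS n)) y :=
    ((hasFDerivAt_id y).const_smul t).const_add c
  have := (h.comp y e).const_mul k
  have h2 : HasFDerivAt (fun y => k * φ (c + t • y)) _ y := this
  rw [h2.fderiv]
  ext ξ
  simp
  ring

lemma contDiff_affine {n : ℕ} {φ : EuS n → ℝ} (hφ : ContDiff ℝ 2 φ) (k t : ℝ) (c : EuS n) :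
    ContDiff ℝ 2 (fun y => k * φ (c + t • y)) :=
  contDiff_const.mul (hφ.comp (by fun_prop))

lemma hess_affine {n : ℕ} {φ : EuS n → ℝ} (hφ : ContDiff ℝ 2 φ) (k t : ℝ) (c y : EuS n) :
    hess (fun y => k * φ (c + t • y)) y = (k * t ^ 2) • hess φ (c + t • y) := by
  unfold hess
  have : fderiv ℝ (fun y => k * φ (c + t • y)) = fun y => (k * t) • fderiv ℝ φ (c + t • y) := by
    ext1 y; exact fderiv_affine hφ k t c y
  rw [this]
  have h := hasFDerivAt_fderiv hφ (c + t • y)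
  have e : HasFDerivAt (fun y : EuS n => c + t • y) (t • ContinuousLinearMap.id ℝ (EuS n)) y :=
    ((hasFDerivAt_id y).const_smul t).const_add c
  have h2 : HasFDerivAt (fun y => (k * t) • fderiv ℝ φ (c + t • y)) _ y :=
    (h.comp y e).const_smul (k * t)
  rw [h2.fderiv]
  ext ξ ζ
  simp [hess]
  ring

lemma vol_affine {n : ℕ} (c : EuS n) {t : ℝ} (ht : 0 < t) (s : Set (EuS n)) :
    volume ((fun y => c + t • y) '' s) = ENNReal.ofReal (t ^ n) * volume s := by
  have : (fun y => c + t • y) '' s = (fun z => c + z) '' (t • s) := by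
    rw [← Set.image_smul, Set.image_image]
  rw [this, Set.image_add_left, measure_preimage_add, Measure.addHaar_smul]
  rw [abs_of_nonneg (by positivity)]
  simp

lemma affine_ball {n : ℕ} (c : EuS n) {t : ℝ} (ht : 0 < t) (r : ℝ) :
    (fun y => c + t • y) '' (ball 0 r) = ball c (t * r) := by
  ext x
  simp only [Set.mem_image, mem_ball, dist_eq_norm, sub_zero]
  constructor
  · rintro ⟨y, hy, rfl⟩
    rw [add_sub_cancel_left, norm_smul, Real.norm_of_nonneg ht.le]
    exact mul_lt_mul_of_pos_left hy ht
  · intro h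
    refine ⟨t⁻¹ • (x - c), ?_, ?_⟩
    · rw [norm_smul, norm_inv, Real.norm_of_nonneg ht.le, inv_mul_lt_iff₀ ht]; exact h
    · rw [smul_smul, mul_inv_cancel₀ ht.ne', one_smul]; abel

/-- property P of constants -/
def PropP (n : ℕ) (Λ M μ : ℝ) : Prop :=
    ∀ (w : EuS n → ℝ) (c : EuS n) (t ℓ : ℝ), 0 < t → 0 < ℓ → ContDiff ℝ 2 w →
    (∀ x ∈ closedBall c (2 * t), 0 ≤ w x) →
    (∀ x ∈ ball c (2 * t), ∃ A, Ell Λ A ∧ trA A (hess w x) ≤ ℓ / t ^ 2) →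
    (∃ x ∈ ball c t, w x ≤ ℓ) →
    ENNReal.ofReal μ * volume (ball c t) ≤ volume (ball c t ∩ {x | w x ≤ M * ℓ})

lemma lemmaP (n : ℕ) (hn : 0 < n) (Λ : ℝ) (hΛ : 1 ≤ Λ) : ∃ M μ : ℝ, 1 < M ∧ 0 < μ ∧ μ < 1 ∧
    PropP n Λ M μ := by
  obtain ⟨M, μ, hM, hμ, hμ1, H⟩ := lemmaP_unit n hn Λ hΛ
  refine ⟨M, μ, hM, hμ, hμ1, ?_⟩
  intro w c t ℓ ht hℓ hw hw0 htr ⟨x1, hx1, hwx1⟩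
  have key := H (fun y => ℓ⁻¹ * w (c + t • y)) (contDiff_affine hw _ _ _) ?_ ?_ ?_
  · have e1 : ball c t = (fun y => c + t • y) '' (ball 0 1) := by rw [affine_ball c ht, mul_one]
    have e2 : ball c t ∩ {x | w x ≤ M * ℓ} =
        (fun y => c + t • y) '' (ball 0 1 ∩ {x | ℓ⁻¹ * w (c + t • x) ≤ M}) := by
      have : {x | ℓ⁻¹ * w (c + t • x) ≤ M} = (fun y => c + t • y) ⁻¹' {x | w x ≤ M * ℓ} := by
        ext x
        change ℓ⁻¹ * w (c + t • x) ≤ M ↔ w (c + t • x) ≤ M * ℓ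
        rw [inv_mul_le_iff₀ hℓ, mul_comm]
      rw [this, Set.image_inter_preimage, ← e1]
    rw [e2, e1, vol_affine c ht, vol_affine c ht, ← mul_assoc, mul_comm (ENNReal.ofReal μ), mul_assoc]
    gcongr
  · intro y hy
    apply mul_nonneg (by positivity)
    apply hw0
    rw [mem_closedBall_zero_iff] at hy
    rw [mem_closedBall, dist_eq_norm, add_sub_cancel_left, norm_smul, Real.norm_of_nonneg ht.le]
    nlinarith
  · intro y hy
    rw [mem_ball_zero_iff] at hy
    obtain ⟨A, hA, h1⟩ := htr (c + t • y) (by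
      rw [mem_ball, dist_eq_norm, add_sub_cancel_left, norm_smul, Real.norm_of_nonneg ht.le]
      nlinarith)
    refine ⟨A, hA, ?_⟩
    rw [hess_affine hw, trA_smul]
    have := mul_le_mul_of_nonneg_left h1 (by positivity : 0 ≤ ℓ⁻¹ * t ^ 2)
    refine this.trans (le_of_eq ?_)
    field_simp
  · have : x1 ∈ (fun y => c + t • y) '' (ball 0 1) := by rw [affine_ball c ht, mul_one]; exact hx1
    obtain ⟨y, hy, rfl⟩ := this
    refine ⟨y, hy, ?_⟩
    simp only at hwx1 ⊢
    rw [inv_mul_le_iff₀ hℓ, mul_one]; exact hwx1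

end B2

lemma ink_ball {n : ℕ} (hn : 0 < n) (x0 : EuS n) {r μ : ℝ} (hr : 0 < r) (hμ : 0 < μ)
    (E : Set (EuS n)) (hE : IsOpen E) (hEB : E ⊆ ball x0 r)
    (hEm : volume E ≤ ENNReal.ofReal (1 - μ) * volume (ball x0 r)) (hμ1 : μ < 1)
    (x : EuS n) (hx : x ∈ E) :
    ∃ (c : EuS n) (t : ℝ), 0 < t ∧ t ≤ r ∧ x ∈ ball c t ∧ ball c t ⊆ ball x0 r ∧
      volume (ball c t \ E) = ENNReal.ofReal (μ / 2) * volume (ball c t) ∧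
      ENNReal.ofReal (1 - μ) * volume (ball c t) < volume (E ∩ ball c t) := by
  haveI : Nonempty (Fin n) := ⟨⟨0, hn⟩⟩
  haveI : Nontrivial (EuS n) := inferInstance
  have hxr : ‖x - x0‖ < r := by simpa [dist_eq_norm] using hEB hx
  set C : ℝ → EuS n := fun s => x0 + (1 - s) • (x - x0) with hC
  set Bs : ℝ → Set (EuS n) := fun s => ball (C s) (s * r) with hBs
  have hnest : ∀ s s', s ≤ s' → Bs s ⊆ Bs s' := by
    intro s s' h
    apply ball_subset_ball'
    have : dist (C s) (C s') = (s' - s) * ‖x - x0‖ := by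
      rw [dist_eq_norm]
      have : C s - C s' = (s' - s) • (x - x0) := by simp only [hC]; module
      rw [this, norm_smul, Real.norm_of_nonneg (by linarith)]
    rw [this]
    nlinarith
  have hxB : ∀ s, 0 < s → x ∈ Bs s := by
    intro s hs
    simp only [hBs, mem_ball, dist_eq_norm]
    have : x - C s = s • (x - x0) := by simp only [hC]; module
    rw [this, norm_smul, Real.norm_of_nonneg hs.le]
    exact mul_lt_mul_of_pos_left hxr hs
  have hB1 : Bs 1 = ball x0 r := by simp [hBs, hC]
  set ω := volume.real (ball (0 : EuS n) 1) with hω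
  have hωp : 0 < ω := ENNReal.toReal_pos (measure_ball_pos _ _ one_pos).ne' measure_ball_lt_top.ne
  have hV : ∀ s, 0 ≤ s → volume.real (Bs s) = (s * r) ^ n * ω := by
    intro s hs
    simp only [hBs, Measure.real]
    rw [Measure.addHaar_ball _ _ (by positivity), ENNReal.toReal_mul, ENNReal.toReal_ofReal (by positivity)]
    simp [hω, Measure.real]
  have hfin : ∀ s, volume (Bs s) ≠ ⊤ := fun s => measure_ball_lt_top.ne
  have hEn : MeasurableSet E := hE.measurableSet
  have hsplit : ∀ s, volume.real (E ∩ Bs s) + volume.real (Bs s \ E) = volume.real (Bs s) := by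
    intro s
    rw [inter_comm]
    exact measureReal_inter_add_sdiff₀ hEn.nullMeasurableSet (hfin s)
  have hmono1 : ∀ s s', s ≤ s' → volume.real (E ∩ Bs s) ≤ volume.real (E ∩ Bs s') := fun s s' h =>
    measureReal_mono (inter_subset_inter_right _ (hnest s s' h)) (measure_ne_top_of_subset inter_subset_right (hfin s'))
  have hmono2 : ∀ s s', s ≤ s' → volume.real (Bs s \ E) ≤ volume.real (Bs s' \ E) := fun s s' h =>
    measureReal_mono (sdiff_subset_sdiff_left (hnest s s' h)) (measure_ne_top_of_subset sdiff_subset (hfin s'))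
  -- continuity
  have hcont : ContinuousOn (fun s => volume.real (E ∩ Bs s)) (Icc 0 1) := by
    have hVc : ContinuousOn (fun s : ℝ => (s * r) ^ n * ω) (Icc 0 1) := by fun_prop
    rw [Metric.continuousOn_iff] at hVc ⊢
    intro b hb ε hε
    obtain ⟨δ, hδ, h⟩ := hVc b hb ε hε
    refine ⟨δ, hδ, fun a ha hab => lt_of_le_of_lt ?_ (h a ha hab)⟩
    rw [Real.dist_eq, Real.dist_eq, ← hV a ha.1, ← hV b hb.1, ← hsplit a, ← hsplit b]
    rcases le_total a b with hh | hh
    · have := hmono1 a b hh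
      have := hmono2 a b hh
      rw [abs_sub_comm, abs_of_nonneg (by linarith), abs_sub_comm, abs_of_nonneg (by linarith)]
      linarith
    · have := hmono1 b a hh
      have := hmono2 b a hh
      rw [abs_of_nonneg (by linarith), abs_of_nonneg (by linarith)]
      linarith
  -- small s
  obtain ⟨ε, hε, hεE⟩ := Metric.isOpen_iff.mp hE x hx
  set s0 : ℝ := min 1 (ε / (2 * r)) with hs0
  have hs0p : 0 < s0 := by positivity
  have hs01 : s0 ≤ 1 := min_le_left _ _
  have hsm : Bs s0 ⊆ E := by
    refine Subset.trans ?_ hεE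
    apply ball_subset_ball'
    have : C s0 - x = (-s0) • (x - x0) := by simp only [hC]; module
    rw [dist_eq_norm, this, norm_smul, norm_neg, Real.norm_of_nonneg hs0p.le]
    have h1 : s0 * r ≤ ε / 2 := by
      calc s0 * r ≤ ε / (2 * r) * r := mul_le_mul_of_nonneg_right (min_le_right _ _) hr.le
        _ = ε / 2 := by field_simp
    nlinarith
  have hg : ContinuousOn (fun s => volume.real (E ∩ Bs s) - (1 - μ / 2) * ((s * r) ^ n * ω)) (Icc s0 1) :=
    (hcont.mono (Icc_subset_Icc hs0p.le le_rfl)).sub (by fun_prop)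
  have hEr : volume.real E ≤ (1 - μ) * volume.real (ball x0 r) := by
    have := ENNReal.toReal_mono (ENNReal.mul_ne_top ENNReal.ofReal_ne_top measure_ball_lt_top.ne) hEm
    rwa [ENNReal.toReal_mul, ENNReal.toReal_ofReal (by linarith)] at this
  have hEB' : E ∩ Bs 1 = E := by rw [hB1]; exact inter_eq_left.mpr hEB
  have hv1 := hV 1 zero_le_one
  have hpos1 : 0 < (1 * r) ^ n * ω := by positivity
  have hpos0 : 0 < (s0 * r) ^ n * ω := by positivity
  obtain ⟨s, hs, hs2⟩ := intermediate_value_Icc' hs01 hg (show (0:ℝ) ∈ Icc _ _ by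
    constructor
    · simp only [hEB']
      rw [hB1] at hv1
      rw [hv1] at hEr
      nlinarith
    · rw [inter_eq_right.mpr hsm, hV s0 hs0p.le]
      nlinarith)
  simp only at hs2
  have hsp : 0 < s := hs0p.trans_le hs.1
  rw [← hV s hsp.le] at hs2
  have hVp : 0 < volume.real (Bs s) := by rw [hV s hsp.le]; positivity
  refine ⟨C s, s * r, by positivity, by nlinarith [hs.2], hxB s hsp, ?_, ?_, ?_⟩
  · rw [← hB1]; exact hnest s 1 hs.2
  · change volume (Bs s \ E) = _ * volume (Bs s)
    rw [← ofReal_measureReal (measure_ne_top_of_subset sdiff_subset (hfin s)),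
      ← ofReal_measureReal (hfin s), ← ENNReal.ofReal_mul (by linarith)]
    congr 1
    have := hsplit s
    linarith
  · change _ * volume (Bs s) < volume (E ∩ Bs s)
    rw [← ofReal_measureReal (measure_ne_top_of_subset inter_subset_right (hfin s)),
      ← ofReal_measureReal (hfin s), ← ENNReal.ofReal_mul (by linarith)]
    rw [ENNReal.ofReal_lt_ofReal_iff] <;> nlinarith

lemma ink_spots {n : ℕ} (hn : 0 < n) (x0 : EuS n) {r μ : ℝ} (hr : 0 < r) (hμ : 0 < μ)
    (hμ1 : μ < 1) (E F : Set (EuS n)) (hE : IsOpen E) (hEB : E ⊆ ball x0 r)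
    (hEm : volume E ≤ ENNReal.ofReal (1 - μ) * volume (ball x0 r))
    (hF : ∀ (c : EuS n) (t : ℝ), 0 < t → t ≤ r → ball c t ⊆ ball x0 r →
      ENNReal.ofReal (1 - μ) * volume (ball c t) < volume (E ∩ ball c t) → ball c t ⊆ F) :
    ENNReal.ofReal (1 + μ / 2 / 5 ^ n) * volume E ≤ volume F := by
  haveI : Nonempty (Fin n) := ⟨⟨0, hn⟩⟩
  haveI : Nontrivial (EuS n) := inferInstance
  have H := ink_ball hn x0 hr hμ E hE hEB hEm hμ1
  choose! c t ht htr hxc hcB hcE hcE2 using H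
  obtain ⟨u, huE, hud, hu⟩ := Vitali.exists_disjoint_subfamily_covering_enlargement_closedBall E c t r
    htr 5 (by norm_num)
  have hdisj : u.PairwiseDisjoint fun a => ball (c a) (t a) :=
    hud.mono fun a => ball_subset_closedBall
  have hcount : u.Countable := by
    apply hdisj.countable_of_nonempty_interior
    intro a ha
    rw [isOpen_ball.interior_eq]
    exact nonempty_ball.mpr (ht a (huE ha))
  have hmE := hE.measurableSet
  have h1 : volume E ≤ ENNReal.ofReal (5 ^ n) * ∑' a : u, volume (ball (c a) (t a)) := by
    have : E ⊆ ⋃ a ∈ u, closedBall (c a) (5 * t a) := by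
      intro x hx
      obtain ⟨b, hb, hs⟩ := hu x hx
      exact mem_biUnion hb (hs (ball_subset_closedBall (hxc x hx)))
    refine (measure_mono this).trans ?_
    refine (measure_biUnion_le _ hcount _).trans ?_
    rw [← ENNReal.tsum_mul_left]
    apply le_of_eq
    congr 1
    ext a
    have h0 : 0 ≤ t a := (ht a (huE a.2)).le
    rw [Measure.addHaar_closedBall _ _ (by positivity), Measure.addHaar_ball _ _ h0, ← mul_assoc,
      ← ENNReal.ofReal_mul (by positivity), mul_pow]
    simp
  have h2 : ENNReal.ofReal (μ / 2) * ∑' a : u, volume (ball (c a) (t a)) ≤ volume (F \ E) := by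
    have hsub : (⋃ a ∈ u, (ball (c a) (t a) \ E)) ⊆ F \ E := by
      apply iUnion₂_subset
      intro a ha
      exact sdiff_subset_sdiff_left (hF _ _ (ht a (huE ha)) (htr a (huE ha)) (hcB a (huE ha)) (hcE2 a (huE ha)))
    refine le_trans ?_ (measure_mono hsub)
    rw [measure_biUnion hcount (hdisj.mono fun a => sdiff_subset)
      (fun a _ => isOpen_ball.measurableSet.diff hmE), ← ENNReal.tsum_mul_left]
    apply le_of_eq
    congr 1
    ext a
    exact (hcE a (huE a.2)).symm
  have hEF : E ⊆ F := fun x hx => hF _ _ (ht x hx) (htr x hx) (hcB x hx) (hcE2 x hx) (hxc x hx)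
  have h3 : volume E + volume (F \ E) = volume F := by
    have := measure_inter_add_sdiff (μ := volume) F hmE
    rwa [inter_eq_right.mpr hEF] at this
  rw [← h3, ENNReal.ofReal_add (by norm_num) (by positivity), add_mul, ENNReal.ofReal_one, one_mul]
  gcongr
  refine le_trans ?_ h2
  rw [div_eq_mul_inv (μ / 2), ENNReal.ofReal_mul (by positivity), mul_assoc]
  gcongr
  rw [ENNReal.ofReal_inv_of_pos (by positivity)]
  rw [mul_comm, ← div_eq_mul_inv]
  apply ENNReal.div_le_of_le_mul
  rw [mul_comm]; exact h1

lemma compl_meas {n : ℕ} {c : EuS n} {t μ a : ℝ} (hμ1 : μ < 1) (hμ : 0 < μ) {w : EuS n → ℝ} (hw : Continuous w)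
    (h : ENNReal.ofReal μ * volume (ball c t) ≤ volume (ball c t ∩ {x | w x ≤ a})) :
    volume (ball c t ∩ {x | a < w x}) ≤ ENNReal.ofReal (1 - μ) * volume (ball c t) := by
  have hm : MeasurableSet {x | w x ≤ a} := (isClosed_le hw continuous_const).measurableSet
  have h1 := measure_inter_add_sdiff (μ := volume) (ball c t) hm
  have e : ball c t \ {x | w x ≤ a} = ball c t ∩ {x | a < w x} := by
    ext x; simp
  rw [e] at h1
  have hfin : volume (ball c t) ≠ ⊤ := measure_ball_lt_top.ne
  have h2 : ENNReal.ofReal μ * volume (ball c t) + volume (ball c t ∩ {x | a < w x}) ≤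
      ENNReal.ofReal μ * volume (ball c t) + ENNReal.ofReal (1 - μ) * volume (ball c t) := by
    rw [← add_mul, ← ENNReal.ofReal_add hμ.le (by linarith)]
    simp only [add_sub_cancel, ENNReal.ofReal_one, one_mul]
    rw [← h1] 
    gcongr
    rw [h1]; exact h
  exact (ENNReal.add_le_add_iff_left (ENNReal.mul_ne_top ENNReal.ofReal_ne_top hfin)).mp h2

lemma decay {n : ℕ} (hn : 0 < n) {Λ M μ : ℝ} (hM : 1 < M) (hμ : 0 < μ) (hμ1 : μ < 1)
    (hP : PropP n Λ M μ) {w : EuS n → ℝ} (hw : ContDiff ℝ 2 w) (x0 : EuS n) {r ℓ : ℝ} (hr : 0 < r)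
    (hℓ : 0 < ℓ) (hw0 : ∀ x ∈ ball x0 (4 * r), 0 ≤ w x)
    (htr : ∀ x ∈ ball x0 (4 * r), ∃ A, Ell Λ A ∧ trA A (hess w x) ≤ ℓ / r ^ 2)
    (hx1 : ∃ x ∈ ball x0 r, w x ≤ ℓ) (k : ℕ) :
    ENNReal.ofReal (1 + μ / 2 / 5 ^ n) ^ k * volume (ball x0 r ∩ {x | M ^ k * ℓ < w x}) ≤
      volume (ball x0 r) := by
  have hPP : ∀ (c : EuS n) (t : ℝ) (L : ℝ), 0 < t → t ≤ r → ball c t ⊆ ball x0 r → ℓ ≤ L →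
      (∃ x ∈ ball c t, w x ≤ L) → 
      volume (ball c t ∩ {x | M * L < w x}) ≤ ENNReal.ofReal (1 - μ) * volume (ball c t) := by
    intro c t L ht htr' hc hL hx
    apply compl_meas hμ1 hμ hw.continuous
    have hcd : dist c x0 < r := hc (mem_ball_self ht)
    apply hP w c t L ht (hℓ.trans_le hL) hw _ _ hx
    · intro x hxx
      apply hw0
      have := dist_triangle x c x0
      rw [mem_closedBall] at hxx
      rw [mem_ball]; linarith
    · intro x hxx
      obtain ⟨A, hA, h⟩ := htr x (by
        have := dist_triangle x c x0
        rw [mem_ball] at hxx ⊢; linarith)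
      refine ⟨A, hA, h.trans ?_⟩
      gcongr
      exact hℓ.le.trans hL
  induction k with
  | zero => simp; exact measure_mono inter_subset_left
  | succ k ih =>
    have hMk : 1 ≤ M ^ k := one_le_pow₀ hM.le
    have hLk : ℓ ≤ M ^ k * ℓ := le_mul_of_one_le_left hℓ.le hMk
    refine le_trans ?_ ih
    rw [pow_succ, mul_assoc]
    gcongr
    apply ink_spots hn x0 hr hμ hμ1
    · exact isOpen_ball.inter (isOpen_lt continuous_const hw.continuous)
    · exact inter_subset_left
    · refine le_trans (measure_mono ?_) (hPP x0 r ℓ hr le_rfl subset_rfl le_rfl hx1)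
      rintro x ⟨hx, hx2⟩
      refine ⟨hx, ?_⟩
      change M * ℓ < w x
      have hx3 : M ^ (k+1) * ℓ < w x := hx2
      have := mul_le_mul_of_nonneg_left hLk (by linarith : 0 ≤ M)
      rw [pow_succ] at hx3
      linarith
    · intro c t ht htr' hc hd x hx
      refine ⟨hc hx, ?_⟩
      by_contra! hcon
      have hcon' : w x ≤ M ^ k * ℓ := by simpa using hcon
      have := hPP c t (M ^ k * ℓ) ht htr' hc hLk ⟨x, hx, hcon'⟩
      refine absurd (hd.trans_le (le_trans (measure_mono ?_) this)) (lt_irrefl _)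
      rintro y ⟨⟨_, hy⟩, hy2⟩
      refine ⟨hy2, ?_⟩
      change M * (M ^ k * ℓ) < w y
      have : M ^ (k+1) * ℓ < w y := hy
      rw [pow_succ] at this
      linarith

lemma weak_harnack (n : ℕ) (hn : 0 < n) (Λ : ℝ) (hΛ : 1 ≤ Λ) : ∃ θ : ℝ, 0 < θ ∧ θ < 1 ∧
    ∀ (w : EuS n → ℝ) (x0 : EuS n) (r τ : ℝ), 0 < r → 0 < τ → ContDiff ℝ 2 w →
    (∀ x ∈ ball x0 (4 * r), 0 ≤ w x) →
    (∀ x ∈ ball x0 (4 * r), ∃ A, Ell Λ A ∧ trA A (hess w x) ≤ θ * τ / r ^ 2) →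
    volume (ball x0 r) ≤ 2 * volume (ball x0 r ∩ {x | τ ≤ w x}) →
    ∀ x ∈ ball x0 r, θ * τ < w x := by
  obtain ⟨M, μ, hM, hμ, hμ1, hP⟩ := lemmaP n hn Λ hΛ
  obtain ⟨k, hk⟩ := pow_unbounded_of_one_lt 2 (show 1 < 1 + μ / 2 / 5 ^ n by
    have : 0 < μ / 2 / 5 ^ n := by positivity
    linarith)
  have hMk : 1 ≤ M ^ k := one_le_pow₀ hM.le
  refine ⟨1 / (2 * M ^ k), by positivity, ?_, ?_⟩
  · rw [div_lt_one (by positivity)]; linarith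
  intro w x0 r τ hr hτ hw hw0 htr hvol x hx
  by_contra! hcon
  have := decay hn hM hμ hμ1 hP hw x0 hr (by positivity) hw0 htr ⟨x, hx, hcon⟩ k
  have e : M ^ k * (1 / (2 * M ^ k) * τ) = τ / 2 := by field_simp
  rw [e] at this
  have h2 : volume (ball x0 r ∩ {x | τ ≤ w x}) ≤ volume (ball x0 r ∩ {x | τ / 2 < w x}) := by
    apply measure_mono
    rintro y ⟨hy, hy2⟩
    refine ⟨hy, ?_⟩
    change τ / 2 < w y
    have : τ ≤ w y := hy2
    linarith
  set V := volume (ball x0 r) with hV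
  have hVp : 0 < V := measure_ball_pos _ _ hr
  have hVf : V ≠ ⊤ := measure_ball_lt_top.ne
  set S := volume (ball x0 r ∩ {x | τ / 2 < w x}) with hS
  have hS0 : S ≠ 0 := by
    intro h0
    rw [h0] at h2
    have : volume (ball x0 r ∩ {x | τ ≤ w x}) = 0 := le_antisymm h2 zero_le
    rw [this, mul_zero] at hvol
    exact absurd hvol (not_le.mpr hVp)
  have hSf : S ≠ ⊤ := measure_ne_top_of_subset inter_subset_left hVf
  have h3 : 2 * S < ENNReal.ofReal (1 + μ / 2 / 5 ^ n) ^ k * S := by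
    rw [ENNReal.mul_lt_mul_iff_left hS0 hSf, ← ENNReal.ofReal_pow (by positivity)]
    rw [← ENNReal.ofReal_ofNat, ENNReal.ofReal_lt_ofReal_iff (by positivity)]
    exact hk
  have h4 : V ≤ 2 * S := hvol.trans (by gcongr)
  exact absurd (h4.trans_lt (h3.trans_le this)) (lt_irrefl _)

lemma fderiv_expf {n : ℕ} {u : EuS n → ℝ} (hu : ContDiff ℝ 2 u) (l : ℝ) (x : EuS n) :
    HasFDerivAt (fun x => 1 - rexp (-l * u x)) ((l * rexp (-l * u x)) • fderiv ℝ u x) x := by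
  have h1 := (hu.differentiable (by norm_num) x).hasFDerivAt
  have h2 := ((h1.const_mul (-l)).exp).const_sub 1
  have e : (l * rexp (-l * u x)) • fderiv ℝ u x = -(rexp (-l * u x) • -l • fderiv ℝ u x) := by
    ext y; simp; ring
  rw [e]; exact h2

lemma hess_expf {n : ℕ} {u : EuS n → ℝ} (hu : ContDiff ℝ 2 u) (l : ℝ) (x : EuS n) :
    hess (fun x => 1 - rexp (-l * u x)) x =
      (l * rexp (-l * u x)) • (hess u x - l • rk1 (fderiv ℝ u x)) := by
  have e0 : fderiv ℝ (fun x => 1 - rexp (-l * u x)) = fun x => (l * rexp (-l * u x)) • fderiv ℝ u x := by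
    ext1 x; exact (fderiv_expf hu l x).fderiv
  have h1 := (hu.differentiable (by norm_num) x).hasFDerivAt
  have h2 := (((h1.const_mul (-l)).exp).const_mul l).smul (hasFDerivAt_fderiv hu x)
  have h3 : HasFDerivAt (fun x => (l * rexp (-l * u x)) • fderiv ℝ u x) _ x := h2
  conv_lhs => rw [hess, e0, h3.fderiv]
  ext ξ ζ
  simp [rk1_apply]
  ring

lemma osc_one (n : ℕ) (hn : 0 < n) (Λ K ε0 : ℝ) (hΛ : 1 ≤ Λ) (hK : 1 ≤ K) (hε : 0 < ε0) :
    ∃ c0 δ : ℝ, 0 < c0 ∧ 0 < δ ∧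
    ∀ (u : EuS n → ℝ) (x0 : EuS n) (r ω Q : ℝ), 0 < r → ε0 ≤ ω → ContDiff ℝ 2 u →
    (∀ x ∈ ball x0 (4 * r), 0 ≤ u x) →
    (∀ x ∈ ball x0 (4 * r), ∃ A, Ell Λ A ∧ |trA A (hess u x)| ≤ K * (‖fderiv ℝ u x‖ ^ 2 + Q)) →
    0 ≤ Q → r ^ 2 * Q ≤ δ →
    volume (ball x0 r) ≤ 2 * volume (ball x0 r ∩ {x | ω / 2 ≤ u x}) →
    ∀ x ∈ ball x0 r, c0 ≤ u x := by
  obtain ⟨θ, hθ, hθ1, H⟩ := weak_harnack n hn Λ hΛ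
  set l := Λ * K with hl
  have hlp : 0 < l := by positivity
  set τ := 1 - rexp (-l * (ε0 / 2)) with hτ
  have hτp : 0 < τ := by
    rw [hτ, sub_pos, Real.exp_lt_one_iff]; 
    have : 0 < l * (ε0 / 2) := by positivity
    linarith
  refine ⟨θ * τ / l, θ * τ / (l * K), by positivity, by positivity, ?_⟩
  intro u x0 r ω Q hr hω hu hu0 htr hQ0 hQ hvol x hx
  have hw : ContDiff ℝ 2 (fun x => 1 - rexp (-l * u x)) :=
    contDiff_const.sub (Real.contDiff_exp.comp (contDiff_const.mul hu))
  have := H (fun x => 1 - rexp (-l * u x)) x0 r τ hr hτp hw ?_ ?_ ?_ x hx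
  · have h1 := Real.add_one_le_exp (-l * u x)
    rw [div_le_iff₀ hlp]
    nlinarith
  · intro y hy
    have := hu0 y hy
    simp only [sub_nonneg, Real.exp_le_one_iff]
    have : 0 ≤ l * u y := by positivity
    linarith
  · intro y hy
    obtain ⟨A, hA, h⟩ := htr y hy
    refine ⟨A, hA, ?_⟩
    rw [hess_expf hu, trA_smul, trA_sub, trA_smul]
    have h1 := (trA_rk1 hA (fderiv ℝ u y)).1
    have h2 := mul_le_mul_of_nonneg_left h1 hlp.le
    have h3 : l * (Λ⁻¹ * ‖fderiv ℝ u y‖ ^ 2) = K * ‖fderiv ℝ u y‖ ^ 2 := by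
      rw [hl]; field_simp
    have h4 := (abs_le.mp h).2
    have h5 : trA A (hess u y) - l * trA A (rk1 (fderiv ℝ u y)) ≤ K * Q := by linarith
    have h6 : rexp (-l * u y) ≤ 1 := by
      rw [Real.exp_le_one_iff]
      have := hu0 y hy
      have : 0 ≤ l * u y := by positivity
      linarith
    have h7 : l * rexp (-l * u y) * (trA A (hess u y) - l * trA A (rk1 (fderiv ℝ u y))) ≤ l * (K * Q) := by
      calc _ ≤ l * rexp (-l * u y) * (K * Q) := mul_le_mul_of_nonneg_left h5 (by positivity)
        _ ≤ l * 1 * (K * Q) := by gcongr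
        _ = _ := by ring
    refine h7.trans ?_
    rw [le_div_iff₀ (by positivity)]
    rw [le_div_iff₀ (by positivity)] at hQ
    linarith
  · refine hvol.trans ?_
    refine mul_le_mul_right (measure_mono (inter_subset_inter_right _ ?_)) _
    intro y hy
    have hy' : ω / 2 ≤ u y := hy
    change τ ≤ 1 - rexp (-l * u y)
    rw [hτ]
    gcongr 1 - ?_
    apply Real.exp_le_exp.mpr
    nlinarith

lemma osc_step (n : ℕ) (hn : 0 < n) (Λ K ε0 : ℝ) (hΛ : 1 ≤ Λ) (hK : 1 ≤ K) (hε : 0 < ε0) :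
    ∃ c0 δ : ℝ, 0 < c0 ∧ 0 < δ ∧
    ∀ (φ : EuS n → ℝ) (x0 : EuS n) (r m ω Q : ℝ), 0 < r → ε0 ≤ ω → ContDiff ℝ 2 φ →
    (∀ x ∈ ball x0 (4 * r), m ≤ φ x ∧ φ x ≤ m + ω) →
    (∀ x ∈ ball x0 (4 * r), ∃ A, Ell Λ A ∧ |trA A (hess φ x)| ≤ K * (‖fderiv ℝ φ x‖ ^ 2 + Q)) →
    0 ≤ Q → r ^ 2 * Q ≤ δ →
    ∃ m', ∀ x ∈ ball x0 r, m' ≤ φ x ∧ φ x ≤ m' + (ω - c0) := by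
  obtain ⟨c0, δ, hc0, hδ, H⟩ := osc_one n hn Λ K ε0 hΛ hK hε
  refine ⟨c0, δ, hc0, hδ, ?_⟩
  intro φ x0 r m ω Q hr hω hφ hb htr hQ0 hQ
  have hsub : ball x0 r ⊆ ball x0 (4 * r) := ball_subset_ball (by linarith)
  by_cases hcase : volume (ball x0 r) ≤ 2 * volume (ball x0 r ∩ {x | m + ω / 2 ≤ φ x})
  · -- u = φ - m
    have hu : ContDiff ℝ 2 (fun x => φ x - m) := hφ.sub contDiff_const
    have e1 : fderiv ℝ (fun x => φ x - m) = fderiv ℝ φ := by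
      ext1 x; exact fderiv_sub_const m
    have e2 : ∀ x, hess (fun x => φ x - m) x = hess φ x := by intro x; rw [hess, e1, hess]
    have := H (fun x => φ x - m) x0 r ω Q hr hω hu (fun x hx => by linarith [(hb x hx).1]) (by
      intro x hx; rw [e2, e1]; exact htr x hx) hQ0 hQ (by
      refine hcase.trans ?_
      refine mul_le_mul_right (measure_mono (inter_subset_inter_right _ ?_)) _
      intro y hy
      have hy' : m + ω / 2 ≤ φ y := hy
      change ω / 2 ≤ φ y - m
      linarith)
    refine ⟨m + c0, fun x hx => ⟨?_, ?_⟩⟩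
    · have := this x hx; linarith
    · have := (hb x (hsub hx)).2; linarith
  · -- u = m + ω - φ
    have hu : ContDiff ℝ 2 (fun x => m + ω - φ x) := contDiff_const.sub hφ
    have e1 : fderiv ℝ (fun x => m + ω - φ x) = fun x => - fderiv ℝ φ x := by
      ext1 x; exact fderiv_const_sub (m + ω)
    have e2 : ∀ x, hess (fun x => m + ω - φ x) x = - hess φ x := by
      intro x; rw [hess, e1, hess]; exact fderiv_fun_neg
    have := H (fun x => m + ω - φ x) x0 r ω Q hr hω hu (fun x hx => by linarith [(hb x hx).2]) (by
      intro x hx; rw [e2, e1]; simp only [trA_neg, abs_neg, norm_neg]; exact htr x hx) hQ0 hQ (by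
      have hm : MeasurableSet {x | m + ω / 2 ≤ φ x} := (isClosed_le continuous_const hφ.continuous).measurableSet
      have h1 := measure_inter_add_sdiff (μ := volume) (ball x0 r) hm
      push Not at hcase
      have hfin : volume (ball x0 r) ≠ ⊤ := measure_ball_lt_top.ne
      set V := volume (ball x0 r)
      set S := volume (ball x0 r ∩ {x | m + ω / 2 ≤ φ x})
      have hS : S ≠ ⊤ := measure_ne_top_of_subset inter_subset_left hfin
      have h2 : V ≤ 2 * volume (ball x0 r \ {x | m + ω / 2 ≤ φ x}) := by
        set T := volume (ball x0 r \ {x | m + ω / 2 ≤ φ x})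
        by_contra! h3
        have : 2 * S + 2 * T < V + V := ENNReal.add_lt_add hcase h3
        rw [← mul_add, h1, two_mul] at this
        exact lt_irrefl _ this
      refine h2.trans ?_
      gcongr
      rintro y ⟨hy1, hy2⟩
      refine ⟨hy1, ?_⟩
      have hy' : ¬ (m + ω / 2 ≤ φ y) := hy2
      change ω / 2 ≤ m + ω - φ y
      linarith)
    refine ⟨m, fun x hx => ⟨(hb x (hsub hx)).1, ?_⟩⟩
    have := this x hx; linarith

lemma osc_decay (n : ℕ) (hn : 0 < n) (Λ K ε0 : ℝ) (hΛ : 1 ≤ Λ) (hK : 1 ≤ K) (hε : 0 < ε0) :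
    ∃ C1 : ℝ, 1 ≤ C1 ∧
    ∀ (φ : EuS n → ℝ) (x0 : EuS n) (κ : ℝ), 1 ≤ κ → ContDiff ℝ 2 φ →
    (∀ x ∈ ball x0 (1/4), 0 ≤ φ x ∧ φ x ≤ κ) →
    (∀ x ∈ ball x0 (1/4), ∃ A, Ell Λ A ∧ |trA A (hess φ x)| ≤ K * (‖fderiv ℝ φ x‖ ^ 2 + rexp κ)) →
    ∀ x ∈ ball x0 (rexp (-C1 * κ)), ∀ y ∈ ball x0 (rexp (-C1 * κ)), |φ x - φ y| ≤ ε0 := by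
  obtain ⟨c0, δ, hc0, hδ, H⟩ := osc_step n hn Λ K ε0 hΛ hK hε
  obtain ⟨d, hd⟩ : ∃ d : ℝ, d = min (1/4) (Real.sqrt δ) := ⟨_, rfl⟩
  have hdp : 0 < d := by rw [hd]; have := Real.sqrt_pos.mpr hδ; positivity
  have hd2 : d ^ 2 ≤ δ := by
    have h1 : d ≤ Real.sqrt δ := by rw [hd]; exact min_le_right _ _
    calc d ^ 2 ≤ Real.sqrt δ ^ 2 := by gcongr
      _ = δ := Real.sq_sqrt hδ.le
  have hd4 : d ≤ 1/4 := by rw [hd]; exact min_le_left _ _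
  set C1 : ℝ := max 1 (1 + Real.log 4 * (1 / c0 + 1) - Real.log d) with hC1
  refine ⟨C1, le_max_left _ _, ?_⟩
  intro φ x0 κ hκ hφ hb htr
  set R : ℝ := d * rexp (-κ) with hR
  have hRp : 0 < R := by positivity
  have hR4 : R ≤ 1/4 := by
    have : rexp (-κ) ≤ 1 := by rw [Real.exp_le_one_iff]; linarith
    calc R ≤ d * 1 := by rw [hR]; gcongr
      _ ≤ 1/4 := by linarith
  have key : ∀ k : ℕ, ∃ m, ∀ x ∈ ball x0 (R / 4 ^ k), m ≤ φ x ∧ φ x ≤ m + max ε0 (κ - k * c0) := by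
    intro k
    induction k with
    | zero =>
      refine ⟨0, fun x hx => ?_⟩
      have := hb x (ball_subset_ball (by simpa using hR4) hx)
      refine ⟨this.1, ?_⟩
      have h2 := le_max_right ε0 (κ - (0:ℕ) * c0)
      simp at h2 ⊢; right; exact this.2
    | succ k ih =>
      obtain ⟨m, hm⟩ := ih
      have hrk : R / 4 ^ k = 4 * (R / 4 ^ (k+1)) := by rw [pow_succ]; field_simp
      have hkp : 0 < R / 4 ^ (k+1) := by positivity
      by_cases hlt : κ - k * c0 ≤ ε0
      · refine ⟨m, fun x hx => ?_⟩
        have := hm x (ball_subset_ball (by linarith) hx)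
        rw [max_eq_left hlt] at this
        exact ⟨this.1, this.2.trans (by gcongr; exact le_max_left _ _)⟩
      · push Not at hlt
        rw [hrk] at hm
        have hle : R / 4 ^ (k+1) ≤ R := div_le_self hRp.le (one_le_pow₀ (by norm_num))
        have hsub : ball x0 (4 * (R / 4 ^ (k+1))) ⊆ ball x0 (1/4) := by
          rw [← hrk]; apply ball_subset_ball
          exact (div_le_self hRp.le (one_le_pow₀ (by norm_num))).trans hR4
        obtain ⟨m', hm'⟩ := H φ x0 (R / 4 ^ (k+1)) m (max ε0 (κ - k * c0)) (rexp κ) hkp (le_max_left _ _) hφ hm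
          (fun x hx => htr x (hsub hx)) (Real.exp_pos _).le (by
            calc (R / 4 ^ (k+1)) ^ 2 * rexp κ ≤ R ^ 2 * rexp κ := by gcongr
              _ = d ^ 2 * rexp (-κ) * (rexp (-κ) * rexp κ) := by rw [hR]; ring
              _ = d ^ 2 * rexp (-κ) := by rw [← Real.exp_add]; simp
              _ ≤ d ^ 2 * 1 := by
                gcongr
                rw [Real.exp_le_one_iff]; linarith
              _ ≤ δ := by linarith)
        refine ⟨m', fun x hx => ⟨(hm' x hx).1, (hm' x hx).2.trans ?_⟩⟩
        gcongr
        rw [max_eq_right hlt.le]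
        refine le_trans (le_of_eq ?_) (le_max_right _ _)
        push_cast; ring
  obtain ⟨m, hm⟩ := key ⌈κ / c0⌉₊
  have hceil := Nat.le_ceil (κ / c0)
  have hceil2 := Nat.ceil_lt_add_one (show 0 ≤ κ / c0 by positivity)
  have hmax : max ε0 (κ - (⌈κ / c0⌉₊ : ℝ) * c0) = ε0 := by
    apply max_eq_left
    rw [div_le_iff₀ hc0] at hceil
    linarith
  rw [hmax] at hm
  have hlog4 : 0 < Real.log 4 := Real.log_pos (by norm_num)
  have hlogd : Real.log d ≤ 0 := Real.log_nonpos hdp.le (by linarith)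
  have hrad : rexp (-C1 * κ) ≤ R / 4 ^ ⌈κ / c0⌉₊ := by
    have e1 : R / 4 ^ ⌈κ / c0⌉₊ = rexp (Real.log d - κ - ⌈κ / c0⌉₊ * Real.log 4) := by
      rw [Real.exp_sub, Real.exp_sub, Real.exp_log hdp, Real.exp_nat_mul, Real.exp_log (by norm_num), hR,
        Real.exp_neg]
      rfl
    rw [e1]
    apply Real.exp_le_exp.mpr
    have h1 : 1 + Real.log 4 * (1 / c0 + 1) - Real.log d ≤ C1 := le_max_right _ _
    have h2 : (⌈κ / c0⌉₊ : ℝ) * Real.log 4 ≤ (κ / c0 + 1) * Real.log 4 := by gcongr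
    have h3 : (κ / c0 + 1) ≤ κ * (1 / c0 + 1) := by
      have : κ / c0 = κ * (1 / c0) := by ring
      rw [this]; linarith
    have h4 : (κ / c0 + 1) * Real.log 4 ≤ κ * (1 / c0 + 1) * Real.log 4 := by gcongr
    have h5 : (1 + Real.log 4 * (1 / c0 + 1) - Real.log d) * κ ≤ C1 * κ := by gcongr
    nlinarith
  intro x hx y hy
  have h1 := hm x (ball_subset_ball hrad hx)
  have h2 := hm y (ball_subset_ball hrad hy)
  rw [abs_le]; constructor <;> linarith

/-- Laplacian -/
noncomputable def lapl {n : ℕ} (v : EuS n → ℝ) (x : EuS n) : ℝ := ∑ i, hess v x (ee i) (ee i)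

lemma kernel_exists (n : ℕ) (hn : 0 < n) : ∃ Ψ η : EuS n → ℝ, ContDiff ℝ 3 Ψ ∧ ContDiff ℝ 3 η ∧
    (∀ z, 1 ≤ ‖z‖ → Ψ z = 0) ∧ (∀ z, 1 ≤ ‖z‖ → η z = 0) ∧
    (∀ z w, fderiv ℝ Ψ z w = - (η z * inner ℝ z w)) ∧ 0 < ∫ z, η z := by
  have hd : ContDiff ℝ 3 (deriv expNegInvGlue) := by
    have h := (expNegInvGlue.contDiff (n := (⊤:ℕ∞)))
    have := (contDiff_infty_iff_deriv.mp h).2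
    exact this.of_le (WithTop.coe_le_coe.mpr (le_top : (3:ℕ∞) ≤ ⊤))
  have hz : ∀ t ≤ 0, deriv expNegInvGlue t = 0 := by
    have h0 : ∀ t < 0, deriv expNegInvGlue t = 0 := by
      intro t ht
      have : expNegInvGlue =ᶠ[nhds t] fun _ => 0 := by
        filter_upwards [Iio_mem_nhds ht] with s hs
        exact expNegInvGlue.zero_of_nonpos (le_of_lt hs)
      rw [this.deriv_eq]; simp
    intro t ht
    have : closure (Iio (0:ℝ)) ⊆ {t | deriv expNegInvGlue t = 0} :=
      closure_minimal (fun t ht => h0 t ht) (isClosed_eq hd.continuous continuous_const)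
    rw [closure_Iio] at this
    exact this ht
  have hnn : ∀ t, 0 ≤ deriv expNegInvGlue t := fun t => expNegInvGlue.monotone.deriv_nonneg
  have hsq : ContDiff ℝ 3 (fun z : EuS n => 1 - ‖z‖ ^ 2) := contDiff_const.sub (contDiff_norm_sq ℝ)
  have hη : ContDiff ℝ 3 (fun z : EuS n => 2 * deriv expNegInvGlue (1 - ‖z‖ ^ 2)) :=
    contDiff_const.mul (hd.comp hsq)
  have hη0 : ∀ z : EuS n, 1 ≤ ‖z‖ → 2 * deriv expNegInvGlue (1 - ‖z‖ ^ 2) = 0 := by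
    intro z hz1
    rw [hz _ (by nlinarith)]; simp
  refine ⟨fun z => expNegInvGlue (1 - ‖z‖ ^ 2), fun z => 2 * deriv expNegInvGlue (1 - ‖z‖ ^ 2),
    (expNegInvGlue.contDiff (n := 3)).comp hsq, hη, ?_, hη0, ?_, ?_⟩
  · intro z hz1
    exact expNegInvGlue.zero_of_nonpos (by nlinarith)
  · intro z w
    have h1 : HasDerivAt expNegInvGlue (deriv expNegInvGlue (1 - ‖z‖^2)) (1 - ‖z‖^2) :=
      ((expNegInvGlue.contDiff (n := 1)).differentiable (by norm_num) _).hasDerivAt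
    have h2 : HasFDerivAt (fun z : EuS n => 1 - ‖z‖ ^ 2) _ z :=
      ((hasStrictFDerivAt_norm_sq z).hasFDerivAt).const_sub 1
    have h3 : HasFDerivAt (fun z : EuS n => expNegInvGlue (1 - ‖z‖ ^ 2)) _ z :=
      HasDerivAt.comp_hasFDerivAt (f := fun z : EuS n => 1 - ‖z‖ ^ 2) z h1 h2
    rw [h3.fderiv]
    simp
    ring
  · have hc : HasCompactSupport (fun z : EuS n => 2 * deriv expNegInvGlue (1 - ‖z‖ ^ 2)) := by
      refine HasCompactSupport.intro (isCompact_closedBall (0 : EuS n) 1) fun z hz1 => ?_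
      apply hη0
      simp at hz1
      exact hz1.le
    -- some point where the derivative is nonzero
    have hex : ∃ t ∈ Ioo (0:ℝ) 1, 0 < deriv expNegInvGlue t := by
      obtain ⟨t, ht, h⟩ := exists_deriv_eq_slope expNegInvGlue (by norm_num : (0:ℝ) < 1)
        (expNegInvGlue.contDiff (n := 1)).continuous.continuousOn
        ((expNegInvGlue.contDiff (n := 1)).differentiable (by norm_num)).differentiableOn
      refine ⟨t, ht, ?_⟩
      rw [h, expNegInvGlue.zero_of_nonpos le_rfl]
      have := expNegInvGlue.pos_of_pos (by norm_num : (0:ℝ) < 1)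
      simpa using this
    · obtain ⟨t, ht, hpos⟩ := hex
      refine Continuous.integral_pos_of_hasCompactSupport_nonneg_nonzero (x := √(1 - t) • ee ⟨0, hn⟩) hη.continuous hc
        (fun z => mul_nonneg zero_le_two (hnn _)) ?_
      rw [norm_smul, norm_ee]
      have : 1 - (‖√(1-t)‖ * 1)^2 = t := by
        rw [mul_one, norm_eq_abs, sq_abs, sq_sqrt (by linarith [ht.2])]; ring
      rw [this]
      positivity

/-- third difference -/
noncomputable def tdf {n : ℕ} (k : EuS n → ℝ) (z ξ : EuS n) : ℝ :=
  k (z + (8:ℝ) • ξ) - 7 * k (z + (4:ℝ) • ξ) + 14 * k (z + (2:ℝ) • ξ) - 8 * k (z + (1:ℝ) • ξ)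

lemma hcs_of {n : ℕ} {k : EuS n → ℝ} (hs : ∀ z, 1 ≤ ‖z‖ → k z = 0) : HasCompactSupport k := by
  refine HasCompactSupport.intro (isCompact_closedBall (0 : EuS n) 1) fun z hz1 => ?_
  apply hs
  simp at hz1
  exact hz1.le

lemma taylor3_E {E : Type*} [NormedAddCommGroup E] [NormedSpace ℝ E] {k : E → ℝ}
    (hk : ContDiff ℝ 3 k) {C : ℝ} (hC : ∀ z u, ‖fderiv ℝ (fderiv ℝ (fderiv ℝ k)) z u‖ ≤ C * ‖u‖) (z ξ : E) :
    ∃ r, |r| ≤ C * ‖ξ‖^3 ∧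
      k (z + ξ) = k z + fderiv ℝ k z ξ + fderiv ℝ (fderiv ℝ k) z ξ ξ / 2 + r / 6 := by
  have hk1 : ContDiff ℝ 2 (fderiv ℝ k) := hk.fderiv_right (by norm_num)
  have hk2 : ContDiff ℝ 1 (fderiv ℝ (fderiv ℝ k)) := hk1.fderiv_right (by norm_num)
  have hl : ∀ t : ℝ, HasDerivAt (fun t : ℝ => z + t • ξ) ξ t := fun t => by
    simpa using ((hasDerivAt_id t).smul_const ξ).const_add z
  have d1 : ∀ t : ℝ, HasDerivAt (fun t : ℝ => k (z + t • ξ)) (fderiv ℝ k (z + t • ξ) ξ) t :=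
    fun t => ((hk.differentiable (by norm_num) _).hasFDerivAt).comp_hasDerivAt t (hl t)
  have d2' : ∀ t : ℝ, HasDerivAt (fun t : ℝ => fderiv ℝ k (z + t • ξ))
      (fderiv ℝ (fderiv ℝ k) (z + t • ξ) ξ) t := fun t =>
    ((hk1.differentiable (by norm_num) _).hasFDerivAt).comp_hasDerivAt t (hl t)
  have d2 : ∀ t : ℝ, HasDerivAt (fun t : ℝ => fderiv ℝ k (z + t • ξ) ξ)
      (fderiv ℝ (fderiv ℝ k) (z + t • ξ) ξ ξ) t := fun t => by
    simpa using (d2' t).clm_apply (hasDerivAt_const t ξ)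
  have d3' : ∀ t : ℝ, HasDerivAt (fun t : ℝ => fderiv ℝ (fderiv ℝ k) (z + t • ξ))
      (fderiv ℝ (fderiv ℝ (fderiv ℝ k)) (z + t • ξ) ξ) t := fun t =>
    ((hk2.differentiable (by norm_num) _).hasFDerivAt).comp_hasDerivAt t (hl t)
  have d3 : ∀ t : ℝ, HasDerivAt (fun t : ℝ => fderiv ℝ (fderiv ℝ k) (z + t • ξ) ξ ξ)
      (fderiv ℝ (fderiv ℝ (fderiv ℝ k)) (z + t • ξ) ξ ξ ξ) t := fun t => by
    simpa using ((d3' t).clm_apply (hasDerivAt_const t ξ)).clm_apply (hasDerivAt_const t ξ)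
  obtain ⟨s, -, h⟩ := taylor3_1d _ _ _ _ d1 d2 d3
  refine ⟨_, ?_, by simpa using h⟩
  rw [← norm_eq_abs]
  refine (ContinuousLinearMap.le_opNorm _ _).trans ?_
  have h1 := (ContinuousLinearMap.le_opNorm ((fderiv ℝ (fderiv ℝ (fderiv ℝ k)) (z + s • ξ)) ξ) ξ)
  have h3 := hC (z + s • ξ) ξ
  calc _ ≤ ((C * ‖ξ‖) * ‖ξ‖) * ‖ξ‖ := by
        gcongr
        refine h1.trans ?_
        gcongr
    _ = C * ‖ξ‖^3 := by ring

lemma fderiv_bdd {E F : Type*} [NormedAddCommGroup E] [NormedSpace ℝ E] [NormedAddCommGroup F]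
    [NormedSpace ℝ F] {k : E → F} (hk : ContDiff ℝ 1 k) (hc : HasCompactSupport k) :
    ∃ C : ℝ, 0 ≤ C ∧ ∀ z u, ‖fderiv ℝ k z u‖ ≤ C * ‖u‖ := by
  have hk3 : Continuous (fderiv ℝ k) := hk.continuous_fderiv (by norm_num)
  obtain ⟨C, hC⟩ := (hc.fderiv (𝕜 := ℝ)).exists_bound_of_continuous hk3
  exact ⟨C, (norm_nonneg _).trans (hC 0), fun z u => ContinuousLinearMap.le_of_opNorm_le _ (hC z) u⟩

lemma third_bdd {E : Type*} [NormedAddCommGroup E] [NormedSpace ℝ E] {k : E → ℝ}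
    (hk : ContDiff ℝ 3 k) (hc : HasCompactSupport k) :
    ∃ C : ℝ, 0 ≤ C ∧ ∀ z u, ‖fderiv ℝ (fderiv ℝ (fderiv ℝ k)) z u‖ ≤ C * ‖u‖ := by
  have hk1 : ContDiff ℝ 2 (fderiv ℝ k) := hk.fderiv_right (by norm_num)
  have hk2 : ContDiff ℝ 1 (fderiv ℝ (fderiv ℝ k)) := hk1.fderiv_right (by norm_num)
  exact fderiv_bdd hk2 ((hc.fderiv (𝕜 := ℝ)).fderiv (𝕜 := ℝ))

lemma third_diff {n : ℕ} (k : EuS n → ℝ) (hk : ContDiff ℝ 3 k) (hs : ∀ z, 1 ≤ ‖z‖ → k z = 0) :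
    ∃ C, 0 ≤ C ∧ ∀ z ξ, |tdf k z ξ| ≤ C * ‖ξ‖ ^ 3 := by
  obtain ⟨C, hC0, hC⟩ := third_bdd hk (hcs_of hs)
  have main : ∀ z ξ : EuS n, ∃ r a b : ℝ, |r| ≤ C * ‖ξ‖^3 ∧ a = fderiv ℝ k z ξ ∧
      b = fderiv ℝ (fderiv ℝ k) z ξ ξ ∧ k (z + ξ) = k z + a + b / 2 + r / 6 := by
    intro z ξ
    obtain ⟨r, h1, h2⟩ := taylor3_E hk hC z ξ
    exact ⟨r, _, _, h1, rfl, rfl, h2⟩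
  refine ⟨(512 + 7 * 64 + 14 * 8 + 8) / 6 * C, by positivity, fun z ξ => ?_⟩
  obtain ⟨r8, a8, b8, h8, A8, B8, e8⟩ := main z ((8:ℝ) • ξ)
  obtain ⟨r4, a4, b4, h4, A4, B4, e4⟩ := main z ((4:ℝ) • ξ)
  obtain ⟨r2, a2, b2, h2, A2, B2, e2⟩ := main z ((2:ℝ) • ξ)
  obtain ⟨r1, a1, b1, h1, A1, B1, e1⟩ := main z ((1:ℝ) • ξ)
  unfold tdf
  rw [e8, e4, e2, e1]
  rw [map_smul, smul_eq_mul] at A8 A4 A2 A1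
  rw [map_smul, map_smul, _root_.smul_apply, smul_eq_mul, smul_eq_mul] at B8 B4 B2 B1
  rw [norm_smul, norm_eq_abs, mul_pow] at h8 h4 h2 h1
  generalize fderiv ℝ k z ξ = a at *
  generalize fderiv ℝ (fderiv ℝ k) z ξ ξ = b at *
  generalize k z = kz at *
  generalize ‖ξ‖ ^ 3 = q at *
  clear e8 e4 e2 e1 main hC
  norm_num at h8 h4 h2 h1
  rw [abs_le] at h8 h4 h2 h1
  subst A8 A4 A2 A1 B8 B4 B2 B1
  rw [abs_le]
  constructor <;> linarith [h8.1, h8.2, h4.1, h4.2, h2.1, h2.2, h1.1, h1.2]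

lemma tdf_supp {n : ℕ} {k : EuS n → ℝ} (hs : ∀ z, 1 ≤ ‖z‖ → k z = 0) (z ξ : EuS n)
    (hξ : ‖ξ‖ ≤ 1) (hz : 9 ≤ ‖z‖) : tdf k z ξ = 0 := by
  have : ∀ j : ℝ, 0 ≤ j → j ≤ 8 → k (z + j • ξ) = 0 := by
    intro j h0 h8
    apply hs
    have h1 : ‖z‖ ≤ ‖z + j • ξ‖ + ‖j • ξ‖ := by
      simpa using norm_sub_le (z + j • ξ) (j • ξ)
    rw [norm_smul, norm_of_nonneg h0] at h1
    nlinarith [norm_nonneg ξ]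
  unfold tdf
  rw [this 8, this 4, this 2, this 1] <;> norm_num

/-- kernel averages -/
noncomputable def Kav {n : ℕ} (k g : EuS n → ℝ) (s : ℝ) (x : EuS n) : ℝ := ∫ z, k z * g (x - s • z)

lemma Kav_int {n : ℕ} {k g : EuS n → ℝ} (hk : Continuous k) (hs : ∀ z, 1 ≤ ‖z‖ → k z = 0)
    (hg : Continuous g) (s : ℝ) (x : EuS n) : Integrable (fun z => k z * g (x - s • z)) :=
  (hk.mul (hg.comp (by fun_prop))).integrable_of_hasCompactSupport ((hcs_of hs).mul_right)

lemma Kav_shift {n : ℕ} {k g : EuS n → ℝ} (s : ℝ) (hs0 : s ≠ 0) (w : EuS n) :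
    Kav k g s w = ∫ z, k (z + s⁻¹ • w) * g (- (s • z)) := by
  unfold Kav
  rw [← integral_add_right_eq_self _ (s⁻¹ • w)]
  refine integral_congr_ae (Filter.Eventually.of_forall fun z => ?_)
  simp only [smul_add, smul_smul, mul_inv_cancel₀ hs0, one_smul]
  congr 2
  abel

lemma int4 {n : ℕ} {f8 f4 f2 f1 : EuS n → ℝ} (h8 : Integrable f8) (h4 : Integrable f4)
    (h2 : Integrable f2) (h1 : Integrable f1) :
    (∫ z, (f8 z - 7 * f4 z + 14 * f2 z - 8 * f1 z)) =
      (∫ z, f8 z) - 7 * (∫ z, f4 z) + 14 * (∫ z, f2 z) - 8 * (∫ z, f1 z) := by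
  have a1 : Integrable (fun z => f8 z - 7 * f4 z) := h8.sub (h4.const_mul 7)
  have a2 : Integrable (fun z => f8 z - 7 * f4 z + 14 * f2 z) := a1.add (h2.const_mul 14)
  rw [integral_sub a2 (h1.const_mul 8), integral_add a1 (h2.const_mul 14),
    integral_sub h8 (h4.const_mul 7), integral_const_mul, integral_const_mul, integral_const_mul]

lemma Kav_tdf {n : ℕ} {k : EuS n → ℝ} (hk : ContDiff ℝ 3 k) (hs : ∀ z, 1 ≤ ‖z‖ → k z = 0) :
    ∃ C, 0 ≤ C ∧ ∀ (g : EuS n → ℝ) (s B : ℝ) (w : EuS n), Continuous g → 0 < s → ‖w‖ ≤ s →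
      (∀ y, ‖y‖ ≤ 9 * s → |g y| ≤ B) → |tdf (Kav k g s) 0 w| ≤ C * (‖w‖ / s) ^ 3 * B := by
  obtain ⟨C, hC0, hC⟩ := third_diff k hk hs
  refine ⟨C * volume.real (closedBall (0:EuS n) 9), by positivity, fun g s B w hg hs0 hw hB => ?_⟩
  have hI : ∀ j : ℝ, Integrable (fun z => k (z + j • (s⁻¹ • w)) * g (-(s • z))) := by
    intro j
    refine Continuous.integrable_of_hasCompactSupport (by
      have := hk.continuous
      fun_prop) ?_
    apply HasCompactSupport.mul_right
    exact (hcs_of hs).comp_homeomorph (Homeomorph.addRight (j • (s⁻¹ • w)))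
  have e : ∀ j : ℝ, Kav k g s (0 + j • w) = ∫ z, k (z + j • (s⁻¹ • w)) * g (-(s • z)) := by
    intro j
    rw [zero_add, Kav_shift s hs0.ne', smul_comm s⁻¹ j w]
  have key : tdf (Kav k g s) 0 w = ∫ z, tdf k z (s⁻¹ • w) * g (-(s • z)) := by
    unfold tdf
    rw [e 8, e 4, e 2, e 1, ← int4 (hI 8) (hI 4) (hI 2) (hI 1)]
    refine integral_congr_ae (Filter.Eventually.of_forall fun z => ?_)
    simp only []
    ring
  have hξ : ‖s⁻¹ • w‖ = ‖w‖ / s := by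
    rw [norm_smul, norm_inv, norm_of_nonneg hs0.le]; field_simp
  have hξ1 : ‖s⁻¹ • w‖ ≤ 1 := by rw [hξ]; exact (div_le_one hs0).mpr hw
  have e2 : ∫ z, tdf k z (s⁻¹ • w) * g (-(s • z)) =
      ∫ z in closedBall 0 9, tdf k z (s⁻¹ • w) * g (-(s • z)) := by
    rw [setIntegral_eq_integral_of_forall_compl_eq_zero]
    intro z hz
    rw [tdf_supp hs z _ hξ1, zero_mul]
    simp at hz
    exact hz.le
  rw [key, e2, ← norm_eq_abs]
  refine (norm_setIntegral_le_of_norm_le_const (C := C * (‖w‖ / s) ^ 3 * B)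
    measure_closedBall_lt_top ?_).trans (le_of_eq (by ring))
  intro z hz
  have hz9 : ‖z‖ ≤ 9 := by simpa using hz
  rw [norm_mul, norm_eq_abs, norm_eq_abs]
  have h1 := hC z (s⁻¹ • w)
  rw [hξ] at h1
  have h2 := hB (-(s • z)) (by
    rw [norm_neg, norm_smul, norm_of_nonneg hs0.le]; nlinarith)
  gcongr

lemma continuous_lapl {n : ℕ} {v : EuS n → ℝ} (hv : ContDiff ℝ 2 v) : Continuous (lapl v) := by
  unfold lapl
  have := continuous_hess hv
  fun_prop

lemma Kav_deriv1 {n : ℕ} {η v : EuS n → ℝ} (hη : Continuous η) (hs : ∀ z, 1 ≤ ‖z‖ → η z = 0)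
    (hv : ContDiff ℝ 2 v) (x : EuS n) (s0 : ℝ) :
    HasDerivAt (fun s => Kav η v s x) (∫ z, η z * fderiv ℝ v (x - s0 • z) (-z)) s0 := by
  have hDc : Continuous (fderiv ℝ v) := hv.continuous_fderiv (by norm_num)
  obtain ⟨C, hC⟩ := (isCompact_closedBall x (|s0| + 1)).exists_bound_of_continuousOn
    hDc.continuousOn
  have hl : ∀ (z : EuS n) (t : ℝ), HasDerivAt (fun t : ℝ => x - t • z) (-z) t := fun z t => by
    simpa using ((hasDerivAt_id t).smul_const z).const_sub x
  refine (hasDerivAt_integral_of_dominated_loc_of_deriv_le (s := ball s0 1)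
    (F := fun s z => η z * v (x - s • z)) (F' := fun s z => η z * fderiv ℝ v (x - s • z) (-z))
    (bound := fun z => C * |η z|) (ball_mem_nhds s0 one_pos) ?_ ?_ ?_ ?_ ?_ ?_).2
  · refine Filter.Eventually.of_forall fun s => ?_
    exact (hη.mul (hv.continuous.comp (by fun_prop))).aestronglyMeasurable
  · exact Kav_int hη hs hv.continuous s0 x
  · refine (hη.mul ?_).aestronglyMeasurable
    exact (hDc.comp (by fun_prop)).clm_apply continuous_neg
  · refine Filter.Eventually.of_forall fun z s hsb => ?_
    by_cases hz : 1 ≤ ‖z‖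
    · simp [hs z hz]
    push Not at hz
    rw [norm_mul, norm_eq_abs, mul_comm]
    gcongr
    have h1 : x - s • z ∈ closedBall x (|s0| + 1) := by
      rw [mem_closedBall, dist_eq_norm, sub_sub_cancel_left, norm_neg, norm_smul, norm_eq_abs]
      have : |s| ≤ |s0| + 1 := by
        rw [mem_ball, Real.dist_eq] at hsb
        have := abs_sub_abs_le_abs_sub s s0
        linarith
      nlinarith [abs_nonneg s, norm_nonneg z]
    have h2 := hC _ h1
    refine (ContinuousLinearMap.le_opNorm _ _).trans ?_
    rw [norm_neg]
    nlinarith [norm_nonneg (fderiv ℝ v (x - s • z))]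
  · exact ((hη.abs).integrable_of_hasCompactSupport (hcs_of hs).norm).const_mul C
  · refine Filter.Eventually.of_forall fun z s hsb => ?_
    exact (((hv.differentiable (by norm_num) _).hasFDerivAt).comp_hasDerivAt s (hl z s)).const_mul _

lemma Kav_deriv {n : ℕ} {Ψ η v : EuS n → ℝ} (hΨ : ContDiff ℝ 3 Ψ) (hη : ContDiff ℝ 3 η)
    (hsΨ : ∀ z, 1 ≤ ‖z‖ → Ψ z = 0) (hsη : ∀ z, 1 ≤ ‖z‖ → η z = 0)
    (hd : ∀ z w, fderiv ℝ Ψ z w = - (η z * inner ℝ z w))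
    (hv : ContDiff ℝ 2 v) (x : EuS n) (s : ℝ) :
    HasDerivAt (fun s => Kav η v s x) (s * Kav Ψ (lapl v) s x) s := by
  have h0 := Kav_deriv1 hη.continuous hsη hv x s
  have hDc : Continuous (fderiv ℝ v) := hv.continuous_fderiv (by norm_num)
  have hHc := continuous_hess hv
  have hDΨ : Continuous (fderiv ℝ Ψ) := hΨ.continuous_fderiv (by norm_num)
  have hcΨ := hcs_of hsΨ
  have hf : ∀ (i : Fin n) (z : EuS n), HasFDerivAt (fun z : EuS n => fderiv ℝ v (x - s • z) (ee i))
      (-s • (hess v (x - s • z)).flip (ee i)) z := by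
    intro i z
    have h := hasFDerivAt_fderiv hv (x - s • z)
    have e : HasFDerivAt (fun y : EuS n => x - s • y) (-(s • ContinuousLinearMap.id ℝ (EuS n))) z :=
      ((hasFDerivAt_id z).const_smul s).const_sub x
    have h2 : HasFDerivAt (fun z : EuS n => fderiv ℝ v (x - s • z)) _ z := h.comp z e
    have h3 : HasFDerivAt (fun z : EuS n => fderiv ℝ v (x - s • z) (ee i)) _ z :=
      h2.clm_apply (hasFDerivAt_const (ee i) z)
    have e3 : -s • (hess v (x - s • z)).flip (ee i) = fderiv ℝ (fun z : EuS n => fderiv ℝ v (x - s • z) (ee i)) z := by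
      rw [h3.fderiv]
      ext u
      simp
    rw [e3]
    exact h3.differentiableAt.hasFDerivAt
  have ibp : ∀ i : Fin n, ∫ z, fderiv ℝ v (x - s • z) (ee i) * fderiv ℝ Ψ z (ee i) =
      s * ∫ z, Ψ z * hess v (x - s • z) (ee i) (ee i) := by
    intro i
    rw [integral_mul_fderiv_eq_neg_fderiv_mul_of_integrable]
    · rw [← integral_neg, ← integral_const_mul]
      refine integral_congr_ae (Filter.Eventually.of_forall fun z => ?_)
      simp only [(hf i z).fderiv]
      simp
      ring
    · simp only [fun z => (hf i z).fderiv, _root_.smul_apply, ContinuousLinearMap.flip_apply]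
      refine Continuous.integrable_of_hasCompactSupport ?_ (hcΨ.mul_left)
      have := hΨ.continuous
      fun_prop
    · refine Continuous.integrable_of_hasCompactSupport (by fun_prop) (HasCompactSupport.mul_left ?_)
      exact (hcΨ.fderiv (𝕜 := ℝ)).comp_left (g := fun L : EuS n →L[ℝ] ℝ => L (ee i)) rfl
    · refine Continuous.integrable_of_hasCompactSupport ?_ (hcΨ.mul_left)
      have := hΨ.continuous
      fun_prop
    · intro z _
      exact (hf i z).differentiableAt
    · intro z _
      exact hΨ.differentiable (by norm_num) z
  have e : ∫ z, η z * fderiv ℝ v (x - s • z) (-z) = s * Kav Ψ (lapl v) s x := by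
    have e1 : ∀ z, η z * fderiv ℝ v (x - s • z) (-z) =
        ∑ i, fderiv ℝ v (x - s • z) (ee i) * fderiv ℝ Ψ z (ee i) := by
      intro z
      rw [lin_expand, Finset.mul_sum]
      refine Finset.sum_congr rfl fun i _ => ?_
      have hi : inner ℝ z (ee i) = z i := by
        have := EuclideanSpace.inner_single_right (𝕜 := ℝ) i (1:ℝ) z
        simpa [ee] using this
      rw [hd, hi]
      simp
      ring
    simp_rw [e1]
    rw [integral_finsetSum]
    · simp_rw [ibp]
      rw [← Finset.mul_sum]
      unfold Kav lapl
      congr 1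
      simp_rw [Finset.mul_sum]
      rw [integral_finsetSum]
      intro i _
      refine Continuous.integrable_of_hasCompactSupport ?_ (hcΨ.mul_right)
      have := hΨ.continuous
      fun_prop
    · intro i _
      refine Continuous.integrable_of_hasCompactSupport (by fun_prop) (HasCompactSupport.mul_left ?_)
      exact (hcΨ.fderiv (𝕜 := ℝ)).comp_left (g := fun L : EuS n →L[ℝ] ℝ => L (ee i)) rfl
  rw [← e]
  exact h0

lemma tdf_bound {n : ℕ} {k : EuS n → ℝ} {w : EuS n} {B : ℝ}
    (h : ∀ j : ℝ, 0 ≤ j → j ≤ 8 → |k (j • w)| ≤ B) : |tdf k 0 w| ≤ 30 * B := by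
  unfold tdf
  simp only [zero_add]
  have h8 := abs_le.mp (h 8 (by norm_num) (by norm_num))
  have h4 := abs_le.mp (h 4 (by norm_num) (by norm_num))
  have h2 := abs_le.mp (h 2 (by norm_num) (by norm_num))
  have h1 := abs_le.mp (h 1 (by norm_num) (by norm_num))
  rw [abs_le]
  constructor <;> linarith [h8.1, h8.2, h4.1, h4.2, h2.1, h2.2, h1.1, h1.2]

lemma Kav_le {n : ℕ} {k g : EuS n → ℝ} (hk : Continuous k) (hs : ∀ z, 1 ≤ ‖z‖ → k z = 0)
    {s B : ℝ} {x : EuS n} (hs0 : 0 ≤ s) (hB : ∀ y, ‖y‖ ≤ ‖x‖ + s → |g y| ≤ B) :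
    |Kav k g s x| ≤ (∫ z, |k z|) * B := by
  unfold Kav
  rw [← norm_eq_abs, ← integral_mul_const]
  refine norm_integral_le_of_norm_le ?_ (Filter.Eventually.of_forall fun z => ?_)
  · exact ((hk.abs).integrable_of_hasCompactSupport (hcs_of hs).norm).mul_const B
  · by_cases hz : 1 ≤ ‖z‖
    · simp [hs z hz]
    push Not at hz
    rw [norm_mul, norm_eq_abs, norm_eq_abs]
    gcongr
    apply hB
    refine (norm_sub_le _ _).trans ?_
    rw [norm_smul, norm_of_nonneg hs0]
    nlinarith

lemma tdf_est (n : ℕ) (hn : 0 < n) : ∃ C, 0 ≤ C ∧ ∀ (v : EuS n → ℝ) (K S : ℝ), ContDiff ℝ 2 v →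
    0 ≤ K → 0 ≤ S → (∀ y, ‖y‖ ≤ 9 → |lapl v y| ≤ K * ‖y‖ ^ (1/3 : ℝ)) → (∀ y, ‖y‖ ≤ 9 → |v y| ≤ S) →
    ∀ w, ‖w‖ ≤ 1 → |tdf v 0 w| ≤ C * (K + S) * ‖w‖ ^ (7/3 : ℝ) := by
  obtain ⟨Ψ, η, hΨ, hη, hsΨ, hsη, hd, hc⟩ := kernel_exists n hn
  obtain ⟨C1, hC10, hC1⟩ := Kav_tdf hη hsη
  obtain ⟨C2, hC20, hC2⟩ := Kav_tdf hΨ hsΨ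
  set c := ∫ z, η z with hcdef
  set P := ∫ z, |Ψ z| with hP
  have hP0 : 0 ≤ P := integral_nonneg fun z => abs_nonneg _
  refine ⟨c⁻¹ * (270 * P + 27 / 2 * C2 + C1), by positivity, ?_⟩
  intro v K S hv hK hS hlap hvS w hw
  set t := ‖w‖ with ht
  have ht0 : 0 ≤ t := norm_nonneg _
  rcases ht0.eq_or_lt with h0 | htp
  · have : w = 0 := by rw [← norm_eq_zero, ← ht, ← h0]
    subst this
    have : tdf v 0 (0 : EuS n) = 0 := by unfold tdf; simp; ring
    rw [this, abs_zero]; positivity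
  have hcl := continuous_lapl hv
  have h9 : ∀ r : ℝ, 0 ≤ r → (9 * r) ^ (1/3:ℝ) ≤ 9 * r ^ (1/3:ℝ) := by
    intro r hr
    rw [mul_rpow (by norm_num) hr]
    gcongr
    calc (9:ℝ) ^ (1/3:ℝ) ≤ 9 ^ (1:ℝ) := rpow_le_rpow_of_exponent_le (by norm_num) (by norm_num)
      _ = 9 := rpow_one 9
  set m : ℝ → ℝ := fun s => tdf (Kav η v s) 0 w with hm
  set m' : ℝ → ℝ := fun s => s * tdf (Kav Ψ (lapl v) s) 0 w with hm'
  have hmd : ∀ s, HasDerivAt m (m' s) s := by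
    intro s
    have hD := fun x => Kav_deriv hΨ hη hsΨ hsη hd hv x s
    have := (((hD (0 + (8:ℝ) • w)).sub ((hD (0 + (4:ℝ) • w)).const_mul 7)).add
      ((hD (0 + (2:ℝ) • w)).const_mul 14)).sub ((hD (0 + (1:ℝ) • w)).const_mul 8)
    refine this.congr_deriv ?_
    simp only [hm', tdf]
    ring
  have b1 : ∀ s ∈ Icc 0 t, |m' s| ≤ 270 * P * K * t ^ (4/3:ℝ) := by
    intro s hs
    have e := tdf_bound (k := Kav Ψ (lapl v) s) (w := w) (B := P * (K * (9 * t ^ (1/3:ℝ)))) ?_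
    · simp only [hm']
      rw [abs_mul, abs_of_nonneg hs.1]
      calc s * |tdf (Kav Ψ (lapl v) s) 0 w| ≤ t * (30 * (P * (K * (9 * t ^ (1/3:ℝ))))) := by
            gcongr; exact hs.2
        _ = 270 * P * K * (t ^ (1:ℝ) * t ^ (1/3:ℝ)) := by rw [rpow_one]; ring
        _ = _ := by rw [← rpow_add htp]; norm_num
    · intro j hj0 hj8
      refine Kav_le hΨ.continuous hsΨ hs.1 fun y hy => ?_
      rw [norm_smul, norm_of_nonneg hj0, ← ht] at hy
      have hy9 : ‖y‖ ≤ 9 * t := by nlinarith [hs.2]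
      refine (hlap y (by linarith)).trans ?_
      gcongr
      refine le_trans ?_ (h9 t ht0)
      gcongr
  have b2 : ∀ s ∈ Icc t 1, |m' s| ≤ 9 * C2 * K * t ^ 3 * s ^ (-5/3:ℝ) := by
    intro s hs
    have hs0 : 0 < s := htp.trans_le hs.1
    have e := hC2 (lapl v) s (K * (9 * s ^ (1/3:ℝ))) w hcl hs0 hs.1 ?_
    · simp only [hm']
      rw [abs_mul, abs_of_nonneg hs0.le]
      calc s * |tdf (Kav Ψ (lapl v) s) 0 w| ≤ s * (C2 * (t / s) ^ 3 * (K * (9 * s ^ (1/3:ℝ)))) := by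
            gcongr
        _ = 9 * C2 * K * t^3 * (s ^ (1/3:ℝ) / s ^ 2) := by field_simp
        _ = _ := by
            congr 1
            rw [← rpow_natCast, ← rpow_sub hs0]; norm_num
    · intro y hy
      refine (hlap y (by linarith [hs.2])).trans ?_
      gcongr
      refine le_trans ?_ (h9 s hs0.le)
      gcongr
  have d1 : |m t - m 0| ≤ 270 * P * K * t ^ (7/3:ℝ) := by
    have := norm_image_sub_le_of_norm_deriv_le_segment' (f := m) (f' := m') (a := 0) (b := t)
      (C := 270 * P * K * t ^ (4/3:ℝ)) (fun s _ => (hmd s).hasDerivWithinAt)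
      (fun s hs => b1 s (Ico_subset_Icc_self hs)) t (right_mem_Icc.mpr ht0)
    rw [norm_eq_abs, sub_zero] at this
    refine this.trans (le_of_eq ?_)
    calc 270 * P * K * t ^ (4/3:ℝ) * t = 270 * P * K * (t ^ (4/3:ℝ) * t ^ (1:ℝ)) := by
          rw [rpow_one]; ring
      _ = _ := by rw [← rpow_add htp]; norm_num
  have d2 : |m 1 - m t| ≤ 27/2 * C2 * K * t ^ (7/3:ℝ) := by
    have hcont : Continuous m := continuous_iff_continuousAt.mpr fun s => (hmd s).continuousAt
    have hBd : ∀ s : ℝ, 0 < s → HasDerivAt (fun s : ℝ => 27/2 * C2 * K * t^3 * (t ^ (-2/3:ℝ) - s ^ (-2/3:ℝ)))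
        (9 * C2 * K * t ^ 3 * s ^ (-5/3:ℝ)) s := by
      intro s hs
      have := ((Real.hasDerivAt_rpow_const (x := s) (p := -2/3) (Or.inl hs.ne')).const_sub
        (t ^ (-2/3:ℝ))).const_mul (27/2 * C2 * K * t^3)
      refine this.congr_deriv ?_
      norm_num
      ring
    have := image_norm_le_of_norm_deriv_right_le_deriv_boundary' (f := fun s => m s - m t) (f' := m')
      (a := t) (b := 1) (B := fun s : ℝ => 27/2 * C2 * K * t^3 * (t ^ (-2/3:ℝ) - s ^ (-2/3:ℝ)))
      (B' := fun s => 9 * C2 * K * t ^ 3 * s ^ (-5/3:ℝ)) (by fun_prop)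
      (fun s _ => ((hmd s).sub_const _).hasDerivWithinAt) (by simp)
      (fun s hs => (hBd s (htp.trans_le hs.1)).continuousAt.continuousWithinAt)
      (fun s hs => (hBd s (htp.trans_le hs.1)).hasDerivWithinAt)
      (fun s hs => b2 s (Ico_subset_Icc_self hs)) (right_mem_Icc.mpr hw)
    rw [norm_eq_abs, one_rpow] at this
    refine this.trans ?_
    calc 27/2 * C2 * K * t^3 * (t ^ (-2/3:ℝ) - 1) ≤ 27/2 * C2 * K * t^3 * t ^ (-2/3:ℝ) := by
          gcongr; linarith
      _ = 27/2 * C2 * K * (t^(3:ℝ) * t ^ (-2/3:ℝ)) := by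
          rw [show (t:ℝ)^(3:ℝ) = t^3 by exact_mod_cast rpow_natCast t 3]; ring
      _ = _ := by rw [← rpow_add htp]; norm_num
  have d3 : |m 1| ≤ C1 * S * t ^ (7/3:ℝ) := by
    have := hC1 v 1 S w hv.continuous one_pos hw (fun y hy => hvS y (by linarith))
    refine this.trans ?_
    rw [div_one]
    calc C1 * t^3 * S = C1 * S * t^(3:ℝ) := by
          rw [show (t:ℝ)^(3:ℝ) = t^3 by exact_mod_cast rpow_natCast t 3]; ring
      _ ≤ _ := by
          have := rpow_le_rpow_of_exponent_ge htp hw (by norm_num : (7/3:ℝ) ≤ 3)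
          gcongr
  have e0 : m 0 = c * tdf v 0 w := by
    have : ∀ x, Kav η v 0 x = c * v x := by
      intro x
      unfold Kav
      simp only [zero_smul, sub_zero]
      rw [integral_mul_const]
    simp only [hm, tdf, this]
    ring
  have e1 : |m 0| ≤ (270 * P * K + 27/2 * C2 * K + C1 * S) * t ^ (7/3:ℝ) := by
    rw [abs_le] at *
    constructor <;> nlinarith [d1.1, d1.2, d2.1, d2.2, d3.1, d3.2]
  rw [e0, abs_mul, abs_of_pos hc] at e1
  have e2 : |tdf v 0 w| ≤ c⁻¹ * ((270 * P * K + 27/2 * C2 * K + C1 * S) * t ^ (7/3:ℝ)) := by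
    rw [← div_eq_inv_mul, le_div_iff₀ hc]; linarith
  refine e2.trans ?_
  rw [mul_assoc c⁻¹, mul_assoc c⁻¹]
  have hcp : 0 ≤ c⁻¹ := by positivity
  gcongr
  nlinarith [mul_nonneg hP0 hS, mul_nonneg hC20 hS, mul_nonneg hC10 hK]

lemma iter_decay {g : ℝ → ℝ} {b D T : ℝ} (hb0 : 0 ≤ b) (hb4 : b ≤ 4) (hD : 0 ≤ D)
    (hg : ∀ t, 0 < t → t ≤ T / 2 → |g (2 * t) - b * g t| ≤ D * t ^ (7/3:ℝ))
    (ho : ∀ ε > 0, ∃ δ > 0, ∀ t, 0 < t → t < δ → |g t| ≤ ε * t ^ 2) :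
    ∀ t, 0 < t → t ≤ T → |g t| ≤ D * t ^ (7/3:ℝ) := by
  have h2 : (5/4:ℝ) ≤ 2 ^ (1/3:ℝ) := by
    have h : ((5/4:ℝ)^3) ^ (1/3:ℝ) ≤ 2 ^ (1/3:ℝ) := by gcongr; norm_num
    rwa [← rpow_natCast, ← rpow_mul (by norm_num), show ((3:ℕ):ℝ) * (1/3) = 1 by norm_num, rpow_one] at h
  intro t ht htT
  have claim : ∀ k : ℕ, |g t| ≤ 4 ^ k * |g (t / 2 ^ k)| +
      D * t ^ 2 * (t ^ (1/3:ℝ) - (t / 2 ^ k) ^ (1/3:ℝ)) := by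
    intro k
    induction k with
    | zero => simp
    | succ k ih =>
      refine ih.trans ?_
      set u := t / 2 ^ (k+1) with hu
      have hu0 : 0 < u := by positivity
      have e1 : t / 2 ^ k = 2 * u := by rw [hu, pow_succ]; field_simp
      have e2 : t = 2 ^ (k+1) * u := by rw [hu]; field_simp
      have hle : u ≤ T / 2 := by
        have : t / 2 ^ k ≤ t := div_le_self ht.le (one_le_pow₀ (by norm_num))
        linarith
      have h3 := hg u hu0 hle
      have h4 : |g (2 * u)| ≤ 4 * |g u| + D * u ^ (7/3:ℝ) := by
        have := abs_sub_abs_le_abs_sub (g (2*u)) (b * g u)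
        rw [abs_mul b, abs_of_nonneg hb0] at this
        nlinarith [abs_nonneg (g u)]
      rw [e1]
      have h5 : u ^ (7/3:ℝ) = u ^ 2 * u ^ (1/3:ℝ) := by
        rw [← rpow_natCast, ← rpow_add hu0]; norm_num
      have h6 : t ^ 2 = 4 * 4 ^ k * u ^ 2 := by
        have h44 : (4:ℝ) ^ k = (2 ^ k) ^ 2 := by
          rw [← pow_mul, mul_comm, pow_mul]; norm_num
        rw [h44, e2, pow_succ]; ring
      have h7 : (2 * u) ^ (1/3:ℝ) = 2 ^ (1/3:ℝ) * u ^ (1/3:ℝ) := mul_rpow (by norm_num) hu0.le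
      have h8 : 4 ^ k * |g (2*u)| ≤ 4 ^ k * (4 * |g u| + D * u ^ (7/3:ℝ)) := by gcongr
      have h9 : D * 4 ^ k * u ^ 2 * u ^ (1/3:ℝ) ≤ D * t^2 * ((2 * u) ^ (1/3:ℝ) - u ^ (1/3:ℝ)) := by
        rw [h6, h7]
        have : 0 ≤ D * 4 ^ k * u ^ 2 * u ^ (1/3:ℝ) := by positivity
        nlinarith
      rw [h5] at h8
      rw [pow_succ (4:ℝ) k]
      nlinarith
  have hlim : ∀ ε > 0, |g t| ≤ ε * t ^ 2 + D * t ^ (7/3:ℝ) := by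
    intro ε hε
    obtain ⟨δ, hδ, hδ'⟩ := ho ε hε
    obtain ⟨k, hk⟩ := exists_pow_lt_of_lt_one (show 0 < δ / t by positivity) (by norm_num : (1/2:ℝ) < 1)
    have hu : t / 2 ^ k < δ := by
      rw [lt_div_iff₀ ht] at hk
      calc t / 2^k = (1/2)^k * t := by rw [one_div, inv_pow]; field_simp
        _ < δ := hk
    have h1 := hδ' _ (by positivity) hu
    refine (claim k).trans ?_
    have h5 : t ^ (7/3:ℝ) = t ^ 2 * t ^ (1/3:ℝ) := by
      rw [← rpow_natCast, ← rpow_add ht]; norm_num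
    have h6 : (4:ℝ) ^ k * |g (t / 2 ^ k)| ≤ 4 ^ k * (ε * (t / 2^k) ^ 2) := by gcongr
    have h7 : (4:ℝ) ^ k * (ε * (t / 2^k) ^ 2) = ε * t ^ 2 := by
      rw [div_pow, ← pow_mul, mul_comm k 2, pow_mul]; norm_num
      field_simp
    have h8 : 0 ≤ D * t ^ 2 * (t / 2 ^ k) ^ (1/3:ℝ) := by positivity
    rw [h5]
    nlinarith
  refine le_of_forall_pos_le_add fun ε hε => ?_
  have := hlim (ε / t ^ 2) (by positivity)
  rw [div_mul_cancel₀ _ (by positivity)] at this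
  linarith

lemma cont_norm_hessE {E : Type*} [NormedAddCommGroup E] [NormedSpace ℝ E] {v : E → ℝ}
    (hv : ContDiff ℝ 2 v) : Continuous fun x => ‖fderiv ℝ (fderiv ℝ v) x‖ := by
  have h : ContDiff ℝ 1 (fderiv ℝ v) := hv.fderiv_right (by norm_num)
  exact (h.continuous_fderiv (by norm_num)).norm

lemma cont_norm_hess {n : ℕ} {v : EuS n → ℝ} (hv : ContDiff ℝ 2 v) :
    Continuous (fun x => ‖hess v x‖) := cont_norm_hessE hv

lemma small_o {n : ℕ} {v : EuS n → ℝ} (hv : ContDiff ℝ 2 v) (h0 : v 0 = 0)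
    (h1 : fderiv ℝ v 0 = 0) (h2 : hess v 0 = 0) (ε : ℝ) (hε : 0 < ε) :
    ∃ δ > 0, ∀ x, ‖x‖ < δ → |v x| ≤ ε * ‖x‖ ^ 2 := by
  have hc : Continuous (fun x => ‖hess v x‖) := cont_norm_hess hv
  obtain ⟨δ, hδ, H⟩ := Metric.continuous_iff.mp hc 0 ε hε
  refine ⟨δ, hδ, fun x hx => ?_⟩
  obtain ⟨s, hs, e⟩ := taylor2 hv 0 x
  rw [zero_add, h0, h1, zero_add, zero_add] at e
  simp only [_root_.zero_apply, zero_add] at e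
  have hsx : dist (s • x) 0 < δ := by
    rw [dist_zero_right, norm_smul, norm_of_nonneg hs.1.le]
    nlinarith [norm_nonneg x, hs.2]
  have := H _ hsx
  rw [h2, ContinuousLinearMap.opNorm_zero, dist_zero_right, norm_eq_abs,
    abs_of_nonneg (ContinuousLinearMap.opNorm_nonneg _)] at this
  have h3 : ‖hess v (s • x) x x‖ ≤ ‖hess v (s • x)‖ * ‖x‖ * ‖x‖ := ContinuousLinearMap.le_opNorm₂ _ _ _
  rw [e, abs_div, ← norm_eq_abs]
  have h4 : ‖hess v (s • x)‖ * ‖x‖ * ‖x‖ ≤ ε * ‖x‖^2 := by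
    rw [mul_assoc, ← sq]; gcongr
  have h5 : 0 ≤ ε * ‖x‖^2 := by positivity
  norm_num
  rw [norm_eq_abs] at h3
  linarith

lemma lapl_schauder (n : ℕ) (hn : 0 < n) : ∃ C, 0 ≤ C ∧ ∀ (v : EuS n → ℝ) (K S : ℝ), ContDiff ℝ 2 v →
    0 ≤ K → 0 ≤ S → v 0 = 0 → fderiv ℝ v 0 = 0 → hess v 0 = 0 →
    (∀ y, ‖y‖ ≤ 9 → |lapl v y| ≤ K * ‖y‖ ^ (1/3 : ℝ)) → (∀ y, ‖y‖ ≤ 9 → |v y| ≤ S) →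
    ∀ w, ‖w‖ ≤ 8 → |v w| ≤ C * (K + S) * ‖w‖ ^ (7/3 : ℝ) := by
  obtain ⟨C, hC0, hC⟩ := tdf_est n hn
  refine ⟨C, hC0, fun v K S hv hK hS h0 h1 h2 hl hb w hw => ?_⟩
  have key := hC v K S hv hK hS hl hb
  rcases eq_or_ne w 0 with rfl | hw0
  · rw [h0, abs_zero]; positivity
  have hwp : 0 < ‖w‖ := norm_pos_iff.mpr hw0
  set e := (‖w‖)⁻¹ • w with he
  have hen : ‖e‖ = 1 := by rw [he, norm_smul, norm_inv, norm_norm]; field_simp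
  have hwe : w = ‖w‖ • e := by rw [he, smul_smul, mul_inv_cancel₀ hwp.ne', one_smul]
  set D := C * (K + S) with hD
  have hD0 : 0 ≤ D := by positivity
  have hne : ∀ t : ℝ, 0 < t → ‖t • e‖ = t := fun t ht => by
    rw [norm_smul, hen, norm_of_nonneg ht.le, mul_one]
  set g : ℝ → ℝ := fun t => v (t • e) with hg
  have ho : ∀ ε > 0, ∃ δ > 0, ∀ t, 0 < t → t < δ → |g t| ≤ ε * t ^ 2 := by
    intro ε hε
    obtain ⟨δ, hδ, H⟩ := small_o hv h0 h1 h2 ε hε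
    refine ⟨δ, hδ, fun t ht htd => ?_⟩
    have := H (t • e) (by rw [hne t ht]; exact htd)
    rwa [hne t ht] at this
  have t1 : ∀ t, 0 < t → t ≤ 1 → |g (8 * t) - 7 * g (4 * t) + 14 * g (2 * t) - 8 * g t| ≤ D * t ^ (7/3:ℝ) := by
    intro t ht ht1
    have := key (t • e) (by rw [hne t ht]; exact ht1)
    rw [hne t ht] at this
    simpa [tdf, hg, smul_smul] using this
  have g2o : ∀ ε > 0, ∃ δ > 0, ∀ t, 0 < t → t < δ → |g (2 * t) - g t| ≤ ε * t ^ 2 := by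
    intro ε hε
    obtain ⟨δ, hδ, H⟩ := ho (ε / 5) (by positivity)
    refine ⟨δ / 2, by positivity, fun t ht htd => ?_⟩
    have a := abs_le.mp (H (2 * t) (by positivity) (by linarith))
    have b := abs_le.mp (H t ht (by linarith))
    rw [abs_le]; constructor <;> nlinarith [a.1, a.2, b.1, b.2]
  have g1o : ∀ ε > 0, ∃ δ > 0, ∀ t, 0 < t → t < δ → |g (4 * t) - 3 * g (2 * t) + 2 * g t| ≤ ε * t ^ 2 := by
    intro ε hε
    obtain ⟨δ, hδ, H⟩ := ho (ε / 30) (by positivity)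
    refine ⟨δ / 4, by positivity, fun t ht htd => ?_⟩
    have c := abs_le.mp (H (4 * t) (by positivity) (by linarith))
    have a := abs_le.mp (H (2 * t) (by positivity) (by linarith))
    have b := abs_le.mp (H t ht (by linarith))
    rw [abs_le]; constructor <;> nlinarith [a.1, a.2, b.1, b.2, c.1, c.2]
  have s1 := iter_decay (g := fun t => g (4 * t) - 3 * g (2 * t) + 2 * g t) (b := 4) (D := D) (T := 2)
    (by norm_num) le_rfl hD0 (by
      intro t ht ht1
      have := t1 t ht (by linarith)
      ring_nf at this ⊢
      exact this) g1o
  have s2 := iter_decay (g := fun t => g (2 * t) - g t) (b := 2) (D := D) (T := 4)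
    (by norm_num) (by norm_num) hD0 (by
      intro t ht ht1
      have := s1 t ht (by linarith)
      ring_nf at this ⊢
      exact this) g2o
  have s3 := iter_decay (g := g) (b := 1) (D := D) (T := 8)
    (by norm_num) (by norm_num) hD0 (by
      intro t ht ht1
      have := s2 t ht (by linarith)
      ring_nf at this ⊢
      exact this) ho
  have := s3 ‖w‖ hwp hw
  simpa [hg, ← hwe] using this

lemma ell_quad {n : ℕ} {B : Matrix (Fin n) (Fin n) ℝ} {A : Fin n → Fin n → ℝ}
    (hAB : ∀ i j, A i j = ∑ k, B k i * B k j) (ξ : EuS n) :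
    ∑ i, ∑ j, A i j * ξ i * ξ j = ∑ k, (∑ i, B k i * ξ i) ^ 2 := by
  simp_rw [hAB, sq, Finset.sum_mul, Finset.mul_sum]
  rw [Finset.sum_comm]
  have : ∀ j i : Fin n, ∑ k, B k i * B k j * ξ i * ξ j = ∑ k, B k i * ξ i * (B k j * ξ j) :=
    fun j i => Finset.sum_congr rfl fun k _ => by ring
  simp_rw [this]
  rw [Finset.sum_comm]
  calc ∑ y, ∑ x, ∑ i, B i y * ξ y * (B i x * ξ x) = ∑ y, ∑ i, ∑ x, B i y * ξ y * (B i x * ξ x) :=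
        Finset.sum_congr rfl fun y _ => Finset.sum_comm
    _ = _ := Finset.sum_comm

open scoped MatrixOrder Matrix.Norms.L2Operator in
lemma psd_sqrt {n : ℕ} {A : Matrix (Fin n) (Fin n) ℝ} (hA : A.PosSemidef) :
    ∃ B : Matrix (Fin n) (Fin n) ℝ, A = B.conjTranspose * B := by
  obtain ⟨B, h⟩ := CStarAlgebra.nonneg_iff_eq_star_mul_self.mp hA.nonneg
  exact ⟨B, h⟩

lemma sqrt_lin {n : ℕ} {Λ : ℝ} (hΛ : 1 ≤ Λ) {A : Fin n → Fin n → ℝ} (hA : Ell Λ A) :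
    ∃ S : EuS n →L[ℝ] EuS n, (∀ i j, A i j = ∑ k, (S (ee k)) i * (S (ee k)) j) ∧
      (∀ y, ‖S y‖ ≤ Λ * ‖y‖) ∧ ∀ x, ∃ y, S y = x ∧ ‖y‖ ≤ Λ * ‖x‖ := by
  have hP : (Matrix.of A).PosSemidef := by
    apply Matrix.PosSemidef.of_dotProduct_mulVec_nonneg
    · ext i j; simp [hA.1 i j]
    · intro x
      have h1 := (hA.2 (WithLp.toLp 2 x)).1
      have h2 : 0 ≤ Λ⁻¹ * ‖(WithLp.toLp 2 x : EuS n)‖ ^ 2 := by positivity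
      refine (h2.trans h1).trans (le_of_eq ?_)
      simp only [dotProduct, Matrix.mulVec, Finset.mul_sum]
      refine Finset.sum_congr rfl fun i _ => Finset.sum_congr rfl fun j _ => ?_
      simp; ring
  obtain ⟨B, hB⟩ := psd_sqrt hP
  have hAB : ∀ i j, A i j = ∑ k, B k i * B k j := by
    intro i j
    have := congrFun (congrFun hB i) j
    simpa [Matrix.mul_apply] using this
  set T := Matrix.toEuclideanLin B with hT
  set S := Matrix.toEuclideanLin B.transpose with hS
  have hTa : ∀ ξ k, (T ξ) k = ∑ i, B k i * ξ i := by
    intro ξ k; simp [hT, Matrix.mulVec, dotProduct]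
  have hSa : ∀ ξ i, (S ξ) i = ∑ k, B k i * ξ k := by
    intro ξ k; simp [hS, Matrix.mulVec, dotProduct]
  have hTn : ∀ ξ, ‖T ξ‖ ^ 2 = ∑ i, ∑ j, A i j * ξ i * ξ j := by
    intro ξ
    rw [ell_quad hAB, EuclideanSpace.norm_sq_eq]
    simp [hTa]
  have hadj : ∀ y ξ, inner ℝ (S y) ξ = inner ℝ y (T ξ) := by
    intro y ξ
    simp only [PiLp.inner_apply, hSa, hTa]
    simp only [RCLike.inner_apply, conj_trivial, Finset.mul_sum, Finset.sum_mul]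
    rw [Finset.sum_comm]
    refine Finset.sum_congr rfl fun i _ => Finset.sum_congr rfl fun j _ => by ring
  have hTu : ∀ ξ, ‖T ξ‖ ≤ Λ * ‖ξ‖ := by
    intro ξ
    have := (hA.2 ξ).2
    rw [← hTn] at this
    refine abs_le_of_sq_le_sq' ?_ (by positivity) |>.2
    rw [mul_pow]
    nlinarith [sq_nonneg ‖ξ‖]
  have hTl : ∀ ξ, ‖ξ‖ ≤ Λ * ‖T ξ‖ := by
    intro ξ
    have := (hA.2 ξ).1
    rw [← hTn, inv_mul_le_iff₀ (by positivity)] at this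
    refine abs_le_of_sq_le_sq' ?_ (by positivity) |>.2
    rw [mul_pow]
    nlinarith [sq_nonneg ‖T ξ‖]
  have hSu : ∀ y, ‖S y‖ ≤ Λ * ‖y‖ := by
    intro y
    have h1 : ‖S y‖ ^ 2 ≤ ‖y‖ * ‖T (S y)‖ := by
      rw [← real_inner_self_eq_norm_sq, hadj]; exact real_inner_le_norm _ _
    have h2 := hTu (S y)
    by_contra hcon
    push Not at hcon
    have : 0 < ‖S y‖ := lt_of_le_of_lt (by positivity) hcon
    nlinarith [norm_nonneg y]
  have hTsurj : Function.Surjective T := by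
    rw [← LinearMap.injective_iff_surjective]
    rw [← LinearMap.ker_eq_bot, LinearMap.ker_eq_bot']
    intro ξ h
    have := hTl ξ
    rw [h, norm_zero, mul_zero] at this
    exact norm_le_zero_iff.mp this
  have hSl : ∀ y, ‖y‖ ≤ Λ * ‖S y‖ := by
    intro y
    obtain ⟨ξ, rfl⟩ := hTsurj y
    have h1 : ‖T ξ‖ ^ 2 ≤ ‖S (T ξ)‖ * ‖ξ‖ := by
      rw [← real_inner_self_eq_norm_sq, ← hadj]; exact real_inner_le_norm _ _
    have h2 := hTl ξ
    by_contra hcon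
    push Not at hcon
    have : 0 < ‖T ξ‖ := lt_of_le_of_lt (by positivity) hcon
    nlinarith [norm_nonneg (S (T ξ))]
  have hSsurj : Function.Surjective S := by
    rw [← LinearMap.injective_iff_surjective]
    rw [← LinearMap.ker_eq_bot, LinearMap.ker_eq_bot']
    intro ξ h
    have := hSl ξ
    rw [h, norm_zero, mul_zero] at this
    exact norm_le_zero_iff.mp this
  refine ⟨LinearMap.toContinuousLinearMap S, fun i j => ?_, hSu, fun x => ?_⟩
  · rw [hAB]
    refine Finset.sum_congr rfl fun k _ => ?_
    simp [hSa, ee]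
  · obtain ⟨y, rfl⟩ := hSsurj x
    exact ⟨y, rfl, hSl y⟩

lemma fderiv_lin {n : ℕ} {v : EuS n → ℝ} (hv : ContDiff ℝ 2 v) (x0 : EuS n) (L : EuS n →L[ℝ] EuS n)
    (y : EuS n) : fderiv ℝ (fun y => v (x0 + L y)) y = (fderiv ℝ v (x0 + L y)).comp L := by
  have h := ((hv.differentiable (by norm_num)) (x0 + L y)).hasFDerivAt
  have e : HasFDerivAt (fun y : EuS n => x0 + L y) L y := L.hasFDerivAt.const_add x0
  have h2 : HasFDerivAt (fun y => v (x0 + L y)) _ y := h.comp y e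
  exact h2.fderiv

lemma hess_lin {n : ℕ} {v : EuS n → ℝ} (hv : ContDiff ℝ 2 v) (x0 : EuS n) (L : EuS n →L[ℝ] EuS n)
    (y a b : EuS n) : hess (fun y => v (x0 + L y)) y a b = hess v (x0 + L y) (L a) (L b) := by
  unfold hess
  have : fderiv ℝ (fun y => v (x0 + L y)) = fun y => (fderiv ℝ v (x0 + L y)).comp L := by
    ext1 y; exact fderiv_lin hv x0 L y
  rw [this]
  have h := hasFDerivAt_fderiv hv (x0 + L y)
  have e : HasFDerivAt (fun y : EuS n => x0 + L y) L y := L.hasFDerivAt.const_add x0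
  have h2 : HasFDerivAt (fun y => fderiv ℝ v (x0 + L y)) _ y := h.comp y e
  have h3 : HasFDerivAt (fun y => (fderiv ℝ v (x0 + L y)).comp L) _ y :=
    h2.clm_comp (hasFDerivAt_const L y)
  rw [h3.fderiv]
  simp [hess]

lemma trA_eq_sum_S {n : ℕ} {A : Fin n → Fin n → ℝ} {S : EuS n →L[ℝ] EuS n}
    (hS : ∀ i j, A i j = ∑ k, (S (ee k)) i * (S (ee k)) j) (H : EuS n →L[ℝ] EuS n →L[ℝ] ℝ) :
    ∑ k, H (S (ee k)) (S (ee k)) = trA A H := by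
  unfold trA
  simp_rw [hS, Finset.sum_mul]
  calc ∑ k, H (S (ee k)) (S (ee k)) =
      ∑ k, ∑ i, ∑ j, (S (ee k)) i * (S (ee k)) j * H (ee i) (ee j) :=
        Finset.sum_congr rfl fun k _ => bil_expand H _ _
    _ = ∑ i, ∑ k, ∑ j, (S (ee k)) i * (S (ee k)) j * H (ee i) (ee j) := Finset.sum_comm
    _ = _ := Finset.sum_congr rfl fun i _ => Finset.sum_comm

lemma const_schauder (n : ℕ) (hn : 0 < n) (Λ : ℝ) (hΛ : 1 ≤ Λ) : ∃ C, 0 ≤ C ∧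
    ∀ (v : EuS n → ℝ) (A : Fin n → Fin n → ℝ) (K S R : ℝ) (x0 : EuS n), ContDiff ℝ 2 v →
    Ell Λ A → 0 ≤ K → 0 ≤ S → 0 < R → v x0 = 0 → fderiv ℝ v x0 = 0 → hess v x0 = 0 →
    (∀ x, ‖x - x0‖ ≤ R → |trA A (hess v x)| ≤ K * ‖x - x0‖ ^ (1/3 : ℝ)) →
    (∀ x, ‖x - x0‖ ≤ R → |v x| ≤ S) →
    ∀ x, ‖x - x0‖ ≤ R / (2 * Λ ^ 2) →
      |v x| ≤ C * (K * R ^ (7/3:ℝ) + S) * (‖x - x0‖ / R) ^ (7/3 : ℝ) := by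
  obtain ⟨C, hC0, hC⟩ := lapl_schauder n hn
  refine ⟨C * (9 * Λ ^ 2) ^ (7/3:ℝ), by positivity, ?_⟩
  intro v A K M R x0 hv hA hK hM hR h0 h1 h2 hl hb x hx
  obtain ⟨S, hSA, hSu, hSs⟩ := sqrt_lin hΛ hA
  have hΛ0 : 0 < Λ := by linarith
  set μ := R / (9 * Λ) with hμ
  have hμ0 : 0 < μ := by positivity
  have hμR : μ ≤ R := by
    rw [hμ, div_le_iff₀ (by positivity)]; nlinarith
  set V : EuS n → ℝ := fun y => v (x0 + (μ • S) y) with hV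
  have hVc : ContDiff ℝ 2 V := hv.comp (by fun_prop)
  have hLn : ∀ y, ‖(x0 + (μ • S) y) - x0‖ ≤ μ * Λ * ‖y‖ := by
    intro y
    rw [add_sub_cancel_left, _root_.smul_apply, norm_smul, norm_of_nonneg hμ0.le, mul_assoc]
    gcongr; exact hSu y
  have hμΛ : μ * Λ = R / 9 := by rw [hμ]; field_simp
  have hLR : ∀ y, ‖y‖ ≤ 9 → ‖(x0 + (μ • S) y) - x0‖ ≤ R := by
    intro y hy
    have := hLn y
    rw [hμΛ] at this
    nlinarith
  have key := hC V (K * R ^ (7/3:ℝ)) M hVc (by positivity) hM (by simp [hV, h0])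
    (by rw [hV, fderiv_lin hv, map_zero, add_zero, h1]; simp)
    (by
      ext a b
      rw [hV, hess_lin hv, map_zero, add_zero, h2]; simp)
    (by
      intro y hy
      have e : lapl V y = μ ^ 2 * trA A (hess v (x0 + (μ • S) y)) := by
        unfold lapl
        rw [← trA_eq_sum_S hSA, Finset.mul_sum]
        refine Finset.sum_congr rfl fun i _ => ?_
        rw [hV, hess_lin hv]
        simp only [_root_.smul_apply, map_smul, smul_eq_mul]
        ring
      rw [e, abs_mul, abs_of_nonneg (by positivity)]
      have h3 := hl _ (hLR y hy)
      have h4 : ‖(x0 + (μ • S) y) - x0‖ ≤ R * ‖y‖ := by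
        refine (hLn y).trans ?_
        rw [hμΛ]; gcongr; linarith
      calc μ ^ 2 * |trA A (hess v (x0 + (μ • S) y))|
          ≤ R ^ 2 * (K * (R * ‖y‖) ^ (1/3:ℝ)) := by
            gcongr
            refine h3.trans ?_
            gcongr
        _ = K * (R ^ 2 * R ^ (1/3:ℝ)) * ‖y‖ ^ (1/3:ℝ) := by
            rw [mul_rpow hR.le (norm_nonneg _)]; ring
        _ = _ := by
            rw [show R ^ 2 * R ^ (1/3:ℝ) = R ^ (7/3:ℝ) by
              rw [← rpow_natCast, ← rpow_add hR]; norm_num])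
    (fun y hy => hb _ (hLR y hy))
  obtain ⟨y, hy, hyn⟩ := hSs (μ⁻¹ • (x - x0))
  have hxy : x0 + (μ • S) y = x := by
    rw [_root_.smul_apply, hy, smul_smul, mul_inv_cancel₀ hμ0.ne', one_smul]; abel
  have hyn' : ‖y‖ ≤ 9 * Λ ^ 2 * (‖x - x0‖ / R) := by
    refine hyn.trans (le_of_eq ?_)
    rw [norm_smul, norm_inv, norm_of_nonneg hμ0.le, hμ]
    field_simp
  have hy8 : ‖y‖ ≤ 8 := by
    refine hyn'.trans ?_
    have : ‖x - x0‖ / R ≤ 1 / (2 * Λ ^ 2) := by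
      rw [div_le_iff₀ hR]; refine hx.trans (le_of_eq (by ring))
    calc 9 * Λ ^ 2 * (‖x - x0‖ / R) ≤ 9 * Λ ^ 2 * (1 / (2 * Λ ^ 2)) := by gcongr
      _ ≤ 8 := by
        rw [mul_one_div, div_le_iff₀ (by positivity)]; nlinarith [sq_nonneg Λ]
  have := key y hy8
  have e : V y = v x := by rw [hV]; simp only [hxy]
  rw [e] at this
  refine this.trans ?_
  calc C * (K * R ^ (7/3:ℝ) + M) * ‖y‖ ^ (7/3:ℝ) ≤
      C * (K * R ^ (7/3:ℝ) + M) * (9 * Λ ^ 2 * (‖x - x0‖ / R)) ^ (7/3:ℝ) := by gcongr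
    _ = _ := by
      rw [mul_rpow (by positivity) (by positivity)]; ring

/-- second-order Taylor polynomial at `z` -/
noncomputable def Tay {n : ℕ} (φ : EuS n → ℝ) (z x : EuS n) : ℝ :=
  φ z + fderiv ℝ φ z (x - z) + hess φ z (x - z) (x - z) / 2

lemma Tay_hasFDerivAt {n : ℕ} {φ : EuS n → ℝ} (hφ : ContDiff ℝ 2 φ) (z x : EuS n) :
    HasFDerivAt (Tay φ z) (fderiv ℝ φ z + hess φ z (x - z)) x := by
  have h1 : HasFDerivAt (fun x : EuS n => x - z) (ContinuousLinearMap.id ℝ (EuS n)) x :=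
    (hasFDerivAt_id x).sub_const z
  have h2 : HasFDerivAt (fun x => fderiv ℝ φ z (x - z)) _ x :=
    (fderiv ℝ φ z).hasFDerivAt.comp x h1
  have h3 : HasFDerivAt (fun x => hess φ z (x - z)) _ x :=
    (hess φ z).hasFDerivAt.comp x h1
  have h4 : HasFDerivAt (fun x => φ z + fderiv ℝ φ z (x - z) + hess φ z (x - z) (x - z) * (1/2)) _ x :=
    (h2.const_add (φ z)).add ((h3.clm_apply h1).mul_const (1/2))
  have e : Tay φ z = fun x => φ z + fderiv ℝ φ z (x - z) + hess φ z (x - z) (x - z) * (1/2) := by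
    ext x; simp [Tay]; ring
  rw [e]
  have : fderiv ℝ φ z + hess φ z (x - z) = fderiv ℝ (fun x => φ z + fderiv ℝ φ z (x - z) + hess φ z (x - z) (x - z) * (1/2)) x := by
    rw [h4.fderiv]
    ext y
    have := hess_symm hφ z y x
    have := hess_symm hφ z y z
    simp
    linarith
  rw [this, h4.fderiv]
  exact h4

lemma Tay_contDiff {n : ℕ} (φ : EuS n → ℝ) (z : EuS n) : ContDiff ℝ 2 (Tay φ z) := by
  unfold Tay
  fun_prop

lemma Tay_hess {n : ℕ} {φ : EuS n → ℝ} (hφ : ContDiff ℝ 2 φ) (z x : EuS n) :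
    hess (Tay φ z) x = hess φ z := by
  have e : fderiv ℝ (Tay φ z) = fun x => fderiv ℝ φ z + hess φ z (x - z) := by
    ext1 x; exact (Tay_hasFDerivAt hφ z x).fderiv
  have h1 : HasFDerivAt (fun x : EuS n => x - z) (ContinuousLinearMap.id ℝ (EuS n)) x :=
    (hasFDerivAt_id x).sub_const z
  have h3 : HasFDerivAt (fun x => fderiv ℝ φ z + hess φ z (x - z)) _ x :=
    ((hess φ z).hasFDerivAt.comp x h1).const_add _
  unfold hess at *
  rw [e, h3.fderiv]
  ext a b
  simp

lemma sym_norm_le {n : ℕ} (H : EuS n →L[ℝ] EuS n →L[ℝ] ℝ) (hs : ∀ ξ ζ, H ξ ζ = H ζ ξ) {D : ℝ}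
    (hD0 : 0 ≤ D) (hD : ∀ ξ, ‖ξ‖ = 1 → |H ξ ξ| ≤ D) : ‖H‖ ≤ D := by
  have hD' : ∀ ξ, |H ξ ξ| ≤ D * ‖ξ‖ ^ 2 := by
    intro ξ
    rcases eq_or_ne ξ 0 with rfl | h
    · simp
    · have h0 : ‖ξ‖ ≠ 0 := norm_ne_zero_iff.mpr h
      have := hD (‖ξ‖⁻¹ • ξ) (by rw [norm_smul, norm_inv, norm_norm, inv_mul_cancel₀ h0])
      simp only [map_smul, _root_.smul_apply, smul_eq_mul] at this
      rw [abs_mul, abs_mul, abs_of_nonneg (by positivity)] at this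
      have hp : 0 < ‖ξ‖ := by positivity
      calc |H ξ ξ| = (‖ξ‖⁻¹ * (‖ξ‖⁻¹ * |H ξ ξ|)) * ‖ξ‖ ^ 2 := by field_simp
        _ ≤ D * ‖ξ‖ ^ 2 := by gcongr
  have hu : ∀ ξ ζ, ‖ξ‖ = 1 → ‖ζ‖ = 1 → |H ξ ζ| ≤ D := by
    intro ξ ζ h1 h2
    have e : H ξ ζ = (H (ξ + ζ) (ξ + ζ) - H (ξ - ζ) (ξ - ζ)) / 4 := by
      simp only [map_add, map_sub, _root_.add_apply, _root_.sub_apply, hs ζ ξ]; ring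
    have a1 := hD' (ξ + ζ)
    have a2 := hD' (ξ - ζ)
    have par := parallelogram_law_with_norm ℝ ξ ζ
    rw [h1, h2] at par
    rw [e, abs_le]
    rw [abs_le] at a1 a2
    have : D * ‖ξ + ζ‖ ^ 2 + D * ‖ξ - ζ‖ ^ 2 = 4 * D := by
      rw [← mul_add]; nlinarith
    constructor <;> linarith [a1.1, a1.2, a2.1, a2.2]
  refine ContinuousLinearMap.opNorm_le_bound₂ H hD0 fun ξ ζ => ?_
  rcases eq_or_ne ξ 0 with rfl | h
  · simp
  rcases eq_or_ne ζ 0 with rfl | h'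
  · simp
  have h0 : ‖ξ‖ ≠ 0 := norm_ne_zero_iff.mpr h
  have h0' : ‖ζ‖ ≠ 0 := norm_ne_zero_iff.mpr h'
  have := hu (‖ξ‖⁻¹ • ξ) (‖ζ‖⁻¹ • ζ) (by rw [norm_smul, norm_inv, norm_norm, inv_mul_cancel₀ h0])
    (by rw [norm_smul, norm_inv, norm_norm, inv_mul_cancel₀ h0'])
  simp only [map_smul, _root_.smul_apply, smul_eq_mul] at this
  rw [abs_mul, abs_mul, abs_of_nonneg (by positivity), abs_of_nonneg (a := ‖ξ‖⁻¹) (by positivity)] at this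
  rw [Real.norm_eq_abs]
  have hp : 0 < ‖ξ‖ := by positivity
  have hp' : 0 < ‖ζ‖ := by positivity
  calc |H ξ ζ| = (‖ζ‖⁻¹ * (‖ξ‖⁻¹ * |H ξ ζ|)) * ‖ξ‖ * ‖ζ‖ := by field_simp
    _ ≤ D * ‖ξ‖ * ‖ζ‖ := by gcongr

lemma Tay_diff2 {n : ℕ} (φ : EuS n → ℝ) (hφ : ContDiff ℝ 2 φ) (z x ξ : EuS n) :
    Tay φ z (x + ξ) + Tay φ z (x - ξ) - 2 * Tay φ z x = hess φ z ξ ξ := by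
  unfold Tay
  have e1 : x + ξ - z = (x - z) + ξ := by abel
  have e2 : x - ξ - z = (x - z) - ξ := by abel
  rw [e1, e2]
  generalize x - z = w
  simp only [map_add, map_sub, _root_.add_apply, _root_.sub_apply]
  ring

lemma rpow73 (t : ℝ) (ht : 0 ≤ t) : t ^ (7/3:ℝ) = t ^ 2 * t ^ (1/3:ℝ) := by
  rw [← Real.rpow_natCast t 2, ← Real.rpow_add' ht (by norm_num)]; norm_num

lemma compare_hess {n : ℕ} {φ : EuS n → ℝ} (hφ : ContDiff ℝ 2 φ) {C1 ρ : ℝ} (hC : 0 ≤ C1)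
    {x x0 : EuS n} (hx : ‖x - x0‖ ≤ ρ / 2)
    (h0 : ∀ y, ‖y - x0‖ ≤ ρ → |φ y - Tay φ x0 y| ≤ C1 * ‖y - x0‖ ^ (7/3:ℝ))
    (h1 : ∀ y, ‖y - x‖ ≤ ρ → |φ y - Tay φ x y| ≤ C1 * ‖y - x‖ ^ (7/3:ℝ)) :
    ‖hess φ x - hess φ x0‖ ≤ 64 * C1 * ‖x - x0‖ ^ (1/3:ℝ) := by
  set h := ‖x - x0‖ with hh
  rcases eq_or_ne x x0 with rfl | hne
  · have : hess φ x - hess φ x = 0 := by ext a b; simp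
    rw [this]
    simp only [ContinuousLinearMap.opNorm_zero]
    positivity
  have hp : 0 < h := norm_pos_iff.mpr (sub_ne_zero.mpr hne)
  refine sym_norm_le _ (fun ξ ζ => ?_) (by positivity) fun ξ hξ => ?_
  · simp only [_root_.sub_apply, hess_symm hφ x ξ, hess_symm hφ x0 ξ]
  have key : ∀ y, ‖y - x0‖ ≤ h → |Tay φ x y - Tay φ x0 y| ≤ 16 * C1 * (h ^ 2 * h ^ (1/3:ℝ)) := by
    intro y hy
    have b0 : ‖y - x‖ ≤ 2 * h := by
      have : y - x = (y - x0) - (x - x0) := by abel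
      rw [this]; exact (norm_sub_le _ _).trans (by linarith)
    have a0 := h0 y (by linarith)
    have a1 := h1 y (by linarith)
    have c0 : ‖y - x0‖ ^ (7/3:ℝ) ≤ (2*h) ^ (7/3:ℝ) := by gcongr; linarith
    have c1 : ‖y - x‖ ^ (7/3:ℝ) ≤ (2*h) ^ (7/3:ℝ) := by gcongr
    have c2 : (2*h) ^ (7/3:ℝ) ≤ 8 * (h ^ 2 * h ^ (1/3:ℝ)) := by
      rw [Real.mul_rpow (by norm_num) hp.le, rpow73 h hp.le]
      have : (2:ℝ) ^ (7/3:ℝ) ≤ 8 := by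
        calc (2:ℝ) ^ (7/3:ℝ) ≤ (2:ℝ) ^ (3:ℝ) := by
              apply Real.rpow_le_rpow_of_exponent_le <;> norm_num
          _ = 8 := by norm_num
      gcongr
    have d0 := a0.trans (mul_le_mul_of_nonneg_left (c0.trans c2) hC)
    have d1 := a1.trans (mul_le_mul_of_nonneg_left (c1.trans c2) hC)
    rw [abs_le] at d0 d1 ⊢
    constructor <;> linarith [d0.1, d0.2, d1.1, d1.2]
  have k1 := key (x0 + h • ξ) (by simp [norm_smul, hξ, abs_of_pos hp])
  have k2 := key (x0 - h • ξ) (by simp [norm_smul, hξ, abs_of_pos hp])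
  have k3 := key x0 (by simp [hp.le])
  have e1 := Tay_diff2 φ hφ x x0 (h • ξ)
  have e2 := Tay_diff2 φ hφ x0 x0 (h • ξ)
  simp only [map_smul, _root_.smul_apply, smul_eq_mul] at e1 e2
  have : |h ^ 2 * (hess φ x ξ ξ - hess φ x0 ξ ξ)| ≤ h ^ 2 * (64 * C1 * h ^ (1/3:ℝ)) := by
    have e : h ^ 2 * (hess φ x ξ ξ - hess φ x0 ξ ξ) = (Tay φ x (x0 + h • ξ) - Tay φ x0 (x0 + h • ξ)) + (Tay φ x (x0 - h • ξ) - Tay φ x0 (x0 - h • ξ)) - 2 * (Tay φ x x0 - Tay φ x0 x0) := by linarith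
    rw [e]
    rw [abs_le] at k1 k2 k3 ⊢
    constructor <;> nlinarith [k1.1, k1.2, k2.1, k2.2, k3.1, k3.2]
  rw [abs_mul, abs_of_pos (by positivity)] at this
  exact le_of_mul_le_mul_left this (by positivity)

/-- pointwise form of the equation and structure conditions on the ball of radius `3/4`. -/
structure PW (n : ℕ) (Λ K κ : ℝ) (φ : EuS n → ℝ) (α : EuS n → Fin n → Fin n → ℝ)
    (h : EuS n → ℝ) : Prop where
  cd : ContDiff ℝ 2 φ
  ell : ∀ x ∈ ball (0 : EuS n) (3/4), Ell Λ (α x)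
  eq : ∀ x ∈ ball (0 : EuS n) (3/4), trA (α x) (hess φ x) = h x
  rng : ∀ x ∈ ball (0 : EuS n) (3/4), 0 ≤ φ x ∧ φ x ≤ κ
  hb : ∀ x ∈ ball (0 : EuS n) (3/4), |h x| ≤ K * (‖fderiv ℝ φ x‖ ^ 2 + rexp κ)
  αh : ∀ x ∈ ball (0 : EuS n) (3/4), ∀ y ∈ ball (0 : EuS n) (3/4), ∀ i j,
    |α x i j - α y i j| ≤ K * (‖x - y‖ + |φ x - φ y|)
  hh : ∀ x ∈ ball (0 : EuS n) (3/4), ∀ y ∈ ball (0 : EuS n) (3/4),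
    |h x - h y| ≤ K * ((rexp κ + ‖fderiv ℝ φ x‖ ^ 2) * (‖x - y‖ ^ (1/3:ℝ) + |φ x - φ y|) +
      (1 + ‖fderiv ℝ φ x‖ + ‖fderiv ℝ φ y‖) * ‖fderiv ℝ φ x - fderiv ℝ φ y‖)

lemma abs_trA_le {n : ℕ} {A : Fin n → Fin n → ℝ} {δ : ℝ} (hδ : 0 ≤ δ) (hA : ∀ i j, |A i j| ≤ δ)
    (H : EuS n →L[ℝ] EuS n →L[ℝ] ℝ) : |trA A H| ≤ n ^ 2 * δ * ‖H‖ := by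
  unfold trA
  have : ∀ i j, |A i j * H (ee i) (ee j)| ≤ δ * ‖H‖ := by
    intro i j
    rw [abs_mul]
    have h1 := ContinuousLinearMap.le_opNorm₂ H (ee i) (ee j)
    rw [norm_ee, norm_ee, mul_one, mul_one, Real.norm_eq_abs] at h1
    exact mul_le_mul (hA i j) h1 (abs_nonneg _) hδ
  calc |∑ i, ∑ j, A i j * H (ee i) (ee j)| ≤ ∑ i, ∑ j, |A i j * H (ee i) (ee j)| := by
        refine (Finset.abs_sum_le_sum_abs _ _).trans (Finset.sum_le_sum fun i _ => ?_)
        exact Finset.abs_sum_le_sum_abs _ _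
    _ ≤ ∑ i : Fin n, ∑ j : Fin n, δ * ‖H‖ :=
        Finset.sum_le_sum fun i _ => Finset.sum_le_sum fun j _ => this i j
    _ = _ := by simp; ring

lemma fderiv_lipE {E : Type*} [NormedAddCommGroup E] [NormedSpace ℝ E] {F : Type*}
    [NormedAddCommGroup F] [NormedSpace ℝ F] {g : E → F} (hg : Differentiable ℝ g)
    {s : Set E} (hs : Convex ℝ s) {C : ℝ} (hC : ∀ x ∈ s, ‖fderiv ℝ g x‖ ≤ C) {x y : E} (hx : x ∈ s)
    (hy : y ∈ s) : ‖g y - g x‖ ≤ C * ‖y - x‖ :=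
  hs.norm_image_sub_le_of_norm_fderiv_le (fun x _ => hg x) hC hx hy

lemma trA_sub_left {n : ℕ} (A B : Fin n → Fin n → ℝ) (H : EuS n →L[ℝ] EuS n →L[ℝ] ℝ) :
    trA (fun i j => A i j - B i j) H = trA A H - trA B H := by
  simp [trA, sub_mul, Finset.sum_sub_distrib]

lemma Z1 {n : ℕ} (hn : 0 < n) {Λ K κ : ℝ} (hK : 1 ≤ K) {φ : EuS n → ℝ}
    {α : EuS n → Fin n → Fin n → ℝ} {h : EuS n → ℝ} (P : PW n Λ K κ φ α h)
    {x0 : EuS n} {r : ℝ} (hr : 0 < r) (hr1 : r ≤ 1) (hsub : ball x0 r ⊆ ball 0 (3/4))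
    (hrk : r ^ 2 * rexp κ ≤ 1) (hD : ∀ x ∈ ball x0 r, ‖fderiv ℝ φ x‖ ≤ 2 / r)
    (hH : ∀ x ∈ ball x0 r, ‖hess φ x‖ ≤ 4 / r ^ 2) {x z : EuS n} (hx : x ∈ ball x0 r)
    (hz : z ∈ ball x0 r) (hxz : ‖x - z‖ ≤ r) :
    |trA (α z) (hess φ x - hess φ z)| ≤ 47 * n ^ 2 * K / (r ^ 2 * r ^ (1/3:ℝ)) * ‖x - z‖ ^ (1/3:ℝ) := by
  have hn1 : (1:ℝ) ≤ (n:ℝ) ^ 2 := by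
    have : (1:ℝ) ≤ n := by exact_mod_cast hn
    nlinarith
  set s := r ^ (1/3:ℝ) with hs
  set τ := ‖x - z‖ ^ (1/3:ℝ) with hτ
  have hs0 : 0 < s := by positivity
  have hτ0 : 0 ≤ τ := by positivity
  have es : s ^ 3 = r := by rw [hs, ← Real.rpow_natCast, ← Real.rpow_mul hr.le]; norm_num
  have eτ : τ ^ 3 = ‖x - z‖ := by rw [hτ, ← Real.rpow_natCast, ← Real.rpow_mul (norm_nonneg _)]; norm_num
  have hτs : τ ≤ s := by rw [hs, hτ]; gcongr
  have hs1 : s ≤ 1 := by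
    by_contra hc
    push Not at hc
    have : 1 < s ^ 3 := one_lt_pow₀ hc (by norm_num)
    linarith
  have b1 : |φ x - φ z| ≤ 2 / r * ‖x - z‖ :=
    fderiv_lipE (P.cd.differentiable (by norm_num)) (convex_ball x0 r) hD hz hx
  have b2 : ‖fderiv ℝ φ x - fderiv ℝ φ z‖ ≤ 4 / r ^ 2 * ‖x - z‖ :=
    fderiv_lipE ((contDiff_fderiv P.cd).differentiable (by norm_num)) (convex_ball x0 r) hH hz hx
  have e : trA (α z) (hess φ x - hess φ z) =
      (h x - h z) + trA (fun i j => α z i j - α x i j) (hess φ x) := by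
    rw [trA_sub, trA_sub_left, P.eq z (hsub hz), P.eq x (hsub hx)]; ring
  have hek : rexp κ ≤ 1 / r ^ 2 := by rw [le_div_iff₀ (by positivity)]; linarith
  have px := hD x hx
  have pz := hD z hz
  rw [← eτ, ← es] at b1 b2
  rw [← es] at px pz hek
  have b1' : |φ x - φ z| ≤ 2 * τ / s := by
    refine b1.trans ?_
    rw [div_mul_eq_mul_div, div_le_div_iff₀ (by positivity) hs0]
    have : τ ^ 2 ≤ s ^ 2 := by gcongr
    nlinarith [mul_nonneg hτ0 hs0.le, mul_le_mul_of_nonneg_left this (mul_nonneg hτ0 hs0.le)]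
  have b2' : ‖fderiv ℝ φ x - fderiv ℝ φ z‖ ≤ 4 * τ / s ^ 4 := by
    refine b2.trans ?_
    rw [div_mul_eq_mul_div, div_le_div_iff₀ (by positivity) (by positivity)]
    have : τ ^ 2 ≤ s ^ 2 := by gcongr
    nlinarith [mul_nonneg hτ0 hs0.le, mul_le_mul_of_nonneg_left this (by positivity : 0 ≤ τ * s ^ 4)]
  have c1 : |h x - h z| ≤ 35 * K * (τ / s ^ 7) := by
    refine (P.hh x (hsub hx) z (hsub hz)).trans ?_
    have i1 : rexp κ + ‖fderiv ℝ φ x‖ ^ 2 ≤ 5 / s ^ 6 := by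
      have : ‖fderiv ℝ φ x‖ ^ 2 ≤ (2 / s ^ 3) ^ 2 := by gcongr
      calc _ ≤ 1 / (s ^ 3) ^ 2 + (2 / s ^ 3) ^ 2 := add_le_add hek this
        _ = _ := by field_simp; norm_num
    have i2 : ‖x - z‖ ^ (1/3:ℝ) + |φ x - φ z| ≤ 3 * τ / s := by
      rw [← hτ]
      have : τ ≤ τ / s := by rw [le_div_iff₀ hs0]; nlinarith
      calc _ ≤ τ / s + 2 * τ / s := add_le_add this b1'
        _ = _ := by ring
    have i3 : 1 + ‖fderiv ℝ φ x‖ + ‖fderiv ℝ φ z‖ ≤ 5 / s ^ 3 := by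
      have : 1 ≤ 1 / s ^ 3 := by rw [le_div_iff₀ (by positivity), one_mul]; exact pow_le_one₀ hs0.le hs1
      calc _ ≤ 1 / s ^ 3 + 2 / s ^ 3 + 2 / s ^ 3 := by gcongr
        _ = _ := by ring
    calc _ ≤ K * (5 / s ^ 6 * (3 * τ / s) + 5 / s ^ 3 * (4 * τ / s ^ 4)) := by gcongr
      _ = _ := by field_simp; ring
  have c2 : |trA (fun i j => α z i j - α x i j) (hess φ x)| ≤ 12 * n ^ 2 * K * (τ / s ^ 7) := by
    have hA : ∀ i j, |α z i j - α x i j| ≤ 3 * K * (τ / s) := by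
      intro i j
      rw [abs_sub_comm]
      refine (P.αh x (hsub hx) z (hsub hz) i j).trans ?_
      have : ‖x - z‖ ≤ τ / s := by
        rw [← eτ, le_div_iff₀ hs0]
        have h2 : τ ≤ 1 := hτs.trans hs1
        have h3 : τ ^ 2 ≤ 1 := pow_le_one₀ hτ0 h2
        have h4 : τ ^ 2 * s ≤ 1 := by nlinarith
        nlinarith [mul_le_mul_of_nonneg_left h4 hτ0]
      calc _ ≤ K * (τ / s + 2 * τ / s) := by gcongr
        _ = _ := by ring
    refine (abs_trA_le (by positivity) hA _).trans ?_
    have := hH x hx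
    rw [← es] at this
    calc _ ≤ n ^ 2 * (3 * K * (τ / s)) * (4 / (s ^ 3) ^ 2) := by gcongr
      _ = _ := by field_simp; ring
  rw [e]
  refine (abs_add_le _ _).trans ((add_le_add c1 c2).trans ?_)
  rw [← es]
  have : 35 * K * (τ / s ^ 7) + 12 * n ^ 2 * K * (τ / s ^ 7) ≤ 47 * n ^ 2 * K * (τ / s ^ 7) := by
    have : 0 ≤ K * (τ / s ^ 7) := by positivity
    nlinarith
  refine this.trans (le_of_eq ?_)
  field_simp

lemma Tay_sub_le {n : ℕ} {φ : EuS n → ℝ} (hφ : ContDiff ℝ 2 φ) {z x : EuS n} {D : ℝ}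
    (hD : ∀ s ∈ Icc (0:ℝ) 1, ‖hess φ (z + s • (x - z))‖ ≤ D) : |φ x - Tay φ z x| ≤ D * ‖x - z‖ ^ 2 := by
  obtain ⟨s, hs, h⟩ := taylor2 hφ z (x - z)
  rw [add_sub_cancel] at h
  have h0 := hD 0 (by simp)
  simp only [zero_smul, add_zero] at h0
  have h1 := hD s ⟨hs.1.le, hs.2.le⟩
  have a0 := ContinuousLinearMap.le_opNorm₂ (hess φ z) (x - z) (x - z)
  have a1 := ContinuousLinearMap.le_opNorm₂ (hess φ (z + s • (x - z))) (x - z) (x - z)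
  rw [Real.norm_eq_abs] at a0 a1
  have b0 : ‖hess φ z‖ * ‖x - z‖ * ‖x - z‖ ≤ D * ‖x - z‖ * ‖x - z‖ := by gcongr
  have b1 : ‖hess φ (z + s • (x - z))‖ * ‖x - z‖ * ‖x - z‖ ≤ D * ‖x - z‖ * ‖x - z‖ := by gcongr
  have c0 := abs_le.mp (a0.trans b0)
  have c1 := abs_le.mp (a1.trans b1)
  rw [h, Tay, abs_le]
  constructor <;> nlinarith [c0.1, c0.2, c1.1, c1.2]

lemma lemmaZ (n : ℕ) (hn : 0 < n) (Λ K : ℝ) (hΛ : 1 ≤ Λ) (hK : 1 ≤ K) : ∃ C, 0 ≤ C ∧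
    ∀ (κ : ℝ) (φ : EuS n → ℝ) (α : EuS n → Fin n → Fin n → ℝ) (h : EuS n → ℝ),
    PW n Λ K κ φ α h → ∀ (x0 : EuS n) (r : ℝ), 0 < r → r ≤ 1 → ball x0 r ⊆ ball 0 (3/4) →
    r ^ 2 * rexp κ ≤ 1 → (∀ x ∈ ball x0 r, ‖fderiv ℝ φ x‖ ≤ 2 / r) →
    (∀ x ∈ ball x0 r, ‖hess φ x‖ ≤ 4 / r ^ 2) → ∀ x, ‖x - x0‖ ≤ r / (16 * Λ ^ 2) →
    ‖hess φ x - hess φ x0‖ ≤ C / r ^ 2 * (‖x - x0‖ / r) ^ (1/3:ℝ) := by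
  obtain ⟨C, hC0, hC⟩ := const_schauder n hn Λ hΛ
  refine ⟨64 * (C * (47 * n ^ 2 * K + 1) * 64), by positivity, ?_⟩
  intro κ φ α h P x0 r hr hr1 hsub hrk hD hH x hx
  have hΛ2 : 1 ≤ Λ ^ 2 := one_le_pow₀ hΛ
  have hx4 : r / (16 * Λ ^ 2) ≤ r / 4 := by
    apply div_le_div_of_nonneg_left hr.le (by norm_num); linarith
  have main : ∀ z, ‖z - x0‖ ≤ r / 4 → ∀ y, ‖y - z‖ ≤ r / (8 * Λ ^ 2) →
      |φ y - Tay φ z y| ≤ (C * (47 * n ^ 2 * K + 1) * 64 / (r ^ 2 * r ^ (1/3:ℝ))) * ‖y - z‖ ^ (7/3:ℝ) := by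
    intro z hz y hy
    have inb : ∀ w, ‖w - z‖ ≤ r / 4 → w ∈ ball x0 r := by
      intro w hw
      rw [mem_ball, dist_eq_norm]
      have : w - x0 = (w - z) + (z - x0) := by abel
      rw [this]
      exact (norm_add_le _ _).trans_lt (by linarith)
    have hzb : z ∈ ball x0 r := inb z (by simp; positivity)
    have hv : ContDiff ℝ 2 (fun x => φ x - 1 * Tay φ z x) := P.cd.sub (contDiff_const.mul (Tay_contDiff φ z))
    have := hC (fun x => φ x - 1 * Tay φ z x) (α z) (47 * n ^ 2 * K / (r ^ 2 * r ^ (1/3:ℝ))) 1 (r / 4) z hv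
      (P.ell z (hsub hzb)) (by positivity) (by norm_num) (by positivity) (by simp [Tay])
      (by rw [fderiv_sub_smul P.cd (Tay_contDiff φ z)]
          simp only
          rw [(Tay_hasFDerivAt P.cd z z).fderiv]; simp)
      (by rw [hess_sub_smul P.cd (Tay_contDiff φ z), Tay_hess P.cd]; ext a b; simp)
      (by
        intro w hw
        rw [hess_sub_smul P.cd (Tay_contDiff φ z), Tay_hess P.cd]
        have e : hess φ w - (1:ℝ) • hess φ z = hess φ w - hess φ z := by ext a b; simp
        rw [e]
        exact Z1 hn hK P hr hr1 hsub hrk hD hH (inb w hw) hzb (by linarith))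
      (by
        intro w hw
        rw [one_mul]
        refine (Tay_sub_le P.cd (D := 4 / r ^ 2) ?_).trans ?_
        · intro s hs
          apply hH
          apply inb
          rw [add_sub_cancel_left, norm_smul, Real.norm_eq_abs, abs_of_nonneg hs.1]
          nlinarith [norm_nonneg (w - z), hs.1, hs.2]
        · calc 4 / r ^ 2 * ‖w - z‖ ^ 2 ≤ 4 / r ^ 2 * (r / 4) ^ 2 := by gcongr
            _ = 1 / 4 := by field_simp
            _ ≤ 1 := by norm_num)
      y (by refine hy.trans (le_of_eq ?_); field_simp; norm_num)
    rw [one_mul] at this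
    refine this.trans ?_
    rw [rpow73 (r/4) (by positivity), rpow73 (‖y - z‖ / (r / 4)) (by positivity), rpow73 ‖y - z‖ (by positivity)]
    rw [Real.div_rpow (norm_nonneg (y - z)) (by positivity : 0 ≤ r / 4), Real.div_rpow hr.le (by norm_num : (0:ℝ) ≤ 4)]
    set q := (4:ℝ) ^ (1/3:ℝ) with hq
    have q1 : 1 ≤ q := Real.one_le_rpow (by norm_num) (by norm_num)
    have q2 : q ≤ 4 := by
      calc q ≤ (4:ℝ) ^ (1:ℝ) := by apply Real.rpow_le_rpow_of_exponent_le <;> norm_num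
        _ = 4 := by norm_num
    set s := r ^ (1/3:ℝ) with hs
    have hs0 : 0 < s := by positivity
    set τ := ‖y - z‖ ^ (1/3:ℝ) with hτ
    have hτ0 : 0 ≤ τ := by positivity
    have f1 : 47 * n ^ 2 * K / (r ^ 2 * s) * ((r / 4) ^ 2 * (s / q)) ≤ 47 * n ^ 2 * K := by
      have : 47 * n ^ 2 * K / (r ^ 2 * s) * ((r / 4) ^ 2 * (s / q)) = 47 * n ^ 2 * K * (1 / (16 * q)) := by
        field_simp; norm_num
      rw [this]
      have h3 : 1 / (16 * q) ≤ 1 := by rw [div_le_one (by positivity)]; linarith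
      exact mul_le_of_le_one_right (by positivity) h3
    have f2 : (‖y - z‖ / (r / 4)) ^ 2 * (τ / (s / q)) ≤ 64 * (‖y - z‖ ^ 2 * τ) / (r ^ 2 * s) := by
      have : (‖y - z‖ / (r / 4)) ^ 2 * (τ / (s / q)) = (16 * q) * ((‖y - z‖ ^ 2 * τ) / (r ^ 2 * s)) := by
        field_simp; ring
      rw [this]
      calc _ ≤ 64 * ((‖y - z‖ ^ 2 * τ) / (r ^ 2 * s)) :=
            mul_le_mul_of_nonneg_right (by linarith) (by positivity)
        _ = _ := by ring
    calc _ ≤ C * (47 * n ^ 2 * K + 1) * (64 * (‖y - z‖ ^ 2 * τ) / (r ^ 2 * s)) := by gcongr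
      _ = _ := by ring
  have := compare_hess P.cd (x := x) (x0 := x0) (C1 := C * (47 * n ^ 2 * K + 1) * 64 / (r ^ 2 * r ^ (1/3:ℝ)))
    (ρ := r / (8 * Λ ^ 2)) (by positivity) (by refine hx.trans (le_of_eq ?_); field_simp; norm_num)
    (main x0 (by simp; positivity)) (main x (hx.trans hx4))
  refine this.trans (le_of_eq ?_)
  rw [Real.div_rpow (by positivity) (by positivity)]
  field_simp

lemma interp_hess {n : ℕ} {φ : EuS n → ℝ} (hφ : ContDiff ℝ 2 φ) {x1 : EuS n} {l ε D : ℝ} (hl : 0 < l)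
    (hε : 0 ≤ ε) (hD : 0 ≤ D)
    (hosc : ∀ x, ‖x - x1‖ ≤ l → |φ x - φ x1| ≤ ε)
    (hH : ∀ x, ‖x - x1‖ ≤ l → ‖hess φ x - hess φ x1‖ ≤ D) : ‖hess φ x1‖ ≤ 2 * ε / l ^ 2 + D := by
  refine sym_norm_le _ (hess_symm hφ x1) (by positivity) fun ξ hξ => ?_
  have gen : ∀ ζ : EuS n, ‖ζ‖ = l → ∃ e, |e| ≤ D * l ^ 2 ∧
      φ (x1 + ζ) = φ x1 + fderiv ℝ φ x1 ζ + (hess φ x1 ζ ζ + e) / 2 := by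
    intro ζ hζ
    obtain ⟨s, hs, h⟩ := taylor2 hφ x1 ζ
    refine ⟨(hess φ (x1 + s • ζ) - hess φ x1) ζ ζ, ?_, ?_⟩
    · have h1 := ContinuousLinearMap.le_opNorm₂ (hess φ (x1 + s • ζ) - hess φ x1) ζ ζ
      rw [hζ, Real.norm_eq_abs] at h1
      have h2 := hH (x1 + s • ζ) (by
        rw [add_sub_cancel_left, norm_smul, hζ, Real.norm_eq_abs, abs_of_pos hs.1]
        nlinarith [hs.2])
      refine h1.trans ?_
      rw [sq, ← mul_assoc]
      gcongr
    · rw [h]; simp only [_root_.sub_apply]; ring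
  have hn1 : ‖l • ξ‖ = l := by rw [norm_smul, hξ, Real.norm_eq_abs, abs_of_pos hl, mul_one]
  obtain ⟨e1, he1, h1⟩ := gen (l • ξ) hn1
  obtain ⟨e2, he2, h2⟩ := gen (-(l • ξ)) (by rw [norm_neg, hn1])
  have o1 := hosc (x1 + l • ξ) (by rw [add_sub_cancel_left, hn1])
  have o2 := hosc (x1 + -(l • ξ)) (by rw [add_sub_cancel_left, norm_neg, hn1])
  simp only [map_neg, map_smul, _root_.neg_apply, _root_.smul_apply, smul_eq_mul] at h1 h2
  have : |hess φ x1 ξ ξ * l ^ 2| ≤ (2 * ε / l ^ 2 + D) * l ^ 2 := by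
    have : (2 * ε / l ^ 2 + D) * l ^ 2 = 2 * ε + D * l ^ 2 := by field_simp
    rw [this]
    rw [abs_le] at *
    constructor <;> nlinarith [he1.1, he1.2, he2.1, he2.2, o1.1, o1.2, o2.1, o2.2]
  rw [abs_mul, abs_of_pos (by positivity : 0 < l ^ 2)] at this
  exact le_of_mul_le_mul_right this (by positivity)

lemma interp_grad {n : ℕ} {φ : EuS n → ℝ} (hφ : ContDiff ℝ 2 φ) {x1 : EuS n} {l ε D : ℝ} (hl : 0 < l)
    (hε : 0 ≤ ε) (hD : 0 ≤ D)
    (hosc : ∀ x, ‖x - x1‖ ≤ l → |φ x - φ x1| ≤ ε)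
    (hH : ∀ x, ‖x - x1‖ ≤ l → ‖hess φ x‖ ≤ D) : ‖fderiv ℝ φ x1‖ ≤ ε / l + D * l := by
  refine ContinuousLinearMap.opNorm_le_of_unit_norm (by positivity) fun ξ hξ => ?_
  have hn1 : ‖l • ξ‖ = l := by rw [norm_smul, hξ, Real.norm_eq_abs, abs_of_pos hl, mul_one]
  obtain ⟨s, hs, h⟩ := taylor2 hφ x1 (l • ξ)
  have h1 := ContinuousLinearMap.le_opNorm₂ (hess φ (x1 + s • l • ξ)) (l • ξ) (l • ξ)
  have h2 := hH (x1 + s • l • ξ) (by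
        rw [add_sub_cancel_left, norm_smul, hn1, Real.norm_eq_abs, abs_of_pos hs.1]
        nlinarith [hs.2])
  rw [hn1, Real.norm_eq_abs] at h1
  have h3 : ‖hess φ (x1 + s • l • ξ)‖ * l * l ≤ D * l * l := by gcongr
  have h4 := h1.trans h3
  have o1 := hosc (x1 + l • ξ) (by rw [add_sub_cancel_left, hn1])
  have : |fderiv ℝ φ x1 ξ * l| ≤ (ε / l + D * l) * l := by
    have e : (ε / l + D * l) * l = ε + D * l * l := by field_simp
    have e2 : fderiv ℝ φ x1 (l • ξ) = fderiv ℝ φ x1 ξ * l := by simp [mul_comm]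
    rw [e, ← e2]
    rw [abs_le] at *
    have : 0 ≤ D * l * l := by positivity
    constructor <;> linarith [h4.1, h4.2, o1.1, o1.2]
  rw [abs_mul, abs_of_pos hl] at this
  rw [Real.norm_eq_abs]
  exact le_of_mul_le_mul_right this (by positivity)

lemma point_pick (n : ℕ) (hn : 0 < n) (Λ K : ℝ) (hΛ : 1 ≤ Λ) (hK : 1 ≤ K) : ∃ ε0, 0 < ε0 ∧
    ∀ (κ : ℝ) (φ : EuS n → ℝ) (α : EuS n → Fin n → Fin n → ℝ) (h : EuS n → ℝ),
    PW n Λ K κ φ α h → ∀ (x0 : EuS n) (r0 : ℝ), 0 < r0 → r0 ≤ 1 → ball x0 r0 ⊆ ball 0 (3/4) →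
    r0 ^ 2 * rexp κ ≤ 1 → (∀ x ∈ ball x0 r0, ∀ y ∈ ball x0 r0, |φ x - φ y| ≤ ε0) →
    ∀ x ∈ ball x0 r0, (r0 - ‖x - x0‖) * (‖fderiv ℝ φ x‖ + √‖hess φ x‖) ≤ 4 := by
  obtain ⟨C, hC0, hC⟩ := lemmaZ n hn Λ K hΛ hK
  have hΛ2 : 1 ≤ Λ ^ 2 := one_le_pow₀ hΛ
  obtain ⟨t, ht0, ht1, ht2, ht3⟩ : ∃ t : ℝ, 0 < t ∧ t ≤ 1/32 ∧ t ≤ 1 / (16 * Λ ^ 2) ∧ C * t ≤ 1 / 32 := by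
    refine ⟨1 / (32 * (C + 1) * (16 * Λ ^ 2)), by positivity, ?_, ?_, ?_⟩
    · apply div_le_div_of_nonneg_left (by norm_num) (by norm_num)
      nlinarith [mul_nonneg hC0 (by linarith : 0 ≤ Λ ^ 2 - 1)]
    · apply div_le_div_of_nonneg_left (by norm_num) (by positivity)
      nlinarith [mul_nonneg hC0 (by linarith : 0 ≤ Λ ^ 2)]
    · rw [mul_one_div, div_le_div_iff₀ (by positivity) (by norm_num)]
      nlinarith [mul_nonneg hC0 (by linarith : 0 ≤ Λ ^ 2 - 1)]
  set τ := t ^ 3 with hτ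
  have hτ0 : 0 < τ := by positivity
  have hτt : τ ≤ t := by
    rw [hτ]; exact pow_le_of_le_one ht0.le (by linarith) (by norm_num)
  have ert : τ ^ (1/3:ℝ) = t := by
    rw [hτ, ← Real.rpow_natCast t 3, ← Real.rpow_mul ht0.le]; norm_num
  refine ⟨τ ^ 2 / 64, by positivity, ?_⟩
  intro κ φ α h P x0 r0 hr0 hr01 hsub hrk hosc
  set g : EuS n → ℝ := fun x => ‖fderiv ℝ φ x‖ + √‖hess φ x‖ with hg
  have hgc : Continuous g :=
    ((contDiff_fderiv P.cd).continuous.norm).add (cont_norm_hess P.cd).sqrt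
  have hGc : Continuous fun x => (r0 - ‖x - x0‖) * g x := by fun_prop
  obtain ⟨x1, hx1, hmax⟩ := (isCompact_closedBall x0 r0).exists_isMaxOn ⟨x0, by simp [hr0.le]⟩ hGc.continuousOn
  by_contra hcon
  push Not at hcon
  obtain ⟨y0, hy0, hy0'⟩ := hcon
  have hgn : ∀ x, 0 ≤ g x := fun x => by positivity
  have hG1 : 4 < (r0 - ‖x1 - x0‖) * g x1 := lt_of_lt_of_le hy0' (hmax (ball_subset_closedBall hy0))
  set d := r0 - ‖x1 - x0‖ with hd
  have hd0 : 0 < d := by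
    by_contra hc; push Not at hc
    nlinarith [hgn x1]
  have hg1 : 0 < g x1 := by
    by_contra hc; push Not at hc
    nlinarith
  obtain ⟨r, hr⟩ : ∃ r, r = 1 / g x1 := ⟨_, rfl⟩
  have hrp : 0 < r := by rw [hr]; positivity
  have hrg : r * g x1 = 1 := by rw [hr]; field_simp
  have hrd : 4 * r < d := by
    rw [hr, mul_one_div, div_lt_iff₀ hg1]; exact hG1
  have hdr0 : d ≤ r0 := by rw [hd]; linarith [norm_nonneg (x1 - x0)]
  have inb : ∀ y, ‖y - x1‖ ≤ 2 * r → y ∈ ball x0 r0 ∧ d / 2 ≤ r0 - ‖y - x0‖ := by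
    intro y hy
    have h1 : ‖y - x0‖ ≤ ‖y - x1‖ + ‖x1 - x0‖ := by
      have : y - x0 = (y - x1) + (x1 - x0) := by abel
      rw [this]; exact norm_add_le _ _
    refine ⟨?_, by linarith⟩
    rw [mem_ball, dist_eq_norm]; linarith
  have hgy : ∀ y ∈ ball x1 r, g y ≤ 2 / r := by
    intro y hy
    rw [mem_ball, dist_eq_norm] at hy
    obtain ⟨i1, i2⟩ := inb y (by linarith)
    have h3 : (r0 - ‖y - x0‖) * g y ≤ d * g x1 := hmax (ball_subset_closedBall i1)
    have h4 : d / 2 * g y ≤ d * g x1 := (mul_le_mul_of_nonneg_right i2 (hgn y)).trans h3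
    have h5 : g y ≤ 2 * g x1 := by
      have : d / 2 * g y ≤ d / 2 * (2 * g x1) := by linarith
      exact le_of_mul_le_mul_left this (by positivity)
    rw [le_div_iff₀ hrp]; nlinarith
  have hDy : ∀ y ∈ ball x1 r, ‖fderiv ℝ φ y‖ ≤ 2 / r := fun y hy =>
    le_trans (le_add_of_nonneg_right (by positivity)) (hgy y hy)
  have hHy : ∀ y ∈ ball x1 r, ‖hess φ y‖ ≤ 4 / r ^ 2 := fun y hy => by
    have h1 : √‖hess φ y‖ ≤ 2 / r := le_trans (le_add_of_nonneg_left (by positivity)) (hgy y hy)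
    rw [Real.sqrt_le_left (by positivity)] at h1
    refine h1.trans (le_of_eq ?_); rw [div_pow]; norm_num
  have hsub1 : ball x1 r ⊆ ball x0 r0 := fun y hy => by
    rw [mem_ball, dist_eq_norm] at hy
    exact (inb y (by linarith)).1
  have hZ := hC κ φ α h P x1 r hrp (by linarith) (hsub1.trans hsub)
    (le_trans (by gcongr; linarith) hrk) hDy hHy
  have hτ1 : τ * r < r := by nlinarith
  have hx1b : x1 ∈ ball x0 r0 := (inb x1 (by simp; positivity)).1
  have osc' : ∀ x, ‖x - x1‖ ≤ τ * r → |φ x - φ x1| ≤ τ ^ 2 / 64 := fun x hx =>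
    hosc x (inb x (by linarith)).1 x1 hx1b
  have I1 := interp_hess P.cd (l := τ * r) (ε := τ ^ 2 / 64) (D := C * t / r ^ 2) (x1 := x1) (by positivity)
    (by positivity) (by positivity) osc' (fun x hx => by
      refine (hZ x (hx.trans ?_)).trans ?_
      · calc τ * r ≤ (1 / (16 * Λ ^ 2)) * r := by gcongr; linarith
          _ = _ := by ring
      · have : (‖x - x1‖ / r) ^ (1/3:ℝ) ≤ t := by
          rw [← ert]
          gcongr
          rwa [div_le_iff₀ hrp]
        calc _ ≤ C / r ^ 2 * t := by gcongr
          _ = _ := by ring)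
  have I2 := interp_grad P.cd (l := τ * r) (ε := τ ^ 2 / 64) (D := 4 / r ^ 2) (x1 := x1) (by positivity)
    (by positivity) (by positivity) osc' (fun x hx => hHy x (by
      rw [mem_ball, dist_eq_norm]; linarith))
  have J1 : √‖hess φ x1‖ ≤ 1 / 4 / r := by
    rw [Real.sqrt_le_left (by positivity)]
    refine I1.trans ?_
    have : 2 * (τ ^ 2 / 64) / (τ * r) ^ 2 + C * t / r ^ 2 = (1/32 + C * t) / r ^ 2 := by field_simp; ring
    rw [this, div_pow]
    gcongr
    linarith
  have J2 : ‖fderiv ℝ φ x1‖ ≤ 1 / 4 / r := by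
    refine I2.trans ?_
    have : τ ^ 2 / 64 / (τ * r) + 4 / r ^ 2 * (τ * r) = (τ / 64 + 4 * τ) / r := by field_simp
    rw [this]
    gcongr
    linarith
  have : g x1 ≤ 1 / 2 / r := by
    calc g x1 ≤ 1 / 4 / r + 1 / 4 / r := add_le_add J2 J1
      _ = _ := by ring
  rw [le_div_iff₀ hrp] at this
  linarith

lemma pw_final (n : ℕ) (hn : 0 < n) (Λ K : ℝ) (hΛ : 1 ≤ Λ) (hK : 1 ≤ K) : ∃ C, 1 ≤ C ∧
    ∀ (κ : ℝ) (φ : EuS n → ℝ) (α : EuS n → Fin n → Fin n → ℝ) (h : EuS n → ℝ), 1 ≤ κ →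
    PW n Λ K κ φ α h →
    (∀ x ∈ ball (0 : EuS n) (1/2), ‖fderiv ℝ φ x‖ ≤ rexp (C * κ) ∧ ‖hess φ x‖ ≤ rexp (C * κ)) ∧
    ∀ x ∈ ball (0 : EuS n) (1/2), ∀ y ∈ ball (0 : EuS n) (1/2),
      ‖hess φ x - hess φ y‖ ≤ rexp (C * κ) * ‖x - y‖ ^ (1/3:ℝ) := by
  obtain ⟨CZ, hCZ0, hCZ⟩ := lemmaZ n hn Λ K hΛ hK
  obtain ⟨ε0, hε0, hPP⟩ := point_pick n hn Λ K hΛ hK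
  obtain ⟨C1, hC1, hosc⟩ := osc_decay n hn Λ K ε0 hΛ hK hε0
  have hΛ2 : 1 ≤ Λ ^ 2 := one_le_pow₀ hΛ
  set Q := CZ + 128 * Λ ^ 2 with hQ
  refine ⟨64 * Q + 6 * C1, by linarith, ?_⟩
  intro κ φ α h hκ P
  obtain ⟨r0, hr0⟩ : ∃ r0, r0 = rexp (-(2 * C1) * κ) := ⟨_, rfl⟩
  have hC1κ : 1 ≤ C1 * κ := by nlinarith
  have hr0p : 0 < r0 := by rw [hr0]; positivity
  have hr04 : r0 < 1 / 4 := by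
    have h1 : r0 ≤ rexp (-2) := by rw [hr0]; apply Real.exp_le_exp.mpr; linarith
    have h2 : rexp (-2) < 1 / 4 := by
      rw [Real.exp_neg, inv_eq_one_div]
      apply one_div_lt_one_div_of_lt (by norm_num)
      have : rexp 2 = rexp 1 * rexp 1 := by rw [← Real.exp_add]; norm_num
      rw [this]
      nlinarith [Real.exp_one_gt_d9]
    linarith
  have hr0k : r0 ^ 2 * rexp κ ≤ 1 := by
    rw [hr0, ← Real.exp_nat_mul, ← Real.exp_add, Real.exp_le_one_iff]
    push_cast
    nlinarith
  obtain ⟨r, hr⟩ : ∃ r, r = r0 / 4 := ⟨_, rfl⟩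
  have hrp : 0 < r := by rw [hr]; positivity
  have hr1 : r ≤ 1 := by linarith
  have hfin : Q / r ^ 3 ≤ rexp ((64 * Q + 6 * C1) * κ) := by
    have e1 : Q / r ^ 3 = 64 * Q * rexp (6 * C1 * κ) := by
      have : rexp (6 * C1 * κ) = 1 / r0 ^ 3 := by
        rw [hr0, ← Real.exp_nat_mul, one_div, ← Real.exp_neg]; congr 1; push_cast; ring
      rw [this, hr]; field_simp; norm_num
    have hQ0 : 0 ≤ 64 * Q := by positivity
    have e2 : 64 * Q ≤ rexp (64 * Q * κ) := by
      have := Real.add_one_le_exp (64 * Q * κ)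
      nlinarith
    rw [e1, add_mul, Real.exp_add]
    gcongr
  have base : ∀ x0 ∈ ball (0 : EuS n) (1/2), ∀ x ∈ ball x0 (2 * r), ‖fderiv ℝ φ x‖ + √‖hess φ x‖ ≤ 2 / r := by
    intro x0 hx0 x hx
    rw [mem_ball, dist_zero_right] at hx0
    have hsub : ∀ s, s ≤ 1/4 → ball x0 s ⊆ ball (0 : EuS n) (3/4) := by
      intro s hs y hy
      rw [mem_ball, dist_eq_norm] at hy
      rw [mem_ball, dist_zero_right]
      have : y = (y - x0) + x0 := by abel
      rw [this]
      exact (norm_add_le _ _).trans_lt (by linarith)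
    have hS := hsub (1/4) le_rfl
    have ho := hosc φ x0 κ hκ P.cd (fun x hx => P.rng x (hS hx)) (fun x hx =>
      ⟨α x, P.ell x (hS hx), by rw [P.eq x (hS hx)]; exact P.hb x (hS hx)⟩)
    have hle : r0 ≤ rexp (-C1 * κ) := by rw [hr0]; apply Real.exp_le_exp.mpr; linarith
    have hp := hPP κ φ α h P x0 r0 hr0p (by linarith) (hsub r0 hr04.le) hr0k
      (fun x hx y hy => ho x (ball_subset_ball hle hx) y (ball_subset_ball hle hy)) x
      (ball_subset_ball (by linarith) hx)
    rw [mem_ball, dist_eq_norm] at hx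
    rw [le_div_iff₀ hrp]
    have hg : 0 ≤ ‖fderiv ℝ φ x‖ + √‖hess φ x‖ := by positivity
    have : 2 * r * (‖fderiv ℝ φ x‖ + √‖hess φ x‖) ≤ 4 :=
      (mul_le_mul_of_nonneg_right (by linarith) hg).trans hp
    linarith
  have bD : ∀ x0 ∈ ball (0 : EuS n) (1/2), ∀ x ∈ ball x0 (2 * r), ‖fderiv ℝ φ x‖ ≤ 2 / r :=
    fun x0 h0 y hy => le_trans (le_add_of_nonneg_right (by positivity)) (base x0 h0 y hy)
  have bH : ∀ x0 ∈ ball (0 : EuS n) (1/2), ∀ x ∈ ball x0 (2 * r), ‖hess φ x‖ ≤ 4 / r ^ 2 := by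
    intro x0 h0 y hy
    have h1 : √‖hess φ y‖ ≤ 2 / r := le_trans (le_add_of_nonneg_left (by positivity)) (base x0 h0 y hy)
    rw [Real.sqrt_le_left (by positivity)] at h1
    refine h1.trans (le_of_eq ?_); rw [div_pow]; norm_num
  have hr3 : r ^ 3 ≤ r := pow_le_of_le_one hrp.le hr1 (by norm_num)
  have hr32 : r ^ 3 ≤ r ^ 2 := pow_le_pow_of_le_one hrp.le hr1 (by norm_num)
  have c1 : 2 / r ≤ Q / r ^ 3 := div_le_div₀ (by positivity) (by linarith) (by positivity) hr3
  have c2 : 4 / r ^ 2 ≤ Q / r ^ 3 := div_le_div₀ (by positivity) (by linarith) (by positivity) hr32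
  refine ⟨fun x hx => ⟨?_, ?_⟩, fun x hx y hy => ?_⟩
  · exact ((bD x hx x (mem_ball_self (by positivity))).trans c1).trans hfin
  · exact ((bH x hx x (mem_ball_self (by positivity))).trans c2).trans hfin
  have hpos : 0 ≤ ‖x - y‖ ^ (1/3:ℝ) := by positivity
  refine le_trans ?_ (mul_le_mul_of_nonneg_right hfin hpos)
  rcases le_or_gt ‖x - y‖ (r / (16 * Λ ^ 2)) with hc | hc
  · have hsb : ball y r ⊆ ball y (2 * r) := ball_subset_ball (by linarith)
    have := hCZ κ φ α h P y r hrp hr1 (by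
      intro z hz
      rw [mem_ball, dist_eq_norm] at hz
      rw [mem_ball, dist_zero_right] at hy ⊢
      have : z = (z - y) + y := by abel
      rw [this]
      exact (norm_add_le _ _).trans_lt (by linarith))
      (le_trans (by gcongr; linarith) hr0k) (fun z hz => bD y hy z (hsb hz)) (fun z hz => bH y hy z (hsb hz)) x hc
    refine this.trans ?_
    rw [Real.div_rpow (norm_nonneg _) hrp.le]
    have h1 : r ≤ r ^ (1/3:ℝ) := by
      calc r = r ^ (1:ℝ) := by rw [Real.rpow_one]
        _ ≤ _ := Real.rpow_le_rpow_of_exponent_ge hrp hr1 (by norm_num)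
    calc CZ / r ^ 2 * (‖x - y‖ ^ (1/3:ℝ) / r ^ (1/3:ℝ)) ≤ Q / r ^ 2 * (‖x - y‖ ^ (1/3:ℝ) / r) := by
          gcongr
          rw [hQ]; nlinarith
      _ = _ := by field_simp
  · have h1 := bH x hx x (mem_ball_self (by positivity))
    have h2 := bH y hy y (mem_ball_self (by positivity))
    have h3 : ‖hess φ x - hess φ y‖ ≤ 8 / r ^ 2 := by
      refine ContinuousLinearMap.opNorm_le_bound₂ _ (by positivity) fun a b => ?_
      rw [_root_.sub_apply, _root_.sub_apply]
      have i1 := (ContinuousLinearMap.le_opNorm₂ (hess φ x) a b)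
      have i2 := (ContinuousLinearMap.le_opNorm₂ (hess φ y) a b)
      have j1 : ‖hess φ x‖ * ‖a‖ * ‖b‖ ≤ 4 / r ^ 2 * ‖a‖ * ‖b‖ := by gcongr
      have j2 : ‖hess φ y‖ * ‖a‖ * ‖b‖ ≤ 4 / r ^ 2 * ‖a‖ * ‖b‖ := by gcongr
      calc _ ≤ ‖hess φ x a b‖ + ‖hess φ y a b‖ := norm_sub_le _ _
        _ ≤ 4 / r ^ 2 * ‖a‖ * ‖b‖ + 4 / r ^ 2 * ‖a‖ * ‖b‖ := add_le_add (i1.trans j1) (i2.trans j2)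
        _ = _ := by ring
    refine h3.trans ?_
    have h4 : r / (16 * Λ ^ 2) ≤ ‖x - y‖ ^ (1/3:ℝ) := by
      have hle1 : r / (16 * Λ ^ 2) ≤ 1 := by rw [div_le_one (by positivity)]; nlinarith
      calc r / (16 * Λ ^ 2) = (r / (16 * Λ ^ 2)) ^ (1:ℝ) := by rw [Real.rpow_one]
        _ ≤ (r / (16 * Λ ^ 2)) ^ (1/3:ℝ) := Real.rpow_le_rpow_of_exponent_ge (by positivity) hle1 (by norm_num)
        _ ≤ _ := by gcongr
    calc 8 / r ^ 2 = (128 * Λ ^ 2) / r ^ 3 * (r / (16 * Λ ^ 2)) := by field_simp; norm_num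
      _ ≤ Q / r ^ 3 * ‖x - y‖ ^ (1/3:ℝ) := by gcongr; linarith

lemma int_cs {n : ℕ} {U : Set (EuS n)} (hU : IsOpen U) {f g : EuS n → ℝ} (hf : ContinuousOn f U)
    (hg : Continuous g) (hc : HasCompactSupport g) (hs : tsupport g ⊆ U) :
    Integrable (fun x => f x * g x) := by
  have hcont : Continuous (fun x => f x * g x) := by
    apply continuous_of_tsupport
    intro x hx
    have hxU := hs (tsupport_mul_subset_right hx)
    exact (hf.continuousAt (hU.mem_nhds hxU)).mul hg.continuousAt
  exact hcont.integrable_of_hasCompactSupport hc.mul_left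

lemma weak_pt {n : ℕ} {U : Set (EuS n)} (hU : IsOpen U) {V : Fin n → EuS n → ℝ} {G : EuS n → ℝ}
    (hV : ∀ j, ContDiffOn ℝ 1 (V j) U) (hG : ContinuousOn G U)
    (hw : ∀ ψ : EuS n → ℝ, ContDiff ℝ (⊤ : ℕ∞) ψ → HasCompactSupport ψ → tsupport ψ ⊆ U →
      ∫ x in U, ∑ j, V j x * fderiv ℝ ψ x (ee j) = ∫ x in U, G x * ψ x) :
    ∀ x ∈ U, ∑ j, fderiv ℝ (V j) x (ee j) + G x = 0 := by
  have hVd : ∀ j, ContinuousOn (fun x => fderiv ℝ (V j) x (ee j)) U := fun j =>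
    ((hV j).continuousOn_fderiv_of_isOpen hU le_rfl).clm_apply continuousOn_const
  set f : EuS n → ℝ := fun x => ∑ j, fderiv ℝ (V j) x (ee j) + G x with hf
  have hfc : ContinuousOn f U := (continuousOn_finsetSum _ fun j _ => hVd j).add hG
  have hae : ∀ᵐ x ∂(volume : Measure (EuS n)), x ∈ U → f x = 0 := by
    refine hU.ae_eq_zero_of_integral_contDiff_smul_eq_zero
      (hfc.locallyIntegrableOn hU.measurableSet) ?_
    intro ψ hψ hψc hψs
    have hψd : Continuous ψ := hψ.continuous
    have hψ1 : ContDiff ℝ 1 ψ := hψ.of_le (by exact_mod_cast le_top)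
    have hψf : ∀ j, Continuous fun x => fderiv ℝ ψ x (ee j) := fun j =>
      (hψ1.continuous_fderiv one_ne_zero).clm_apply continuous_const
    have hsub : ∀ j : Fin n, tsupport (fun x => fderiv ℝ ψ x (ee j)) ⊆ tsupport ψ := by
      intro j
      refine (closure_mono ?_).trans (tsupport_fderiv_subset ℝ (f := ψ))
      intro x hx h0
      exact hx (by simp [h0])
    have hcd : ∀ j : Fin n, HasCompactSupport (fun x => fderiv ℝ ψ x (ee j)) := fun j =>
      hψc.of_isClosed_subset (isClosed_tsupport _) (hsub j)
    have I1 : ∀ j, Integrable (fun x => V j x * fderiv ℝ ψ x (ee j)) := fun j =>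
      int_cs hU (hV j).continuousOn (hψf j) (hcd j) ((hsub j).trans hψs)
    have I2 : ∀ j, Integrable (fun x => fderiv ℝ (V j) x (ee j) * ψ x) := fun j =>
      int_cs hU (hVd j) hψd hψc hψs
    have I3 : ∀ j, Integrable (fun x => V j x * ψ x) := fun j =>
      int_cs hU (hV j).continuousOn hψd hψc hψs
    have I4 : Integrable (fun x => G x * ψ x) := int_cs hU hG hψd hψc hψs
    have ibp : ∀ j, ∫ x, V j x * fderiv ℝ ψ x (ee j) = -∫ x, fderiv ℝ (V j) x (ee j) * ψ x := fun j =>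
      integral_mul_fderiv_eq_neg_fderiv_mul_of_integrable (I2 j) (I1 j) (I3 j)
        (fun x hx => ((hV j).contDiffAt (hU.mem_nhds (hψs hx))).differentiableAt (by norm_num))
        (fun x _ => hψ1.differentiable (by norm_num) x)
    have h1 := hw ψ hψ hψc hψs
    have z0 : ∀ x ∉ U, ψ x = 0 := fun x hx => image_eq_zero_of_notMem_tsupport fun h => hx (hψs h)
    have z1 : ∀ x ∉ U, ∀ j, fderiv ℝ ψ x (ee j) = 0 := fun x hx j =>
      image_eq_zero_of_notMem_tsupport (f := fun x => fderiv ℝ ψ x (ee j)) fun h => hx (hψs (hsub j h))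
    rw [setIntegral_eq_integral_of_forall_compl_eq_zero (fun x hx => by simp [z1 x hx]),
      setIntegral_eq_integral_of_forall_compl_eq_zero (fun x hx => by simp [z0 x hx]),
      integral_finsetSum _ (fun j _ => I1 j)] at h1
    have e : (fun x => ψ x • f x) = fun x => ∑ j, fderiv ℝ (V j) x (ee j) * ψ x + G x * ψ x := by
      ext x; simp only [hf, smul_eq_mul, mul_add, Finset.mul_sum]
      congr 1
      · exact Finset.sum_congr rfl fun j _ => mul_comm _ _
      · exact mul_comm _ _
    rw [e, integral_add (integrable_finsetSum _ fun j _ => I2 j) I4,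
      integral_finsetSum _ (fun j _ => I2 j), ← h1, ← Finset.sum_add_distrib]
    exact Finset.sum_eq_zero fun j _ => by rw [ibp j]; ring
  have := Measure.eqOn_open_of_ae_eq (μ := volume) (f := f) (g := fun _ => 0)
    ((ae_restrict_iff' hU.measurableSet).mpr hae) hU hfc continuousOn_const
  exact fun x hx => this hx

section slices
variable {E : Type*} [NormedAddCommGroup E] [NormedSpace ℝ E]

lemma unif_open {U : Set E} (hU : IsOpen U) : IsOpen (U ×ˢ (univ : Set ℝ)) := hU.prod isOpen_univ

lemma slice_diffAt {U : Set E} (hU : IsOpen U) {g : E → ℝ → ℝ}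
    (hg : ContDiffOn ℝ 1 (fun p : E × ℝ => g p.1 p.2) (U ×ˢ univ)) {x : E} (hx : x ∈ U) (z : ℝ) :
    HasFDerivAt (fun p : E × ℝ => g p.1 p.2) (fderiv ℝ (fun p : E × ℝ => g p.1 p.2) (x, z)) (x, z) := by
  have : DifferentiableAt ℝ (fun p : E × ℝ => g p.1 p.2) (x, z) :=
    (hg.differentiableOn one_ne_zero).differentiableAt
      ((unif_open hU).mem_nhds ⟨hx, mem_univ _⟩)
  exact this.hasFDerivAt

lemma slice_x {U : Set E} (hU : IsOpen U) {g : E → ℝ → ℝ}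
    (hg : ContDiffOn ℝ 1 (fun p : E × ℝ => g p.1 p.2) (U ×ˢ univ)) {x : E} (hx : x ∈ U) (z : ℝ) :
    HasFDerivAt (fun y => g y z) ((fderiv ℝ (fun p : E × ℝ => g p.1 p.2) (x, z)).comp
      (ContinuousLinearMap.inl ℝ E ℝ)) x := by
  have h1 := slice_diffAt hU hg hx z
  have h2 : HasFDerivAt (fun y : E => (y, z)) (ContinuousLinearMap.inl ℝ E ℝ) x :=
    hasFDerivAt_prodMk_left x z
  exact HasFDerivAt.comp x h1 h2

lemma slice_z {U : Set E} (hU : IsOpen U) {g : E → ℝ → ℝ}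
    (hg : ContDiffOn ℝ 1 (fun p : E × ℝ => g p.1 p.2) (U ×ˢ univ)) {x : E} (hx : x ∈ U) (z : ℝ) :
    HasDerivAt (fun w => g x w) (fderiv ℝ (fun p : E × ℝ => g p.1 p.2) (x, z) (0, 1)) z := by
  have h1 := slice_diffAt hU hg hx z
  have h2 : HasFDerivAt (fun w : ℝ => (x, w)) (ContinuousLinearMap.inr ℝ E ℝ) z :=
    hasFDerivAt_prodMk_right x z
  have h3 := (HasFDerivAt.comp z h1 h2).hasDerivAt
  have e : (fderiv ℝ (fun p : E × ℝ => g p.1 p.2) (x, z) ∘SL ContinuousLinearMap.inr ℝ E ℝ) 1 =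
      fderiv ℝ (fun p : E × ℝ => g p.1 p.2) (x, z) (0, 1) := by simp
  exact e ▸ h3

lemma sep_lip {U : Set E} (hc : Convex ℝ U) {g : E → ℝ → ℝ} {L : ℝ}
    (h1 : ∀ x ∈ U, ∀ z, DifferentiableAt ℝ (fun y => g y z) x)
    (h2 : ∀ x ∈ U, ∀ z, DifferentiableAt ℝ (fun w => g x w) z)
    (b1 : ∀ x ∈ U, ∀ z, ‖fderiv ℝ (fun y => g y z) x‖ ≤ L)
    (b2 : ∀ x ∈ U, ∀ z, |deriv (fun w => g x w) z| ≤ L)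
    {x y : E} (hx : x ∈ U) (hy : y ∈ U) (z w : ℝ) :
    |g x z - g y w| ≤ L * (‖x - y‖ + |z - w|) := by
  have e1 : ‖g x z - g y z‖ ≤ L * ‖x - y‖ :=
    hc.norm_image_sub_le_of_norm_fderiv_le (𝕜 := ℝ) (f := fun y => g y z)
      (fun u hu => h1 u hu z) (fun u hu => b1 u hu z) hy hx
  have e2 : ‖g y z - g y w‖ ≤ L * ‖z - w‖ :=
    (convex_univ (E := ℝ) (𝕜 := ℝ)).norm_image_sub_le_of_norm_deriv_le (f := fun w => g y w)
      (fun u _ => h2 y hy u) (fun u _ => b2 y hy u) (mem_univ w) (mem_univ z)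
  rw [Real.norm_eq_abs] at e1 e2
  rw [Real.norm_eq_abs] at e2
  have : |g x z - g y w| ≤ |g x z - g y z| + |g y z - g y w| := by
    simpa using abs_sub_le (g x z) (g y z) (g y w)
  linarith

lemma c1_lip {U : Set E} (hU : IsOpen U) (hc : Convex ℝ U) {g : E → ℝ → ℝ} {L : ℝ}
    (hg : ContDiffOn ℝ 1 (fun p : E × ℝ => g p.1 p.2) (U ×ˢ univ))
    (hL : 0 ≤ L)
    (hb : ∀ x ∈ U, ∀ z, ‖fderiv ℝ (fun p : E × ℝ => g p.1 p.2) (x, z)‖ ≤ L)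
    {x y : E} (hx : x ∈ U) (hy : y ∈ U) (z w : ℝ) :
    |g x z - g y w| ≤ L * (‖x - y‖ + |z - w|) := by
  have hcc : Convex ℝ (U ×ˢ (univ : Set ℝ)) := hc.prod convex_univ
  have e := hcc.norm_image_sub_le_of_norm_fderiv_le (𝕜 := ℝ) (f := fun p : E × ℝ => g p.1 p.2)
    (C := L) (x := (y, w)) (y := (x, z))
    (fun u hu => (slice_diffAt hU hg hu.1 u.2).differentiableAt) (fun u hu => hb u.1 hu.1 u.2)
    ⟨hy, mem_univ _⟩ ⟨hx, mem_univ _⟩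
  refine (show |g x z - g y w| ≤ _ from e).trans ?_
  apply mul_le_mul_of_nonneg_left _ hL
  rw [Prod.norm_def]
  simp only [Prod.fst_sub, Prod.snd_sub, Real.norm_eq_abs]
  exact max_le (by linarith [abs_nonneg (z - w)]) (by linarith [norm_nonneg (x - y)])

/-- The `z`-derivative is jointly `C¹`. -/
lemma Q_c1 {U : Set E} (hU : IsOpen U) {g : E → ℝ → ℝ}
    (hg : ContDiffOn ℝ 2 (fun p : E × ℝ => g p.1 p.2) (U ×ˢ univ)) :
    ContDiffOn ℝ 1 (fun p : E × ℝ => deriv (fun w => g p.1 w) p.2) (U ×ˢ univ) := by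
  have h1 : ContDiffOn ℝ 1 (fderiv ℝ (fun p : E × ℝ => g p.1 p.2)) (U ×ˢ univ) :=
    hg.fderiv_of_isOpen (unif_open hU) (by norm_num)
  refine (h1.clm_apply contDiffOn_const (g := fun _ => ((0 : E), (1 : ℝ)))).congr ?_
  intro p hp
  exact (slice_z hU (hg.of_le (by norm_num)) hp.1 p.2).deriv

lemma Q_lip {U : Set E} (hU : IsOpen U) (hc : Convex ℝ U) {g : E → ℝ → ℝ} {L : ℝ}
    (hg : ContDiffOn ℝ 2 (fun p : E × ℝ => g p.1 p.2) (U ×ˢ univ))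
    (hb : ∀ x ∈ U, ∀ z : ℝ, ‖fderiv ℝ (fun y => fderiv ℝ (fun y' => g y' z) y) x‖ +
        ‖fderiv ℝ (fun y => deriv (fun w => g y w) z) x‖ +
        |deriv (fun w => deriv (fun w' => g x w') w) z| ≤ L)
    {x y : E} (hx : x ∈ U) (hy : y ∈ U) (z w : ℝ) :
    |deriv (fun w => g x w) z - deriv (fun w => g y w) w| ≤ L * (‖x - y‖ + |z - w|) := by
  have hq := Q_c1 hU hg
  refine sep_lip (g := fun x z => deriv (fun w => g x w) z) hc ?_ ?_ ?_ ?_ hx hy z w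
  · intro x hx z
    exact (slice_x hU (g := fun x z => deriv (fun w => g x w) z) hq hx z).differentiableAt
  · intro x hx z
    exact (slice_z hU (g := fun x z => deriv (fun w => g x w) z) hq hx z).differentiableAt
  · intro x hx z
    have := hb x hx z
    have := norm_nonneg (fderiv ℝ (fun y => fderiv ℝ (fun y' => g y' z) y) x)
    have := abs_nonneg (deriv (fun w => deriv (fun w' => g x w') w) z)
    linarith
  · intro x hx z
    have := hb x hx z
    have := norm_nonneg (fderiv ℝ (fun y => fderiv ℝ (fun y' => g y' z) y) x)
    have := norm_nonneg (fderiv ℝ (fun y => deriv (fun w => g y w) z) x)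
    linarith

lemma P_lip {U : Set E} (hU : IsOpen U) (hc : Convex ℝ U) {g : E → ℝ → ℝ} {L : ℝ}
    (hg : ContDiffOn ℝ 2 (fun p : E × ℝ => g p.1 p.2) (U ×ˢ univ))
    (hb : ∀ x ∈ U, ∀ z : ℝ, ‖fderiv ℝ (fun y => fderiv ℝ (fun y' => g y' z) y) x‖ +
        ‖fderiv ℝ (fun y => deriv (fun w => g y w) z) x‖ +
        |deriv (fun w => deriv (fun w' => g x w') w) z| ≤ L) (hL : 0 ≤ L)
    {x y : E} (hx : x ∈ U) (hy : y ∈ U) (z w : ℝ) :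
    ‖fderiv ℝ (fun u => g u z) x - fderiv ℝ (fun u => g u w) y‖ ≤ L * (‖x - y‖ + |z - w|) := by
  have hg1 : ContDiffOn ℝ 1 (fun p : E × ℝ => g p.1 p.2) (U ×ˢ univ) := hg.of_le (by norm_num)
  have e1 : ‖fderiv ℝ (fun u => g u z) x - fderiv ℝ (fun u => g u z) y‖ ≤ L * ‖x - y‖ := by
    have hs : ContDiffOn ℝ 2 (fun u => g u z) U := by
      have : ContDiffOn ℝ 2 (fun u : E => (u, z)) U := contDiffOn_id.prodMk contDiffOn_const
      exact ContDiffOn.comp (g := fun p : E × ℝ => g p.1 p.2) hg this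
        (fun u hu => ⟨hu, mem_univ _⟩)
    have hs1 : ContDiffOn ℝ 1 (fderiv ℝ (fun u => g u z)) U :=
      hs.fderiv_of_isOpen hU (by norm_num)
    refine hc.norm_image_sub_le_of_norm_fderiv_le (𝕜 := ℝ) (f := fderiv ℝ (fun u => g u z))
      (fun u hu => (hs1.differentiableOn one_ne_zero).differentiableAt (hU.mem_nhds hu))
      (fun u hu => ?_) hy hx
    have h0 := hb u hu z
    have := norm_nonneg (fderiv ℝ (fun y => deriv (fun w => g y w) z) u)
    have := abs_nonneg (deriv (fun w => deriv (fun w' => g u w') w) z)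
    linarith
  have e2 : ‖fderiv ℝ (fun u => g u z) y - fderiv ℝ (fun u => g u w) y‖ ≤ L * |z - w| := by
    have hd : ∀ v : ℝ, DifferentiableAt ℝ (fun u => g u v) y :=
      fun v => (slice_x hU hg1 hy v).differentiableAt
    rw [← fderiv_sub (hd z) (hd w)]
    apply norm_fderiv_le_of_lip' ℝ (by positivity)
    filter_upwards [hU.mem_nhds hy] with u hu
    have := (convex_univ (E := ℝ) (𝕜 := ℝ)).norm_image_sub_le_of_norm_deriv_le
      (f := fun w => g u w - g y w) (C := L * ‖u - y‖) (x := w) (y := z)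
      (fun v _ => (slice_z hU hg1 hu v).differentiableAt.sub
        (slice_z hU hg1 hy v).differentiableAt) ?_ (mem_univ _) (mem_univ _)
    · rw [Real.norm_eq_abs (z - w)] at this
      have e : (fun u => g u z) u - (fun u => g u z) y = g u z - g y z := rfl
      calc _ = ‖g u z - g y z - (g u w - g y w)‖ := by
            congr 1; simp only [Pi.sub_apply]; ring
        _ ≤ L * ‖u - y‖ * |z - w| := this
        _ = _ := by ring
    · intro v _
      rw [deriv_fun_sub (slice_z hU hg1 hu v).differentiableAt
        (slice_z hU hg1 hy v).differentiableAt]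
      have := Q_lip hU hc hg hb hu hy v v
      simpa using this
  calc _ ≤ ‖fderiv ℝ (fun u => g u z) x - fderiv ℝ (fun u => g u z) y‖ +
      ‖fderiv ℝ (fun u => g u z) y - fderiv ℝ (fun u => g u w) y‖ := norm_sub_le_norm_sub_add_norm_sub _ _ _
    _ ≤ _ := by linarith

/-- chain rule along the graph -/
lemma chain_graph {U : Set E} (hU : IsOpen U) {g : E → ℝ → ℝ} {φ : E → ℝ}
    (hg : ContDiffOn ℝ 1 (fun p : E × ℝ => g p.1 p.2) (U ×ˢ univ))
    (hφ : ContDiffOn ℝ 1 φ U) {x : E} (hx : x ∈ U) :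
    HasFDerivAt (fun y => g y (φ y)) (fderiv ℝ (fun y => g y (φ x)) x +
      deriv (fun w => g x w) (φ x) • fderiv ℝ φ x) x := by
  have h1 := slice_diffAt hU hg hx (φ x)
  have h2 : HasFDerivAt φ (fderiv ℝ φ x) x :=
    ((hφ.differentiableOn one_ne_zero).differentiableAt (hU.mem_nhds hx)).hasFDerivAt
  have h3 : HasFDerivAt (fun y => (y, φ y)) ((ContinuousLinearMap.id ℝ E).prod (fderiv ℝ φ x)) x :=
    (hasFDerivAt_id x).prodMk h2
  have h4 := HasFDerivAt.comp (g := fun p : E × ℝ => g p.1 p.2) (f := fun y => (y, φ y)) x h1 h3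
  refine HasFDerivAt.congr_fderiv (f := fun y => g y (φ y)) h4 ?_
  ext v
  rw [(slice_x hU hg hx (φ x)).fderiv, (slice_z hU hg hx (φ x)).deriv]
  simp only [ContinuousLinearMap.comp_apply, ContinuousLinearMap.prod_apply,
    ContinuousLinearMap.id_apply, _root_.add_apply, _root_.smul_apply,
    ContinuousLinearMap.inl_apply, smul_eq_mul]
  have : ((v, fderiv ℝ φ x v) : E × ℝ) = (v, 0) + fderiv ℝ φ x v • ((0 : E), (1 : ℝ)) := by
    ext <;> simp
  rw [this, map_add, map_smul]
  simp [mul_comm]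

lemma contDiffOn_graph {U : Set E} {g : E → ℝ → ℝ} {φ : E → ℝ}
    (hg : ContDiffOn ℝ 1 (fun p : E × ℝ => g p.1 p.2) (U ×ˢ univ))
    (hφ : ContDiffOn ℝ 1 φ U) : ContDiffOn ℝ 1 (fun y => g y (φ y)) U :=
  ContDiffOn.comp (g := fun p : E × ℝ => g p.1 p.2) hg (contDiffOn_id.prodMk hφ)
    (fun _ hu => ⟨hu, mem_univ _⟩)

end slices

/-- Values of all the coefficients at one point. -/
structure CData (n : ℕ) where
  P : Fin n → Fin n → ℝ
  Q : Fin n → Fin n → ℝ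
  c2 : Fin n → Fin n → ℝ
  c1 : Fin n → ℝ
  c0 : ℝ
  ρ : ℝ
  f : ℝ
  u : ℝ

/-- quadratic form in the gradient -/
noncomputable def qsum {n : ℕ} (A : Fin n → Fin n → ℝ) (p : EuS n →L[ℝ] ℝ) : ℝ :=
  ∑ i, ∑ j, A i j * (p (ee i) * p (ee j))

/-- linear form in the gradient -/
noncomputable def lsum {n : ℕ} (A : Fin n → ℝ) (p : EuS n →L[ℝ] ℝ) : ℝ :=
  ∑ i, A i * p (ee i)

/-- the bracket -/
noncomputable def CData.S {n : ℕ} (d : CData n) (p : EuS n →L[ℝ] ℝ) : ℝ :=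
  1 - (1/2) * d.f * Real.exp d.u + (qsum d.c2 p + lsum d.c1 p + d.c0)

/-- the right hand side -/
noncomputable def CData.hv {n : ℕ} (d : CData n) (p : EuS n →L[ℝ] ℝ) : ℝ :=
  -((∑ j, lsum (fun i => d.P i j) p) + qsum d.Q p + d.ρ * d.S p)

lemma comp_le {n : ℕ} (p : EuS n →L[ℝ] ℝ) (i : Fin n) : |p (ee i)| ≤ ‖p‖ := by
  have := p.le_opNorm (ee i)
  rwa [norm_ee, mul_one] at this

lemma abs_sum_le_card {n : ℕ} (g : Fin n → ℝ) (B : ℝ) (h : ∀ i, |g i| ≤ B) :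
    |∑ i, g i| ≤ n * B := by
  calc _ ≤ ∑ i, |g i| := Finset.abs_sum_le_sum_abs _ _
    _ ≤ ∑ _i : Fin n, B := Finset.sum_le_sum fun i _ => h i
    _ = _ := by simp

lemma qsum_le {n : ℕ} (A : Fin n → Fin n → ℝ) (p : EuS n →L[ℝ] ℝ) {B : ℝ}
    (hA : ∀ i j, |A i j| ≤ B) : |qsum A p| ≤ n ^ 2 * (B * ‖p‖ ^ 2) := by
  have : |qsum A p| ≤ n * (n * (B * ‖p‖ ^ 2)) := by
    refine abs_sum_le_card _ _ fun i => abs_sum_le_card _ _ fun j => ?_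
    rw [abs_mul, abs_mul, sq]
    have h1 := comp_le p i
    have h2 := comp_le p j
    have h3 := hA i j
    have := (abs_nonneg _).trans h3
    gcongr
  linarith [this]

lemma lsum_le {n : ℕ} (A : Fin n → ℝ) (p : EuS n →L[ℝ] ℝ) {B : ℝ}
    (hA : ∀ i, |A i| ≤ B) : |lsum A p| ≤ n * (B * ‖p‖) := by
  refine abs_sum_le_card _ _ fun i => ?_
  rw [abs_mul]
  have h1 := comp_le p i
  have h3 := hA i
  have := (abs_nonneg _).trans h3
  gcongr

lemma qsum_diff {n : ℕ} (A A' : Fin n → Fin n → ℝ) (p q : EuS n →L[ℝ] ℝ) {B t : ℝ}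
    (hA : ∀ i j, |A' i j| ≤ B) (hd : ∀ i j, |A i j - A' i j| ≤ B * t) :
    |qsum A p - qsum A' q| ≤ n ^ 2 * (B * (t * ‖p‖ ^ 2 + (‖p‖ + ‖q‖) * ‖p - q‖)) := by
  have : |qsum A p - qsum A' q| ≤ n * (n * (B * (t * ‖p‖ ^ 2 + (‖p‖ + ‖q‖) * ‖p - q‖))) := by
    unfold qsum
    rw [← Finset.sum_sub_distrib]
    refine abs_sum_le_card _ _ fun i => ?_
    rw [← Finset.sum_sub_distrib]
    refine abs_sum_le_card _ _ fun j => ?_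
    have h1 := comp_le p i
    have h2 := comp_le p j
    have h3 := comp_le q j
    have h4 := comp_le (p - q) i
    have h5 := comp_le (p - q) j
    rw [_root_.sub_apply] at h4 h5
    have e : A i j * (p (ee i) * p (ee j)) - A' i j * (q (ee i) * q (ee j)) =
      (A i j - A' i j) * (p (ee i) * p (ee j)) +
        A' i j * (p (ee i) * (p (ee j) - q (ee j)) + (p (ee i) - q (ee i)) * q (ee j)) := by ring
    have hB := (abs_nonneg _).trans (hA i j)
    have hBt := (abs_nonneg _).trans (hd i j)
    rw [e]
    calc _ ≤ |A i j - A' i j| * (|p (ee i)| * |p (ee j)|) +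
          |A' i j| * (|p (ee i)| * |p (ee j) - q (ee j)| + |p (ee i) - q (ee i)| * |q (ee j)|) := by
          refine (abs_add_le _ _).trans ?_
          rw [abs_mul, abs_mul, abs_mul (A' i j)]
          gcongr
          refine (abs_add_le _ _).trans ?_
          rw [abs_mul, abs_mul]
      _ ≤ (B * t) * (‖p‖ * ‖p‖) + B * (‖p‖ * ‖p - q‖ + ‖p - q‖ * ‖q‖) := by
          have a1 := hA i j
          have a2 := hd i j
          gcongr
      _ = _ := by ring
  linarith [this]

lemma lsum_diff {n : ℕ} (A A' : Fin n → ℝ) (p q : EuS n →L[ℝ] ℝ) {B t : ℝ}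
    (hA : ∀ i, |A' i| ≤ B) (hd : ∀ i, |A i - A' i| ≤ B * t) :
    |lsum A p - lsum A' q| ≤ n * (B * (t * ‖p‖ + ‖p - q‖)) := by
  unfold lsum
  rw [← Finset.sum_sub_distrib]
  refine abs_sum_le_card _ _ fun i => ?_
  have h1 := comp_le p i
  have h4 := comp_le (p - q) i
  rw [_root_.sub_apply] at h4
  have e : A i * p (ee i) - A' i * q (ee i) =
    (A i - A' i) * p (ee i) + A' i * (p (ee i) - q (ee i)) := by ring
  have hB := (abs_nonneg _).trans (hA i)
  have hBt := (abs_nonneg _).trans (hd i)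
  have a1 := hA i
  have a2 := hd i
  rw [e]
  calc _ ≤ |A i - A' i| * |p (ee i)| + |A' i| * |p (ee i) - q (ee i)| := by
        refine (abs_add_le _ _).trans ?_
        rw [abs_mul, abs_mul]
    _ ≤ (B * t) * ‖p‖ + B * ‖p - q‖ := by gcongr
    _ = _ := by ring

/-- size bounds on the coefficients -/
structure CData.Ok {n : ℕ} (d : CData n) (L κ : ℝ) : Prop where
  P : ∀ i j, |d.P i j| ≤ L
  Q : ∀ i j, |d.Q i j| ≤ L
  c2 : ∀ i j, |d.c2 i j| ≤ L
  c1 : ∀ i, |d.c1 i| ≤ L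
  ρ : |d.ρ| ≤ 2
  f : |d.f| ≤ 1
  u : d.u ≤ κ

/-- Lipschitz bounds on the coefficients -/
structure CData.Lip {n : ℕ} (d e : CData n) (L t s : ℝ) : Prop where
  P : ∀ i j, |d.P i j - e.P i j| ≤ L * t
  Q : ∀ i j, |d.Q i j - e.Q i j| ≤ L * t
  c2 : ∀ i j, |d.c2 i j - e.c2 i j| ≤ L * t
  c1 : ∀ i, |d.c1 i - e.c1 i| ≤ L * t
  c0 : |d.c0 - e.c0| ≤ L * t
  ρ : |d.ρ - e.ρ| ≤ L * t
  f : |d.f - e.f| ≤ L * s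

lemma exp_diff {a b κ : ℝ} (ha : a ≤ κ) (hb : b ≤ κ) : |exp a - exp b| ≤ exp κ * |a - b| := by
  have := (convex_Iic κ).norm_image_sub_le_of_norm_deriv_le (f := Real.exp) (C := exp κ)
    (x := b) (y := a) (fun x _ => Real.differentiableAt_exp) ?_ hb ha
  · simpa using this
  · intro x hx
    rw [Real.deriv_exp, Real.norm_eq_abs, abs_of_pos (exp_pos x)]
    exact exp_le_exp.mpr hx

lemma S_le {n : ℕ} {d : CData n} {L κ : ℝ} (hd : d.Ok L κ) (hκ : 0 ≤ κ) (p : EuS n →L[ℝ] ℝ)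
    (hF : |qsum d.c2 p + lsum d.c1 p + d.c0| ≤ ‖p‖ ^ 2 + 1) :
    |d.S p| ≤ 3 * (exp κ + ‖p‖ ^ 2) := by
  have h1 : 1 ≤ exp κ := by simpa using hκ
  have h2 : |d.f * exp d.u| ≤ 1 * exp κ := by
    rw [abs_mul, abs_of_pos (exp_pos _)]
    have := hd.f
    have := exp_le_exp.mpr hd.u
    gcongr
  have e : d.S p = 1 - (1/2) * (d.f * exp d.u) + (qsum d.c2 p + lsum d.c1 p + d.c0) := by
    unfold CData.S; ring
  rw [abs_le] at *
  have := sq_nonneg ‖p‖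
  rw [e]
  constructor <;> nlinarith [h2.1, h2.2, hF.1, hF.2]

lemma hv_le {n : ℕ} {d : CData n} {L κ : ℝ} (hd : d.Ok L κ) (hL : 1 ≤ L) (hκ : 0 ≤ κ)
    (p : EuS n →L[ℝ] ℝ)
    (hF : |qsum d.c2 p + lsum d.c1 p + d.c0| ≤ ‖p‖ ^ 2 + 1) :
    |d.hv p| ≤ 16 * (n ^ 2 + n + 1) * L * (‖p‖ ^ 2 + exp κ) := by
  have h1 : 1 ≤ exp κ := by simpa using hκ
  set G := exp κ + ‖p‖ ^ 2 with hG
  have hpG : ‖p‖ ≤ G := by nlinarith [sq_nonneg (‖p‖ - 1)]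
  have hp2G : ‖p‖ ^ 2 ≤ G := by linarith
  have hG0 : 0 ≤ G := le_trans (norm_nonneg p) hpG
  have a1 : |∑ j, lsum (fun i => d.P i j) p| ≤ n * (n * (L * ‖p‖)) :=
    abs_sum_le_card _ _ fun j => lsum_le _ p fun i => hd.P i j
  have a2 := qsum_le d.Q p hd.Q
  have a3 := S_le hd hκ p hF
  have a4 : |d.ρ * d.S p| ≤ 2 * (3 * G) := by
    rw [abs_mul]; have := hd.ρ; gcongr
  have e1 : (n:ℝ) * (n * (L * ‖p‖)) ≤ n ^ 2 * (L * G) := by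
    rw [sq, mul_assoc]; gcongr
  have e2 : (n:ℝ) ^ 2 * (L * ‖p‖ ^ 2) ≤ n ^ 2 * (L * G) := by gcongr
  have e3 : G ≤ L * G := by nlinarith
  have e4 : |d.hv p| ≤ |∑ j, lsum (fun i => d.P i j) p| + |qsum d.Q p| + |d.ρ * d.S p| := by
    unfold CData.hv; rw [abs_neg]; exact abs_add_three _ _ _
  have e5 : 0 ≤ (n:ℝ) ^ 2 * (L * G) := by positivity
  have e6 : 0 ≤ (n:ℝ) * (L * G) := by positivity
  rw [add_comm (‖p‖ ^ 2)]
  change _ ≤ 16 * (n ^ 2 + n + 1) * L * G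
  nlinarith

set_option maxHeartbeats 1000000 in
lemma hv_diff {n : ℕ} {d e : CData n} {L κ t s : ℝ} (hd : d.Ok L κ) (he : e.Ok L κ)
    (hl : d.Lip e L t s) (hL : 1 ≤ L) (hκ : 0 ≤ κ) (hs : 0 ≤ s) (ht : 0 ≤ t)
    (hts : t ≤ 2 * (s + |d.u - e.u|))
    (p q : EuS n →L[ℝ] ℝ)
    (hF : |qsum d.c2 p + lsum d.c1 p + d.c0| ≤ ‖p‖ ^ 2 + 1) :
    |d.hv p - e.hv q| ≤ 16 * (n ^ 2 + n + 1) * L *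
      ((exp κ + ‖p‖ ^ 2) * (s + |d.u - e.u|) + (1 + ‖p‖ + ‖q‖) * ‖p - q‖) := by
  have h1 : 1 ≤ exp κ := by simpa using hκ
  set G := exp κ + ‖p‖ ^ 2 with hG
  set δ := s + |d.u - e.u| with hδ
  set D := ‖p - q‖ with hD
  set W := 1 + ‖p‖ + ‖q‖ with hW
  have hδ0 : 0 ≤ δ := by positivity
  have hD0 : 0 ≤ D := norm_nonneg _
  have hW1 : 1 ≤ W := by rw [hW]; linarith [norm_nonneg p, norm_nonneg q]
  have hpG : ‖p‖ ≤ G := by nlinarith [sq_nonneg (‖p‖ - 1)]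
  have hp2G : ‖p‖ ^ 2 ≤ G := by linarith
  have hG1 : 1 ≤ G := by linarith [sq_nonneg ‖p‖]
  have hG0 : 0 ≤ G := by linarith
  have hpqW : ‖p‖ + ‖q‖ ≤ W := by linarith
  set X := G * δ + W * D with hX
  have hGδ : 0 ≤ G * δ := by positivity
  have hWD : 0 ≤ W * D := by positivity
  have hL0 : 0 ≤ L := by linarith
  -- building blocks
  have q1 : t * ‖p‖ ^ 2 + (‖p‖ + ‖q‖) * D ≤ 2 * X := by
    have : t * ‖p‖ ^ 2 ≤ (2 * δ) * G := by gcongr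
    have : (‖p‖ + ‖q‖) * D ≤ W * D := by gcongr
    linarith
  have l1 : t * ‖p‖ + D ≤ 2 * X := by
    have : t * ‖p‖ ≤ (2 * δ) * G := by gcongr
    have : D ≤ W * D := by nlinarith
    linarith
  have t1 : t ≤ 2 * X := by
    have : t * 1 ≤ (2 * δ) * G := by gcongr
    linarith
  have hX0 : 0 ≤ X := by positivity
  have bP : |(∑ j, lsum (fun i => d.P i j) p) - ∑ j, lsum (fun i => e.P i j) q| ≤
      n * (n * (L * (2 * X))) := by
    rw [← Finset.sum_sub_distrib]
    refine abs_sum_le_card _ _ fun j => ?_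
    refine (lsum_diff _ _ p q (fun i => he.P i j) (fun i => hl.P i j)).trans ?_
    gcongr
  have bQ : |qsum d.Q p - qsum e.Q q| ≤ n ^ 2 * (L * (2 * X)) :=
    (qsum_diff _ _ p q he.Q hl.Q).trans (by gcongr)
  have bc2 : |qsum d.c2 p - qsum e.c2 q| ≤ n ^ 2 * (L * (2 * X)) :=
    (qsum_diff _ _ p q he.c2 hl.c2).trans (by gcongr)
  have bc1 : |lsum d.c1 p - lsum e.c1 q| ≤ n * (L * (2 * X)) :=
    (lsum_diff _ _ p q he.c1 hl.c1).trans (by gcongr)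
  have bc0 : |d.c0 - e.c0| ≤ L * (2 * X) := hl.c0.trans (by gcongr)
  have bf : |d.f * exp d.u - e.f * exp e.u| ≤ L * X := by
    have e0 : d.f * exp d.u - e.f * exp e.u =
      (d.f - e.f) * exp d.u + e.f * (exp d.u - exp e.u) := by ring
    rw [e0]
    have i1 := hl.f
    have i2 := exp_diff hd.u he.u
    have i3 := exp_le_exp.mpr hd.u
    have i4 := he.f
    calc _ ≤ |d.f - e.f| * exp d.u + |e.f| * |exp d.u - exp e.u| := by
          refine (abs_add_le _ _).trans ?_
          rw [abs_mul, abs_mul, abs_of_pos (exp_pos d.u)]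
      _ ≤ (L * s) * exp κ + 1 * (exp κ * |d.u - e.u|) := by gcongr
      _ ≤ (L * s) * exp κ + L * (exp κ * |d.u - e.u|) := by gcongr
      _ = L * (exp κ * δ) := by rw [hδ]; ring
      _ ≤ L * X := by
          have : exp κ ≤ G := by linarith [sq_nonneg ‖p‖]
          have : exp κ * δ ≤ G * δ := by gcongr
          gcongr; linarith
  have bS : |d.S p - e.S q| ≤ 3 * (n ^ 2 + n + 1) * (L * X) := by
    have e0 : d.S p - e.S q = -(1/2) * (d.f * exp d.u - e.f * exp e.u) +
      (qsum d.c2 p - qsum e.c2 q) + (lsum d.c1 p - lsum e.c1 q) + (d.c0 - e.c0) := by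
      unfold CData.S; ring
    have u1 : 0 ≤ (n:ℝ) ^ 2 * (L * X) := by positivity
    have u2 : 0 ≤ (n:ℝ) * (L * X) := by positivity
    have u3 : 0 ≤ L * X := by positivity
    rw [e0]
    have v1 := abs_le.mp bc2
    have v2 := abs_le.mp bc1
    have v3 := abs_le.mp bc0
    have v4 := abs_le.mp bf
    rw [abs_le]
    clear bc2 bc1 bc0 bf bP bQ q1 l1 t1 hts hF e0
    constructor <;> linarith [v1.1, v1.2, v2.1, v2.2, v3.1, v3.2, v4.1, v4.2]
  have bρ : |d.ρ * d.S p - e.ρ * e.S q| ≤ 12 * (n ^ 2 + n + 1) * (L * X) := by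
    have e0 : d.ρ * d.S p - e.ρ * e.S q = (d.ρ - e.ρ) * d.S p + e.ρ * (d.S p - e.S q) := by ring
    have i1 := hl.ρ
    have i2 := he.ρ
    have i3 := S_le hd hκ p hF
    rw [e0]
    calc _ ≤ |d.ρ - e.ρ| * |d.S p| + |e.ρ| * |d.S p - e.S q| := by
          refine (abs_add_le _ _).trans ?_
          rw [abs_mul, abs_mul]
      _ ≤ (L * (2 * δ)) * (3 * G) + 2 * (3 * (n ^ 2 + n + 1) * (L * X)) := by
          have : |d.ρ - e.ρ| ≤ L * (2 * δ) := i1.trans (by gcongr)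
          gcongr
      _ ≤ _ := by
          have : L * (G * δ) ≤ L * X := by gcongr; linarith
          have u1 : 0 ≤ (n:ℝ) ^ 2 * (L * X) := by positivity
          have u2 : 0 ≤ (n:ℝ) * (L * X) := by positivity
          linarith
  have e0 : d.hv p - e.hv q =
      -(((∑ j, lsum (fun i => d.P i j) p) - ∑ j, lsum (fun i => e.P i j) q) +
      (qsum d.Q p - qsum e.Q q) + (d.ρ * d.S p - e.ρ * e.S q)) := by
    unfold CData.hv; ring
  rw [e0, abs_neg]
  refine (abs_add_three _ _ _).trans ?_
  have u2 : 0 ≤ (n:ℝ) * (L * X) := by positivity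
  have u3 : 0 ≤ L * X := by positivity
  linarith

lemma gradient_coord {n : ℕ} (φ : EuS n → ℝ) (x : EuS n) (i : Fin n) :
    gradient φ x i = fderiv ℝ φ x (ee i) := by
  have h := inner_gradient_left (𝕜 := ℝ) (f := φ) (x := x) (y := ee i)
  rw [← h, ee, EuclideanSpace.inner_single_right]
  simp

lemma norm_gradient_eq {n : ℕ} (φ : EuS n → ℝ) (x : EuS n) :
    ‖gradient φ x‖ = ‖fderiv ℝ φ x‖ := by
  unfold gradient; simp

/-- coefficient data at a point -/
noncomputable def cdat {n : ℕ} (a : Fin n → Fin n → EuS n → ℝ → ℝ) (ρ : EuS n → ℝ → ℝ)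
    (f : EuS n → ℝ) (c₂ : Fin n → Fin n → EuS n → ℝ → ℝ) (c₁ : Fin n → EuS n → ℝ → ℝ)
    (c₀ : EuS n → ℝ → ℝ) (φ : EuS n → ℝ) (x : EuS n) : CData n where
  P := fun i j => fderiv ℝ (fun y => a i j y (φ x)) x (ee j)
  Q := fun i j => deriv (fun w => a i j x w) (φ x)
  c2 := fun i j => c₂ i j x (φ x)
  c1 := fun i => c₁ i x (φ x)
  c0 := c₀ x (φ x)
  ρ := ρ x (φ x)
  f := f x
  u := φ x

lemma hasFDerivAt_flux {n : ℕ} {U : Set (EuS n)} (hU : IsOpen U)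
    {a : Fin n → EuS n → ℝ → ℝ}
    (ha : ∀ i, ContDiffOn ℝ 1 (fun p : EuS n × ℝ => a i p.1 p.2) (U ×ˢ univ))
    {φ : EuS n → ℝ} (hφ : ContDiffOn ℝ 2 φ U) {x : EuS n} (hx : x ∈ U) (v : EuS n) :
    fderiv ℝ (fun y => ∑ i, a i y (φ y) * fderiv ℝ φ y (ee i)) x v =
      ∑ i, ((fderiv ℝ (fun y => a i y (φ x)) x v + deriv (fun w => a i x w) (φ x) * fderiv ℝ φ x v) *
        fderiv ℝ φ x (ee i) + a i x (φ x) * hess φ x v (ee i)) := by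
  have hφ1 : ContDiffOn ℝ 1 φ U := hφ.of_le (by norm_num)
  have hd : ContDiffOn ℝ 1 (fderiv ℝ φ) U := hφ.fderiv_of_isOpen hU (by norm_num)
  have hh : HasFDerivAt (fderiv ℝ φ) (fderiv ℝ (fderiv ℝ φ) x) x :=
    ((hd.differentiableOn one_ne_zero).differentiableAt (hU.mem_nhds hx)).hasFDerivAt
  have h1 : ∀ i : Fin n, HasFDerivAt (fun y => fderiv ℝ φ y (ee i))
      ((fderiv ℝ (fderiv ℝ φ) x).flip (ee i)) x := fun i =>
    (hh.clm_apply (hasFDerivAt_const (ee i) x)).congr_fderiv (by ext w; simp)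
  have h2 := fun i => (chain_graph hU (ha i) hφ1 hx).mul (h1 i)
  have h3 : HasFDerivAt (fun y => ∑ i, a i y (φ y) * fderiv ℝ φ y (ee i)) _ x :=
    HasFDerivAt.fun_sum fun i (_ : i ∈ Finset.univ) => h2 i
  rw [h3.fderiv]
  simp only [_root_.sum_apply, _root_.add_apply, _root_.smul_apply, smul_eq_mul,
    ContinuousLinearMap.flip_apply]
  refine Finset.sum_congr rfl fun i _ => ?_
  unfold hess
  ring

lemma pt_eq {n : ℕ} {Λ κ : ℝ} {a : Fin n → Fin n → EuS n → ℝ → ℝ} {ρ : EuS n → ℝ → ℝ}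
    {f : EuS n → ℝ} {F : EuS n → ℝ → EuS n → ℝ} {c₂ : Fin n → Fin n → EuS n → ℝ → ℝ}
    {c₁ : Fin n → EuS n → ℝ → ℝ} {c₀ : EuS n → ℝ → ℝ} {φ : EuS n → ℝ}
    (hG : GoodCoeffs n Λ a ρ f F)
    (ha : ∀ i j, ContDiffOn ℝ 1 (fun p : EuS n × ℝ => a i j p.1 p.2) (ball 0 1 ×ˢ univ))
    (hF : ∀ x ∈ ball (0 : EuS n) 1, ∀ (z : ℝ) (p : EuS n),
            F x z p = (∑ i : Fin n, ∑ j : Fin n, c₂ i j x z * p i * p j)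
              + (∑ i : Fin n, c₁ i x z * p i) + c₀ x z)
    (hS : IsSolution n κ a ρ f F φ) (hφ : ContDiffOn ℝ 2 φ (ball 0 1)) {x : EuS n}
    (hx : x ∈ ball (0 : EuS n) 1) :
    trA (fun i j => a i j x (φ x)) (hess φ x) = (cdat a ρ f c₂ c₁ c₀ φ x).hv (fderiv ℝ φ x) := by
  obtain ⟨-, hsym, -, hρc, -, hfc, -, hFc, -⟩ := hG
  obtain ⟨hφ1, -, hw⟩ := hS
  have hU : IsOpen (ball (0 : EuS n) 1) := isOpen_ball
  have hd : ContDiffOn ℝ 1 (fderiv ℝ φ) (ball 0 1) := hφ.fderiv_of_isOpen hU (by norm_num)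
  have hV : ∀ j, ContDiffOn ℝ 1 (fun y => ∑ i, a i j y (φ y) * fderiv ℝ φ y (ee i)) (ball 0 1) := by
    intro j
    refine ContDiffOn.sum fun i _ => ?_
    exact (contDiffOn_graph (ha i j) hφ1).mul (hd.clm_apply contDiffOn_const)
  have hgr : ContinuousOn (gradient φ) (ball 0 1) := by
    unfold gradient
    exact (LinearIsometryEquiv.continuous _).comp_continuousOn hd.continuousOn
  have hφc := hφ1.continuousOn
  have hGc : ContinuousOn (fun x => ρ x (φ x) * (1 - (1/2) * f x * Real.exp (φ x) +
      F x (φ x) (gradient φ x))) (ball 0 1) := by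
    refine ContinuousOn.mul ?_ (ContinuousOn.add ?_ ?_)
    · exact ContinuousOn.comp (g := fun p : EuS n × ℝ => ρ p.1 p.2) hρc
        (continuousOn_id.prodMk hφc) (fun u hu => ⟨hu, mem_univ _⟩)
    · exact continuousOn_const.sub ((continuousOn_const.mul hfc).mul
        (Real.continuous_exp.comp_continuousOn hφc))
    · exact ContinuousOn.comp (g := fun p : EuS n × ℝ × EuS n => F p.1 p.2.1 p.2.2) hFc
        (continuousOn_id.prodMk (hφc.prodMk hgr)) (fun u hu => ⟨hu, mem_univ _⟩)
  have key := weak_pt hU hV hGc (by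
    intro ψ h1 h2 h3
    rw [← hw ψ h1 h2 h3]
    refine integral_congr_ae (Filter.Eventually.of_forall fun y => ?_)
    simp only [Finset.sum_mul]
    rw [Finset.sum_comm]
    rfl) x hx
  have e1 : ∀ j, fderiv ℝ (fun y => ∑ i, a i j y (φ y) * fderiv ℝ φ y (ee i)) x (ee j) = _ :=
    fun j => hasFDerivAt_flux hU (a := fun i => a i j) (fun i => ha i j) hφ hx (ee j)
  simp only [e1] at key
  have e2 : trA (fun i j => a i j x (φ x)) (hess φ x) =
      ∑ j, ∑ i, a i j x (φ x) * hess φ x (ee j) (ee i) := by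
    unfold trA
    refine Finset.sum_congr rfl fun i _ => Finset.sum_congr rfl fun j _ => ?_
    rw [hsym j i]
  have e3 : qsum (cdat a ρ f c₂ c₁ c₀ φ x).Q (fderiv ℝ φ x) =
      ∑ j, ∑ i, deriv (fun w => a i j x w) (φ x) * fderiv ℝ φ x (ee j) * fderiv ℝ φ x (ee i) := by
    unfold qsum
    rw [Finset.sum_comm]
    refine Finset.sum_congr rfl fun i _ => Finset.sum_congr rfl fun j _ => ?_
    simp only [cdat]; ring
  have e4 : F x (φ x) (gradient φ x) = qsum (cdat a ρ f c₂ c₁ c₀ φ x).c2 (fderiv ℝ φ x) +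
      lsum (cdat a ρ f c₂ c₁ c₀ φ x).c1 (fderiv ℝ φ x) + (cdat a ρ f c₂ c₁ c₀ φ x).c0 := by
    rw [hF x hx]
    simp only [gradient_coord, qsum, lsum, cdat, mul_assoc]
  rw [e4] at key
  have e5 : ∑ j, ∑ i, ((fderiv ℝ (fun y => a i j y (φ x)) x (ee j) +
      deriv (fun w => a i j x w) (φ x) * fderiv ℝ φ x (ee j)) *
        fderiv ℝ φ x (ee i) + a i j x (φ x) * hess φ x (ee j) (ee i)) =
      (∑ j, lsum (fun i => (cdat a ρ f c₂ c₁ c₀ φ x).P i j) (fderiv ℝ φ x)) +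
      qsum (cdat a ρ f c₂ c₁ c₀ φ x).Q (fderiv ℝ φ x) +
      trA (fun i j => a i j x (φ x)) (hess φ x) := by
    rw [e2, e3]
    unfold lsum
    simp only [← Finset.sum_add_distrib]
    refine Finset.sum_congr rfl fun i _ => Finset.sum_congr rfl fun j _ => ?_
    simp only [cdat]; ring
  rw [e5] at key
  unfold CData.hv CData.S
  simp only [cdat] at key ⊢
  linarith

lemma exists_cutoff {n : ℕ} {φ : EuS n → ℝ} (hφ : ContDiffOn ℝ 2 φ (ball (0 : EuS n) 1)) :
    ∃ g : EuS n → ℝ, ContDiff ℝ 2 g ∧ ∀ x ∈ ball (0 : EuS n) (3/4), g x = φ x := by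
  let χ : ContDiffBump (0 : EuS n) := ⟨3/4, 7/8, by norm_num, by norm_num⟩
  have hχ : ContDiff ℝ 2 χ := χ.contDiff (n := 2)
  refine ⟨fun x => χ x * φ x, ?_, ?_⟩
  · rw [contDiff_iff_contDiffAt]
    intro x
    by_cases hx : x ∈ ball (0 : EuS n) 1
    · exact hχ.contDiffAt.mul (hφ.contDiffAt (isOpen_ball.mem_nhds hx))
    · have hx' : x ∉ tsupport χ := by
        rw [χ.tsupport_eq]
        intro h
        apply hx
        have h1 : dist x 0 ≤ 7/8 := h
        exact mem_ball.mpr (by linarith)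
      have h0 : χ =ᶠ[nhds x] 0 := notMem_tsupport_iff_eventuallyEq.mp hx'
      have : (fun x => χ x * φ x) =ᶠ[nhds x] fun _ => (0:ℝ) := by
        filter_upwards [h0] with y hy
        rw [hy]; simp
      exact contDiffAt_const.congr_of_eventuallyEq this
  · intro x hx
    have : χ x = 1 := χ.one_of_mem_closedBall (ball_subset_closedBall hx)
    change χ x * φ x = φ x
    rw [this, one_mul]

lemma fderiv_hess_eq {n : ℕ} {φ g : EuS n → ℝ} {r : ℝ}
    (h : ∀ x ∈ ball (0 : EuS n) r, g x = φ x) {x : EuS n} (hx : x ∈ ball (0 : EuS n) r) :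
    fderiv ℝ g x = fderiv ℝ φ x ∧ hess g x = hess φ x := by
  have e : g =ᶠ[nhds x] φ := by
    filter_upwards [isOpen_ball.mem_nhds hx] with y hy using h y hy
  exact ⟨e.fderiv.eq_of_nhds, e.fderiv.fderiv.eq_of_nhds⟩

lemma rpow_third {r : ℝ} (h0 : 0 ≤ r) (h : r ≤ 2) : r ≤ 2 * r ^ (1/3:ℝ) := by
  have e : r = r ^ (1/3:ℝ) * r ^ (2/3:ℝ) := by
    rw [← Real.rpow_add_of_nonneg h0 (by norm_num) (by norm_num)]
    norm_num
  have h1 : r ^ (2/3:ℝ) ≤ 2 := by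
    calc r ^ (2/3:ℝ) ≤ 2 ^ (2/3:ℝ) := Real.rpow_le_rpow h0 h (by norm_num)
      _ ≤ 2 ^ (1:ℝ) := Real.rpow_le_rpow_of_exponent_le (by norm_num) (by norm_num)
      _ = 2 := by norm_num
  have h2 : 0 ≤ r ^ (1/3:ℝ) := Real.rpow_nonneg h0 _
  calc r = r ^ (1/3:ℝ) * r ^ (2/3:ℝ) := e
    _ ≤ r ^ (1/3:ℝ) * 2 := by gcongr
    _ = _ := by ring

lemma build_pw {n : ℕ} {Λ Λ₁ Λ₂ M κ : ℝ} (hΛ₁ : 0 < Λ₁) (hΛ₂ : 0 < Λ₂) (hM : 1 ≤ M)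
    (hκ : 1 ≤ κ)
    {a : Fin n → Fin n → EuS n → ℝ → ℝ} {ρ : EuS n → ℝ → ℝ}
    {f : EuS n → ℝ} {F : EuS n → ℝ → EuS n → ℝ} {c₂ : Fin n → Fin n → EuS n → ℝ → ℝ}
    {c₁ : Fin n → EuS n → ℝ → ℝ} {c₀ : EuS n → ℝ → ℝ} {φ g : EuS n → ℝ}
    (hG : GoodCoeffs n Λ a ρ f F) (h1 : C1Bound n Λ₁ a) (h2 : C2Bound n Λ₂ a)
    (hρ : C1NormLE n M ρ)
    (hf : ∀ x ∈ ball (0 : EuS n) 1, ∀ y ∈ ball (0 : EuS n) 1,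
            |f x - f y| ≤ M * ‖x - y‖ ^ ((1:ℝ)/3))
    (hc2 : ∀ i j, C1NormLE n M (c₂ i j)) (hc1 : ∀ i, C1NormLE n M (c₁ i)) (hc0 : C1NormLE n M c₀)
    (hF : ∀ x ∈ ball (0 : EuS n) 1, ∀ (z : ℝ) (p : EuS n),
            F x z p = (∑ i : Fin n, ∑ j : Fin n, c₂ i j x z * p i * p j)
              + (∑ i : Fin n, c₁ i x z * p i) + c₀ x z)
    (hS : IsSolution n κ a ρ f F φ) (hφ : ContDiffOn ℝ 2 φ (ball 0 1))
    (hg : ContDiff ℝ 2 g) (hgφ : ∀ x ∈ ball (0 : EuS n) (3/4), g x = φ x) :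
    PW n Λ (16 * (n ^ 2 + n + 1) * (Λ₁ + Λ₂ + M)) κ g (fun x i j => a i j x (φ x))
      (fun x => (cdat a ρ f c₂ c₁ c₀ φ x).hv (fderiv ℝ φ x)) := by
  have hU : IsOpen (ball (0 : EuS n) 1) := isOpen_ball
  have hc : Convex ℝ (ball (0 : EuS n) 1) := convex_ball 0 1
  have hsub : ball (0 : EuS n) (3/4) ⊆ ball 0 1 := ball_subset_ball (by norm_num)
  have hpt := fun x (hx : x ∈ ball (0 : EuS n) (3/4)) =>
    pt_eq hG h1.1 hF hS hφ (hsub hx)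
  have hG' := hG
  obtain ⟨-, hsym, hell, -, hρb, -, hfb, -, hFb⟩ := hG'
  obtain ⟨hφ1, hrng, -⟩ := hS
  set L := Λ₁ + Λ₂ + M with hL
  have hL1 : 1 ≤ L := by linarith
  have hL0 : 0 ≤ L := by linarith
  have hfd := fun x (hx : x ∈ ball (0 : EuS n) (3/4)) => fderiv_hess_eq hgφ hx
  have c1n : ∀ c : EuS n → ℝ → ℝ, C1NormLE n M c → ∀ x ∈ ball (0 : EuS n) 1, ∀ z,
      |c x z| ≤ L := by
    intro c hc x hx z
    have := hc.2 x hx z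
    have h0 := norm_nonneg (fderiv ℝ (fun p : EuS n × ℝ => c p.1 p.2) (x, z))
    linarith
  have c1l : ∀ c : EuS n → ℝ → ℝ, C1NormLE n M c → ∀ x ∈ ball (0 : EuS n) 1,
      ∀ y ∈ ball (0 : EuS n) 1, ∀ z w, |c x z - c y w| ≤ L * (‖x - y‖ + |z - w|) := by
    intro c hc' x hx y hy z w
    refine c1_lip hU hc hc'.1 hL0 ?_ hx hy z w
    intro x hx z
    have := hc'.2 x hx z
    have h0 := abs_nonneg (c x z)
    linarith
  have hok : ∀ x ∈ ball (0 : EuS n) 1, (cdat a ρ f c₂ c₁ c₀ φ x).Ok L κ := by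
    intro x hx
    refine ⟨?_, ?_, ?_, ?_, ?_, ?_, ?_⟩
    · intro i j
      have := h1.2 i j x hx (φ x)
      have h0 := abs_nonneg (deriv (fun w => a i j x w) (φ x))
      have h3 := comp_le (fderiv ℝ (fun y => a i j y (φ x)) x) j
      simp only [cdat]
      linarith
    · intro i j
      have := h1.2 i j x hx (φ x)
      have h0 := norm_nonneg (fderiv ℝ (fun y => a i j y (φ x)) x)
      simp only [cdat]
      linarith
    · exact fun i j => c1n _ (hc2 i j) x hx _
    · exact fun i => c1n _ (hc1 i) x hx _
    · have := hρb x hx (φ x)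
      simp only [cdat]
      rw [abs_le]; constructor <;> linarith
    · have := hfb x hx
      simp only [cdat]
      rw [abs_le]; constructor <;> linarith
    · exact (hrng x hx).2
  have hlip : ∀ x ∈ ball (0 : EuS n) 1, ∀ y ∈ ball (0 : EuS n) 1,
      (cdat a ρ f c₂ c₁ c₀ φ x).Lip (cdat a ρ f c₂ c₁ c₀ φ y) L (‖x - y‖ + |φ x - φ y|)
        (‖x - y‖ ^ (1/3:ℝ)) := by
    intro x hx y hy
    have ht : 0 ≤ ‖x - y‖ + |φ x - φ y| := by positivity
    have hΛ2L : Λ₂ * (‖x - y‖ + |φ x - φ y|) ≤ L * (‖x - y‖ + |φ x - φ y|) := by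
      gcongr; linarith
    refine ⟨?_, ?_, ?_, ?_, ?_, ?_, ?_⟩
    · intro i j
      have h3 := P_lip hU hc (h2.1 i j) (h2.2 i j) hΛ₂.le hx hy (φ x) (φ y)
      have h4 := comp_le (fderiv ℝ (fun u => a i j u (φ x)) x -
        fderiv ℝ (fun u => a i j u (φ y)) y) j
      rw [_root_.sub_apply] at h4
      exact h4.trans (h3.trans hΛ2L)
    · intro i j
      exact (Q_lip hU hc (h2.1 i j) (h2.2 i j) hx hy (φ x) (φ y)).trans hΛ2L
    · exact fun i j => c1l _ (hc2 i j) x hx y hy _ _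
    · exact fun i => c1l _ (hc1 i) x hx y hy _ _
    · exact c1l _ hc0 x hx y hy _ _
    · exact c1l _ hρ x hx y hy _ _
    · refine (hf x hx y hy).trans ?_
      have : M ≤ L := by linarith
      gcongr
  have hFq : ∀ x ∈ ball (0 : EuS n) 1,
      |qsum (cdat a ρ f c₂ c₁ c₀ φ x).c2 (fderiv ℝ φ x) +
      lsum (cdat a ρ f c₂ c₁ c₀ φ x).c1 (fderiv ℝ φ x) + (cdat a ρ f c₂ c₁ c₀ φ x).c0| ≤
      ‖fderiv ℝ φ x‖ ^ 2 + 1 := by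
    intro x hx
    have e4 : F x (φ x) (gradient φ x) = qsum (cdat a ρ f c₂ c₁ c₀ φ x).c2 (fderiv ℝ φ x) +
        lsum (cdat a ρ f c₂ c₁ c₀ φ x).c1 (fderiv ℝ φ x) + (cdat a ρ f c₂ c₁ c₀ φ x).c0 := by
      rw [hF x hx]
      simp only [gradient_coord, qsum, lsum, cdat, mul_assoc]
    rw [← e4, ← norm_gradient_eq]
    exact hFb x hx _ _
  have hκ0 : 0 ≤ κ := by linarith
  refine ⟨hg, ?_, ?_, ?_, ?_, ?_, ?_⟩
  · intro x hx
    exact ⟨fun i j => hsym i j _ _, fun ξ => hell x (hsub hx) _ ξ⟩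
  · intro x hx
    rw [(hfd x hx).2]
    exact hpt x hx
  · intro x hx
    rw [hgφ x hx]; exact hrng x (hsub hx)
  · intro x hx
    rw [(hfd x hx).1]
    exact hv_le (hok x (hsub hx)) hL1 hκ0 _ (hFq x (hsub hx))
  · intro x hx y hy i j
    rw [hgφ x hx, hgφ y hy]
    have h3 : |a i j x (φ x) - a i j y (φ y)| ≤ Λ₁ * (‖x - y‖ + |φ x - φ y|) := by
      refine sep_lip (g := a i j) hc ?_ ?_ ?_ ?_ (hsub hx) (hsub hy) (φ x) (φ y)
      · exact fun x hx z => (slice_x hU (h1.1 i j) hx z).differentiableAt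
      · exact fun x hx z => (slice_z hU (h1.1 i j) hx z).differentiableAt
      · intro x hx z
        have := h1.2 i j x hx z
        linarith [abs_nonneg (deriv (fun w => a i j x w) z)]
      · intro x hx z
        have := h1.2 i j x hx z
        linarith [norm_nonneg (fderiv ℝ (fun y => a i j y z) x)]
    refine h3.trans ?_
    have hn : (0:ℝ) ≤ n := Nat.cast_nonneg n
    have hK : Λ₁ ≤ 16 * (n ^ 2 + n + 1) * L := by nlinarith [sq_nonneg (n:ℝ)]
    gcongr
  · intro x hx y hy
    rw [(hfd x hx).1, (hfd y hy).1, hgφ x hx, hgφ y hy]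
    have hxy : ‖x - y‖ ≤ 2 := by
      have a1 := mem_ball_zero_iff.mp hx
      have a2 := mem_ball_zero_iff.mp hy
      have := norm_sub_le x y
      linarith
    have hr := rpow_third (norm_nonneg (x - y)) hxy
    refine hv_diff (hok x (hsub hx)) (hok y (hsub hy)) (hlip x (hsub hx) y (hsub hy)) hL1 hκ0
      (by positivity) (by positivity) ?_ _ _ (hFq x (hsub hx))
    have := abs_nonneg (φ x - φ y)
    change ‖x - y‖ + |φ x - φ y| ≤ 2 * (‖x - y‖ ^ (1/3:ℝ) + |φ x - φ y|)
    linarith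

lemma norm_it2_le {n : ℕ} (φ : EuS n → ℝ) (x : EuS n) :
    ‖iteratedFDeriv ℝ 2 φ x‖ ≤ ‖hess φ x‖ := by
  refine ContinuousMultilinearMap.opNorm_le_bound (ContinuousLinearMap.opNorm_nonneg _) fun m => ?_
  rw [iteratedFDeriv_two_apply, Fin.prod_univ_two, ← mul_assoc]
  exact ContinuousLinearMap.le_opNorm₂ (hess φ x) (m 0) (m 1)

lemma norm_it2_sub_le {n : ℕ} (φ : EuS n → ℝ) (x y : EuS n) :
    ‖iteratedFDeriv ℝ 2 φ x - iteratedFDeriv ℝ 2 φ y‖ ≤ ‖hess φ x - hess φ y‖ := by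
  refine ContinuousMultilinearMap.opNorm_le_bound (ContinuousLinearMap.opNorm_nonneg _) fun m => ?_
  rw [_root_.sub_apply, iteratedFDeriv_two_apply, iteratedFDeriv_two_apply,
    Fin.prod_univ_two, ← mul_assoc]
  exact ContinuousLinearMap.le_opNorm₂ (hess φ x - hess φ y) (m 0) (m 1)

lemma final_const {C κ Λ : ℝ} (hC : 1 ≤ C) (hκ : 1 ≤ κ) (hΛ : 1 ≤ Λ) :
    3 * exp (C * κ) ≤ ((C + 3) * exp κ) ^ ((C + 3) * exp (4 * Λ * κ)) := by
  have h1 : 1 ≤ exp κ := by simpa using (by linarith : 0 ≤ κ)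
  have h2 : 1 ≤ exp (4 * Λ * κ) := by simpa using (by positivity : 0 ≤ 4 * Λ * κ)
  have h3 : 1 ≤ (C + 3) * exp κ := by nlinarith
  calc 3 * exp (C * κ) ≤ (C + 3) * exp (κ * (C + 3)) := by
        have : exp (C * κ) ≤ exp (κ * (C + 3)) := exp_le_exp.mpr (by nlinarith)
        have h5 := exp_pos (κ * (C + 3))
        nlinarith
    _ ≤ (C + 3) ^ (C + 3) * exp (κ * (C + 3)) := by
        have : (C + 3) ^ (1:ℝ) ≤ (C + 3) ^ (C + 3) :=
          Real.rpow_le_rpow_of_exponent_le (by linarith) (by linarith)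
        rw [Real.rpow_one] at this
        gcongr
    _ = ((C + 3) * exp κ) ^ (C + 3) := by
        rw [Real.mul_rpow (by linarith) (exp_pos κ).le, Real.exp_mul]
    _ ≤ _ := Real.rpow_le_rpow_of_exponent_le h3 (by nlinarith)

/-- **Interior Schauder (second-derivative Hölder) estimate**
(Theorem 4.4 / `theorem-Holder-second derivative`): under the additional regularity
hypotheses on the coefficients, with `F` of the natural quadratic form in the gradient,
there is a constant `C > 0` depending only on `n`, `Λ`, `Λ₁`, `Λ₂` and `M` such that
every `C²` solution `φ` satisfies
`sup_{B_{1/2}} (|φ| + |∇φ| + |∇²φ|) ≤ (C e^κ)^{C e^{4Λκ}}` and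
`|∇²φ(x) - ∇²φ(y)| ≤ (C e^κ)^{C e^{4Λκ}} |x - y|^{1/3}` on `B_{1/2}`. -/
theorem interior_Schauder (n : ℕ) (hn : 2 ≤ n) (Λ Λ₁ Λ₂ M : ℝ)
    (hΛ : 1 ≤ Λ) (hΛ₁ : 0 < Λ₁) (hΛ₂ : 0 < Λ₂) (hM : 1 ≤ M) :
    ∃ C > (0:ℝ),
      ∀ κ : ℝ, 1 ≤ κ →
      ∀ (a : Fin n → Fin n → EuclideanSpace ℝ (Fin n) → ℝ → ℝ)
        (ρ : EuclideanSpace ℝ (Fin n) → ℝ → ℝ)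
        (f : EuclideanSpace ℝ (Fin n) → ℝ)
        (F : EuclideanSpace ℝ (Fin n) → ℝ → EuclideanSpace ℝ (Fin n) → ℝ)
        (c₂ : Fin n → Fin n → EuclideanSpace ℝ (Fin n) → ℝ → ℝ)
        (c₁ : Fin n → EuclideanSpace ℝ (Fin n) → ℝ → ℝ)
        (c₀ : EuclideanSpace ℝ (Fin n) → ℝ → ℝ),
        GoodCoeffs n Λ a ρ f F → C1Bound n Λ₁ a → C2Bound n Λ₂ a →
        -- `ρ` is `C¹` with `C¹`-norm at most `M`
        C1NormLE n M ρ →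
        -- `f` has Hölder-`1/3` seminorm at most `M`
        (∀ x ∈ ball (0 : EuclideanSpace ℝ (Fin n)) 1,
         ∀ y ∈ ball (0 : EuclideanSpace ℝ (Fin n)) 1,
            |f x - f y| ≤ M * ‖x - y‖ ^ ((1:ℝ)/3)) →
        -- the coefficients of `F` are `C¹` with `C¹`-norms at most `M`
        (∀ i j, C1NormLE n M (c₂ i j)) → (∀ i, C1NormLE n M (c₁ i)) → C1NormLE n M c₀ →
        -- `F(x,z,p) = Σᵢⱼ c₂ᵢⱼ(x,z) pᵢ pⱼ + Σᵢ c₁ᵢ(x,z) pᵢ + c₀(x,z)`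
        (∀ x ∈ ball (0 : EuclideanSpace ℝ (Fin n)) 1,
         ∀ (z : ℝ) (p : EuclideanSpace ℝ (Fin n)),
            F x z p = (∑ i : Fin n, ∑ j : Fin n, c₂ i j x z * p i * p j)
              + (∑ i : Fin n, c₁ i x z * p i) + c₀ x z) →
        ∀ φ : EuclideanSpace ℝ (Fin n) → ℝ, IsSolution n κ a ρ f F φ →
          ContDiffOn ℝ 2 φ (ball (0 : EuclideanSpace ℝ (Fin n)) 1) →
          (∀ x ∈ ball (0 : EuclideanSpace ℝ (Fin n)) (1/2),
            |φ x| + ‖gradient φ x‖ + ‖iteratedFDeriv ℝ 2 φ x‖ ≤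
              (C * Real.exp κ) ^ (C * Real.exp (4 * Λ * κ))) ∧
          (∀ x ∈ ball (0 : EuclideanSpace ℝ (Fin n)) (1/2),
           ∀ y ∈ ball (0 : EuclideanSpace ℝ (Fin n)) (1/2),
            ‖iteratedFDeriv ℝ 2 φ x - iteratedFDeriv ℝ 2 φ y‖ ≤
              (C * Real.exp κ) ^ (C * Real.exp (4 * Λ * κ)) *
                ‖x - y‖ ^ ((1:ℝ)/3)) := by
  obtain ⟨C, hC, hmain⟩ := pw_final n (by omega) Λ (16 * (n ^ 2 + n + 1) * (Λ₁ + Λ₂ + M)) hΛ (by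
    have hn0 : (0:ℝ) ≤ n := Nat.cast_nonneg n
    have hq : (0:ℝ) ≤ (n:ℝ) ^ 2 := by positivity
    have hL : 1 ≤ Λ₁ + Λ₂ + M := by linarith
    nlinarith)
  refine ⟨C + 3, by linarith, ?_⟩
  intro κ hκ a ρ f F c₂ c₁ c₀ hG h1 h2 hρ hf hc2 hc1 hc0 hF φ hS hφ
  obtain ⟨g, hg, hgφ⟩ := exists_cutoff hφ
  have hpw := build_pw hΛ₁ hΛ₂ hM hκ hG h1 h2 hρ hf hc2 hc1 hc0 hF hS hφ hg hgφ
  obtain ⟨hA, hB⟩ := hmain κ g _ _ hκ hpw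
  have hfin := final_const (Λ := Λ) hC hκ hΛ
  have hpos := exp_pos (C * κ)
  have hsub : ball (0 : EuclideanSpace ℝ (Fin n)) (1/2) ⊆ ball 0 (3/4) :=
    ball_subset_ball (by norm_num)
  have hsub1 : ball (0 : EuclideanSpace ℝ (Fin n)) (1/2) ⊆ ball 0 1 :=
    ball_subset_ball (by norm_num)
  constructor
  · intro x hx
    obtain ⟨e1, e2⟩ := fderiv_hess_eq hgφ (hsub hx)
    obtain ⟨b1, b2⟩ := hA x hx
    rw [e1] at b1
    rw [e2] at b2
    have r := hS.2.1 x (hsub1 hx)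
    have b0 : |φ x| ≤ exp (C * κ) := by
      rw [abs_of_nonneg r.1]
      have : κ + 1 ≤ exp κ := add_one_le_exp κ
      have h3 : exp κ ≤ exp (C * κ) := exp_le_exp.mpr (by nlinarith)
      linarith [r.2]
    have b3 := norm_it2_le φ x
    have b4 := norm_gradient_eq φ x
    rw [b4]
    linarith
  · intro x hx y hy
    have b := hB x hx y hy
    rw [(fderiv_hess_eq hgφ (hsub hx)).2, (fderiv_hess_eq hgφ (hsub hy)).2] at b
    refine (norm_it2_sub_le φ x y).trans (b.trans ?_)
    have : exp (C * κ) ≤ (((C + 3) * Real.exp κ) ^ ((C + 3) * Real.exp (4 * Λ * κ))) := by linarith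
    gcongr
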